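/- arXiv:2011.06915 — 9 statements merged into one kernel-verified Lean document; each statement's English description precedes it below -/
import Mathlib

section
/- Let I ⊆ ℝ be an open interval, let h : I → ℝ be continuously differentiable, let s₀ ∈ I and let w₀ ∈ ℝ with |w₀| < 1. Then there exists a differentiable function w : I → ℝ, defined on all of I, such that w(s₀) = w₀, w'(s) = (1 − w(s)²)·(1 − w(s)·h(s)) for every s ∈ I, and −1 < w(s) < 1 for every s ∈ I. -/
open Set Filter

noncomputable def bclip (x : ℝ) : ℝ := max (-1) (min 1 x)

noncomputable def bfield (h : ℝ → ℝ) (t x : ℝ) : ℝ :=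
  (1 - bclip x ^ 2) * (1 - bclip x * h t)

lemma bclip_mem (x : ℝ) : -1 ≤ bclip x ∧ bclip x ≤ 1 := by
  unfold bclip
  exact ⟨le_max_left _ _, max_le (by norm_num) (min_le_left _ _)⟩

lemma bclip_eq {x : ℝ} (h1 : -1 ≤ x) (h2 : x ≤ 1) : bclip x = x := by
  unfold bclip
  rw [min_eq_right h2, max_eq_right h1]

lemma bclip_sub (x y : ℝ) : |bclip x - bclip y| ≤ |x - y| := by
  unfold bclip
  refine (abs_max_sub_max_le_max _ _ _ _).trans ?_
  refine max_le (by simp) ?_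
  refine (abs_min_sub_min_le_max _ _ _ _).trans ?_
  exact max_le (by simp) le_rfl

lemma bfield_lip (h : ℝ → ℝ) (t M : ℝ) (hM0 : 0 ≤ M) (hM : |h t| ≤ M) :
    LipschitzWith (Real.toNNReal (2 + 4 * M)) (bfield h t) := by
  refine LipschitzWith.of_dist_le_mul fun x y => ?_
  rw [Real.coe_toNNReal _ (by positivity), Real.dist_eq, Real.dist_eq]
  have e := bclip_sub x y
  obtain ⟨a1, a2⟩ := bclip_mem x
  obtain ⟨b1, b2⟩ := bclip_mem y
  unfold bfield
  generalize bclip x = u at *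
  generalize bclip y = v at *
  have : (1 - u ^ 2) * (1 - u * h t) - (1 - v ^ 2) * (1 - v * h t)
      = (-(u + v) + h t * (u ^ 2 + u * v + v ^ 2 - 1)) * (u - v) := by ring
  rw [this, abs_mul]
  refine mul_le_mul ?_ e (abs_nonneg _) (by positivity)
  refine (abs_add_le _ _).trans (add_le_add ?_ ?_)
  · rw [abs_le]; constructor <;> linarith
  · rw [abs_mul, mul_comm]
    refine mul_le_mul ?_ hM (abs_nonneg _) (by norm_num)
    rw [abs_le]; constructor <;> nlinarith

lemma bfield_bound (h : ℝ → ℝ) (t x M : ℝ) (hM : |h t| ≤ M) :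
    |bfield h t x| ≤ 1 + M := by
  obtain ⟨a1, a2⟩ := bclip_mem x
  unfold bfield
  generalize bclip x = u at *
  rw [abs_mul]
  have h1 : |1 - u ^ 2| ≤ 1 := by rw [abs_le]; constructor <;> nlinarith
  have h2 : |1 - u * h t| ≤ 1 + M := by
    refine (abs_sub _ _).trans ?_
    rw [abs_one, abs_mul]
    have : |u| ≤ 1 := abs_le.2 ⟨a1, a2⟩
    nlinarith [abs_nonneg u, abs_nonneg (h t)]
  nlinarith [abs_nonneg (1 - u ^ 2), abs_nonneg (1 - u * h t)]

/-- bounded `h` on the interval -/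
lemma bexists_M {h : ℝ → ℝ} {A B : ℝ} (hc : ContinuousOn h (Icc A B)) :
    ∃ M : ℝ, 0 ≤ M ∧ ∀ t ∈ Icc A B, |h t| ≤ M := by
  obtain ⟨C, hC⟩ := isCompact_Icc.exists_bound_of_continuousOn hc
  exact ⟨max 0 C, le_max_left _ _, fun t ht => (hC t ht).trans (le_max_right _ _)⟩

lemma bunique {h : ℝ → ℝ} {A B : ℝ} (hc : ContinuousOn h (Icc A B)) {f g : ℝ → ℝ} {t₀ : ℝ}
    (ht : t₀ ∈ Ioo A B)
    (hf : ∀ t ∈ Ioo A B, HasDerivAt f (bfield h t (f t)) t)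
    (hg : ∀ t ∈ Ioo A B, HasDerivAt g (bfield h t (g t)) t)
    (heq : f t₀ = g t₀) : EqOn f g (Ioo A B) := by
  obtain ⟨M, hM0, hM⟩ := bexists_M hc
  exact ODE_solution_unique_of_mem_Ioo (v := bfield h) (s := fun _ => univ)
    (fun t ht => (bfield_lip h t M hM0 (hM t (Ioo_subset_Icc_self ht))).lipschitzOnWith)
    ht (fun t ht => ⟨hf t ht, trivial⟩) (fun t ht => ⟨hg t ht, trivial⟩) heq

lemma blocal {h : ℝ → ℝ} {A B : ℝ} (hc : ContinuousOn h (Icc A B)) {s₀ w₀ : ℝ}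
    (hs : s₀ ∈ Ioo A B) (hw₀ : |w₀| < 1) :
    ∃ w : ℝ → ℝ, w s₀ = w₀ ∧ (∀ t ∈ Ioo A B, HasDerivAt w (bfield h t (w t)) t) ∧
      ∀ t ∈ Ioo A B, -1 < w t ∧ w t < 1 := by
  obtain ⟨M, hM0, hM⟩ := bexists_M hc
  have hAB : A < B := hs.1.trans hs.2
  have hpl : IsPicardLindelof (bfield h) (⟨s₀, Ioo_subset_Icc_self hs⟩ : Icc A B) w₀
      (Real.toNNReal ((1 + M) * (B - A))) 0 (Real.toNNReal (1 + M))
      (Real.toNNReal (2 + 4 * M)) := by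
    refine ⟨fun t ht => (bfield_lip h t M hM0 (hM t ht)).lipschitzOnWith, fun x _ => ?_,
      fun t ht x _ => ?_, ?_⟩
    · unfold bfield
      fun_prop
    · rw [Real.coe_toNNReal _ (by positivity)]
      exact bfield_bound h t x M (hM t ht)
    · rw [Real.coe_toNNReal _ (by positivity),
        Real.coe_toNNReal _ (mul_nonneg (by positivity) (by linarith))]
      simp only [NNReal.coe_zero, sub_zero]
      refine mul_le_mul_of_nonneg_left (max_le ?_ ?_) (by positivity) <;>
        linarith [hs.1, hs.2]
  obtain ⟨w, hw, hd⟩ := hpl.exists_eq_forall_mem_Icc_hasDerivWithinAt₀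
  have hd' : ∀ t ∈ Ioo A B, HasDerivAt w (bfield h t (w t)) t := fun t ht =>
    (hd t (Ioo_subset_Icc_self ht)).hasDerivAt (Icc_mem_nhds ht.1 ht.2)
  simp only at hw
  rw [abs_lt] at hw₀
  have hcw : ContinuousOn w (Ioo A B) := HasDerivAt.continuousOn hd'
  have key : ∀ c : ℝ, c ^ 2 = 1 → c ≠ w₀ → ∀ t ∈ Ioo A B, w t ≠ c := by
    intro c hc1 hcw0 t ht hwt
    have hcc : bclip c = c := bclip_eq (by nlinarith) (by nlinarith)
    have := bunique hc ht hd' (g := fun _ => c) (fun t _ => by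
      have : bfield h t c = 0 := by unfold bfield; rw [hcc, hc1]; ring
      rw [this]; exact hasDerivAt_const t c) hwt hs
    exact hcw0 (by rw [← hw]; exact this.symm)
  have hconn : IsPreconnected (Ioo A B) := isPreconnected_Ioo
  refine ⟨w, hw, hd', fun t ht => ⟨?_, ?_⟩⟩
  · by_contra! hlt
    obtain ⟨u, hu, hu'⟩ := hconn.intermediate_value ht hs hcw
      (show (-1 : ℝ) ∈ Icc (w t) (w s₀) from ⟨hlt, by rw [hw]; exact hw₀.1.le⟩)
    exact key (-1) (by norm_num) hw₀.1.ne u hu hu'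
  · by_contra! hlt
    obtain ⟨u, hu, hu'⟩ := hconn.intermediate_value hs ht hcw
      (show (1 : ℝ) ∈ Icc (w s₀) (w t) from ⟨by rw [hw]; exact hw₀.2.le, hlt⟩)
    exact key 1 (by norm_num) hw₀.2.ne' u hu hu'

/-- Global existence of solutions of `w' = (1 - w²)(1 - w·h)`
confined between the barrier solutions `w ≡ ±1`, on any open interval `I`,
for continuously differentiable `h` and initial value `|w₀| < 1`. -/
theorem global_solution_between_barriers
    (I : Set ℝ) (hIopen : IsOpen I) (hIinterval : I.OrdConnected)
    (h : ℝ → ℝ) (hh : ContDiffOn ℝ 1 h I)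
    (s₀ : ℝ) (hs₀ : s₀ ∈ I) (w₀ : ℝ) (hw₀ : |w₀| < 1) :
    ∃ w : ℝ → ℝ, w s₀ = w₀ ∧
      (∀ s ∈ I, HasDerivAt w ((1 - w s ^ 2) * (1 - w s * h s)) s) ∧
      (∀ s ∈ I, -1 < w s ∧ w s < 1) := by
  have hcont := hh.continuousOn
  have step : ∀ s : ℝ, ∃ (A B : ℝ) (w : ℝ → ℝ), s ∈ I → (s ∈ Ioo A B ∧ s₀ ∈ Ioo A B ∧
      Icc A B ⊆ I ∧ w s₀ = w₀ ∧ (∀ t ∈ Ioo A B, HasDerivAt w (bfield h t (w t)) t) ∧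
      ∀ t ∈ Ioo A B, -1 < w t ∧ w t < 1) := by
    intro s
    by_cases hs : s ∈ I
    · have hmin : min s s₀ ∈ I := by rcases min_choice s s₀ with e | e <;> rw [e] <;> assumption
      have hmax : max s s₀ ∈ I := by rcases max_choice s s₀ with e | e <;> rw [e] <;> assumption
      obtain ⟨e, he, he'⟩ := Metric.isOpen_iff.1 hIopen _ hmin
      obtain ⟨d, hd, hd'⟩ := Metric.isOpen_iff.1 hIopen _ hmax
      have hA : min s s₀ - e / 2 ∈ I := he' (by
        rw [Metric.mem_ball, Real.dist_eq, abs_lt]; constructor <;> linarith)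
      have hB : max s s₀ + d / 2 ∈ I := hd' (by
        rw [Metric.mem_ball, Real.dist_eq, abs_lt]; constructor <;> linarith)
      have hsub := hIinterval.out hA hB
      have m1 : s ∈ Ioo (min s s₀ - e / 2) (max s s₀ + d / 2) :=
        ⟨by linarith [min_le_left s s₀], by linarith [le_max_left s s₀]⟩
      have m2 : s₀ ∈ Ioo (min s s₀ - e / 2) (max s s₀ + d / 2) :=
        ⟨by linarith [min_le_right s s₀], by linarith [le_max_right s s₀]⟩
      obtain ⟨w, hw⟩ := blocal (hcont.mono hsub) m2 hw₀
      exact ⟨_, _, w, fun _ => ⟨m1, m2, hsub, hw⟩⟩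
    · exact ⟨0, 0, 0, fun hs' => absurd hs' hs⟩
  choose A B W hW using step
  refine ⟨fun s => W s s, (hW s₀ hs₀).2.2.2.1, fun s hs => ?_, fun s hs => ?_⟩
  · obtain ⟨m1, m2, hsub, e0, hd, hb⟩ := hW s hs
    have hloc : (fun s => W s s) =ᶠ[nhds s] W s := by
      filter_upwards [Ioo_mem_nhds m1.1 m1.2] with t ht
      obtain ⟨n1, n2, nsub, f0, nd, nb⟩ := hW t (hsub (Ioo_subset_Icc_self ht))
      refine bunique (h := h) (A := max (A s) (A t)) (B := min (B s) (B t)) (t₀ := s₀) 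
        (hcont.mono ((Icc_subset_Icc (le_max_left _ _) (min_le_left _ _)).trans hsub))
        ⟨max_lt m2.1 n2.1, lt_min m2.2 n2.2⟩
        (fun u hu => nd u (Ioo_subset_Ioo (le_max_right _ _) (min_le_right _ _) hu))
        (fun u hu => hd u (Ioo_subset_Ioo (le_max_left _ _) (min_le_left _ _) hu))
        (f0.trans e0.symm) ⟨max_lt ht.1 n1.1, lt_min ht.2 n1.2⟩
    have := (hd s m1).congr_of_eventuallyEq hloc
    unfold bfield at this
    rwa [bclip_eq (hb s m1).1.le (hb s m1).2.le] at this
  · obtain ⟨m1, m2, hsub, e0, hd, hb⟩ := hW s hs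
    exact hb s m1
end

section
/- Let n ≥ 2 be a natural number. There exists a unique function f_B : ℝ → ℝ such that f_B is even, f_B is real-analytic on ℝ, f_B(0) = 0, f_B'(0) = 0, and f_B''(s) = (1 − f_B'(s)²)·(1 − (n−1)·f_B'(s)/s) for every s ≠ 0. -/
open Set Filter

namespace Bowl
open Topology unitInterval
open scoped ContDiff


abbrev E := C(unitInterval, ℝ)

noncomputable def avgFun (k : ℕ) (g : E) : E where
  toFun := fun τ => ∫ t in (0:ℝ)..1, t ^ k * g (projIcc 0 1 zero_le_one t * τ)
  continuous_toFun := by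
    apply intervalIntegral.continuous_parametric_intervalIntegral_of_continuous'
    have : Continuous (projIcc (0:ℝ) 1 zero_le_one) := continuous_projIcc
    unfold Function.uncurry
    fun_prop

lemma avg_cont (k : ℕ) (g : E) (τ : unitInterval) :
    Continuous (fun t : ℝ => t ^ k * g (projIcc 0 1 zero_le_one t * τ)) := by
  have : Continuous (projIcc (0:ℝ) 1 zero_le_one) := continuous_projIcc
  fun_prop

noncomputable def avg (k : ℕ) : E →L[ℝ] E :=
  LinearMap.mkContinuous
    { toFun := avgFun k
      map_add' := by
        intro f g
        ext τ
        simp only [avgFun, ContinuousMap.coe_mk, ContinuousMap.add_apply, mul_add]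
        exact intervalIntegral.integral_add ((avg_cont k f τ).intervalIntegrable _ _)
          ((avg_cont k g τ).intervalIntegrable _ _)
      map_smul' := by
        intro c f
        ext τ
        simp only [avgFun, ContinuousMap.coe_mk, ContinuousMap.smul_apply, smul_eq_mul,
          RingHom.id_apply]
        rw [← intervalIntegral.integral_const_mul]
        congr 1
        ext t
        ring } 1 (by
    intro g
    rw [ContinuousMap.norm_le _ (by positivity)]
    intro τ
    have := intervalIntegral.norm_integral_le_of_norm_le_const (a := 0) (b := 1) (C := ‖g‖)
      (f := fun t : ℝ => t ^ k * g (projIcc 0 1 zero_le_one t * τ)) (by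
        intro t ht
        rw [uIoc_of_le zero_le_one] at ht
        rw [norm_mul, norm_pow, Real.norm_of_nonneg ht.1.le]
        have h1 := g.norm_coe_le_norm (projIcc 0 1 zero_le_one t * τ)
        have h2 : t ^ k ≤ 1 := pow_le_one₀ ht.1.le ht.2
        have h3 : 0 ≤ t ^ k := pow_nonneg ht.1.le _
        nlinarith [norm_nonneg g, norm_nonneg (g (projIcc 0 1 zero_le_one t * τ))])
    simpa [avgFun] using this)

lemma avg_apply (k : ℕ) (g : E) (τ : unitInterval) :
    avg k g τ = ∫ t in (0:ℝ)..1, t ^ k * g (projIcc 0 1 zero_le_one t * τ) := rfl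

/-- dilation -/
def dil (c : unitInterval) (g : E) : E := g.comp ⟨fun τ => c * τ, by fun_prop⟩

lemma dil_apply (c τ : unitInterval) (g : E) : dil c g τ = g (c * τ) := rfl

lemma dil_avg (k : ℕ) (c : unitInterval) (g : E) : avg k (dil c g) = dil c (avg k g) := by
  ext τ
  simp only [dil_apply, avg_apply]
  congr 1
  ext t
  rw [mul_left_comm]

/-- coordinate -/
def T : E := ⟨fun τ => (τ : ℝ), by fun_prop⟩

@[simp] lemma T_apply (τ : unitInterval) : T τ = τ := rfl

lemma avg_formula (k : ℕ) (u : E) (φ : ℝ → ℝ) (ε : ℝ) (h : ∀ τ : unitInterval, u τ = φ (ε * τ)) :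
    ε ^ (k + 1) * avg k u 1 = ∫ x in (0:ℝ)..ε, x ^ k * φ x := by
  have h1 := intervalIntegral.smul_integral_comp_mul_left (a := 0) (b := 1)
    (fun x => x ^ k * φ x) ε
  simp only [mul_zero, mul_one, smul_eq_mul] at h1
  rw [← h1, avg_apply, pow_succ', mul_assoc, ← intervalIntegral.integral_const_mul]
  congr 1
  apply intervalIntegral.integral_congr
  intro t ht
  rw [uIcc_of_le zero_le_one] at ht
  simp only [mul_one, h]
  rw [projIcc_of_mem _ ht]
  ring

lemma avg_zero_scale (u v : E) (τ : unitInterval) (h : ∀ t, u (t * τ) = v t) (k : ℕ) :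
    avg k u τ = avg k v 1 := by
  simp only [avg_apply, h, mul_one]

lemma prim {φ : ℝ → ℝ} {r : ℝ} (hφ : ContinuousOn φ (Ioo (-r) r)) {x : ℝ} (hx : x ∈ Ioo (-r) r) :
    HasDerivAt (fun y => ∫ t in (0:ℝ)..y, φ t) (φ x) x := by
  have h0 : (0:ℝ) ∈ Ioo (-r) r := ⟨by linarith [hx.1, hx.2], by linarith [hx.1, hx.2]⟩
  apply intervalIntegral.integral_hasDerivAt_right
  · apply ContinuousOn.intervalIntegrable
    exact hφ.mono (ordConnected_Ioo.uIcc_subset h0 hx)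
  · exact hφ.stronglyMeasurableAtFilter isOpen_Ioo x hx
  · exact hφ.continuousAt (isOpen_Ioo.mem_nhds hx)

lemma dil_norm (c : unitInterval) (g : E) : ‖dil c g‖ ≤ ‖g‖ := by
  rw [ContinuousMap.norm_le _ (norm_nonneg _)]
  intro τ
  exact g.norm_coe_le_norm _

lemma impl (F : (ℝ × ℝ × ℝ) × E → E) (hF : ContDiff ℝ ω F) (s₀ w₀ : ℝ) (v₀ : E) (c : ℝ) (hc : c ≠ 0)
    (h0 : F ((s₀, w₀, 0), v₀) = 0)
    (hd : HasFDerivAt (fun v => F ((s₀, w₀, 0), v)) (c • ContinuousLinearMap.id ℝ E) v₀)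
    (hv : ∀ c, dil c v₀ = v₀)
    (hdil : ∀ (s w ε : ℝ) (v : E) (c : unitInterval), F ((s, w, ε * c), dil c v)
      = dil c (F ((s, w, ε), v))) :
    ∃ r > 0, ∃ ψ : ℝ × ℝ × ℝ → E, ψ (s₀, w₀, 0) = v₀ ∧ ∀ s w, |s - s₀| < r → |w - w₀| < r →
      ∀ ε, |ε| < r → AnalyticAt ℝ (fun x => ψ (s, w, x)) ε ∧ F ((s, w, ε), ψ (s, w, ε)) = 0 ∧
        ∀ τ : unitInterval, ψ (s, w, ε) τ = ψ (s, w, ε * τ) 1 := by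
  have cdf : ContDiffAt ℝ ω F ((s₀, w₀, 0), v₀) := hF.contDiffAt
  have hinv : (fderiv ℝ F ((s₀, w₀, 0), v₀) ∘L .inr ℝ (ℝ × ℝ × ℝ) E).IsInvertible := by
    have h1 : HasFDerivAt (fun v : E => (((s₀, w₀, 0) : ℝ × ℝ × ℝ), v))
        (ContinuousLinearMap.inr ℝ (ℝ × ℝ × ℝ) E) v₀ := hasFDerivAt_prodMk_right _ _
    have h2 := HasFDerivAt.comp v₀
      ((hF.differentiable (by simp)).differentiableAt (x := ((s₀, w₀, 0), v₀))).hasFDerivAt h1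
    rw [h2.unique hd]
    exact ⟨ContinuousLinearEquiv.smulLeft (Units.mk0 c hc), by ext; rfl⟩
  set ψ := cdf.implicitFunction (by simp) hinv with hψ
  have e1 := cdf.implicitFunction_apply_self (by simp) hinv
  have e2 := cdf.eventually_apply_implicitFunction (by simp) hinv
  have e3 := cdf.eventually_apply_eq_iff_implicitFunction (by simp) hinv
  have e4 := (cdf.contDiffAt_implicitFunction (by simp) hinv)
  rw [← hψ] at e1 e2 e3 e4
  simp only at e1 e2 e3 e4
  have e5 := (ContDiffAt.analyticAt e4).eventually_analyticAt
  have e6 := e4.continuousAt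
  rw [Metric.eventually_nhds_iff] at e2 e3 e5
  obtain ⟨r2, hr2, e2⟩ := e2
  obtain ⟨r3, hr3, e3⟩ := e3
  obtain ⟨r5, hr5, e5⟩ := e5
  obtain ⟨r6, hr6, e6⟩ := Metric.continuousAt_iff.1 e6 r3 hr3
  refine ⟨min (min r2 r3) (min r5 r6), by positivity, ψ, e1, ?_⟩
  intro s w hs hw ε hε
  have key : ∀ x : ℝ, |x| < min (min r2 r3) (min r5 r6) →
      dist (s, w, x) (s₀, w₀, (0:ℝ)) < min (min r2 r3) (min r5 r6) := by
    intro x hx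
    simp only [Prod.dist_eq, Real.dist_eq, sub_zero]
    exact max_lt hs (max_lt hw hx)
  have hA : ∀ x : ℝ, |x| < min (min r2 r3) (min r5 r6) → F ((s, w, x), ψ (s, w, x)) = 0 := by
    intro x hx
    rw [e2 ((key x hx).trans_le (by simp)), h0]
  refine ⟨?_, hA ε hε, ?_⟩
  · have := e5 ((key ε hε).trans_le (by simp))
    exact this.comp (f := fun x : ℝ => (s, w, x)) (by fun_prop)
  · intro τ
    have hετ : |ε * τ| < min (min r2 r3) (min r5 r6) := by
      refine lt_of_le_of_lt ?_ hε
      rw [abs_mul, abs_of_nonneg τ.2.1]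
      exact mul_le_of_le_one_right (abs_nonneg _) τ.2.2
    have h7 : dist (dil τ (ψ (s, w, ε))) v₀ < r3 := by
      have h8 := e6 ((key ε hε).trans_le (by simp))
      rw [e1] at h8
      refine lt_of_le_of_lt ?_ h8
      have : dil τ (ψ (s, w, ε)) - v₀ = dil τ (ψ (s, w, ε) - v₀) := by
        conv_lhs => rw [← hv τ]
        rfl
      rw [dist_eq_norm, dist_eq_norm, this]
      exact dil_norm _ _
    have h9 := (@e3 ((s, w, ε * τ), dil τ (ψ (s, w, ε))) (by
      rw [Prod.dist_eq]
      exact max_lt ((key _ hετ).trans_le (by simp)) h7)).1 (by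
        rw [hdil, hA ε hε, h0]; rfl)
    simp only at h9
    rw [h9, dil_apply, mul_one]

def Eqn (k : ℕ) (f : ℝ → ℝ) (s : ℝ) : Prop :=
  s * deriv (deriv f) s = (1 - (deriv f s) ^ 2) * (s - (k + 1) * deriv f s)

lemma base_uniq {d h : ℝ → ℝ} {a : ℝ} (hd : AnalyticAt ℝ d a) (hda : d a = 0)
    (hh : ContinuousAt h a) (hha : h a ≤ 0)
    (he : ∀ᶠ s in 𝓝 a, (s - a) * deriv d s = h s * d s) : ∀ᶠ s in 𝓝 a, d s = 0 := by
  by_contra hne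
  obtain ⟨k, g, hg, hga, hdg⟩ := hd.exists_eventuallyEq_pow_smul_nonzero_iff.2 hne
  have hk : k ≠ 0 := by
    rintro rfl
    have := hdg.self_of_nhds
    simp [hda] at this
    exact hga this.symm
  have h1 : ∀ᶠ z in 𝓝[≠] a, k * g z + (z - a) * deriv g z - h z * g z = 0 := by
    rw [eventually_nhdsWithin_iff]
    filter_upwards [hdg.eventually_nhds, he, hg.eventually_analyticAt] with z hz hez hgz hza
    have hza' : z - a ≠ 0 := sub_ne_zero.2 hza
    have hD : HasDerivAt d (k * (z - a) ^ (k - 1) * g z + (z - a) ^ k * deriv g z) z := by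
      have := (((hasDerivAt_id z).sub_const a).pow k).mul hgz.differentiableAt.hasDerivAt
      refine HasDerivAt.congr_of_eventuallyEq ?_ hz
      have h8 : (fun x => (x - a) ^ k • g x) = (fun x => id x - a) ^ k * g := by
        ext x; simp
      rw [h8]
      simpa using this
    rw [hD.deriv, hz.self_of_nhds] at hez
    simp only [smul_eq_mul] at hez
    have hp : (z - a) ^ k = (z - a) * (z - a) ^ (k - 1) := by
      rw [← pow_succ', Nat.sub_add_cancel (Nat.pos_of_ne_zero hk)]
    have : (z - a) ^ k * (k * g z + (z - a) * deriv g z - h z * g z) = 0 := by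
      have : (z - a) ^ k * (k * g z) = (z - a) * (k * (z - a) ^ (k - 1) * g z) := by
        rw [hp]; ring
      linear_combination hez + this
    exact (mul_eq_zero.1 this).resolve_left (pow_ne_zero _ hza')
  have h2 : ContinuousAt (fun z => k * g z + (z - a) * deriv g z - h z * g z) a := by
    have := hg.continuousAt
    have := hg.deriv.continuousAt
    fun_prop
  have h3 := tendsto_nhds_unique (h2.tendsto.mono_left nhdsWithin_le_nhds)
    ((tendsto_congr' h1).2 tendsto_const_nhds)
  simp only [sub_self, zero_mul, add_zero] at h3
  have h4 : ((k:ℝ) - h a) * g a = 0 := by linear_combination h3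
  have hk' : (0:ℝ) < k := by exact_mod_cast Nat.pos_of_ne_zero hk
  rcases mul_eq_zero.1 h4 with h5 | h5
  · linarith
  · exact hga h5

lemma uniq {k : ℕ} {f g : ℝ → ℝ} {a : ℝ} (hf : AnalyticAt ℝ f a) (hg : AnalyticAt ℝ g a)
    (ef : ∀ᶠ s in 𝓝 a, Eqn k f s) (eg : ∀ᶠ s in 𝓝 a, Eqn k g s)
    (h0 : f a = g a) (h1 : deriv f a = deriv g a) (ha : a = 0 → deriv f a = 0) :
    f =ᶠ[𝓝 a] g := by
  set p := deriv f with hp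
  set q := deriv g with hq
  have hpa : AnalyticAt ℝ p a := hf.deriv
  have hqa : AnalyticAt ℝ q a := hg.deriv
  let H : ℝ → ℝ := fun s => -s * (p s + q s) - (k + 1) + (k + 1) * (p s ^ 2 + p s * q s + q s ^ 2)
  have cp := hpa.continuousAt
  have cq := hqa.continuousAt
  have cH : ContinuousAt H a := by
    simp only [H]; fun_prop
  have dd : ∀ᶠ s in 𝓝 a, deriv (fun s => p s - q s) s = deriv p s - deriv q s := by
    filter_upwards [hpa.eventually_analyticAt, hqa.eventually_analyticAt] with s h2 h3
    exact deriv_fun_sub h2.differentiableAt h3.differentiableAt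
  have hH : ∀ᶠ s in 𝓝 a, s * deriv (fun s => p s - q s) s = H s * (p s - q s) := by
    filter_upwards [dd, ef, eg] with s h1 h2 h3
    rw [h1]
    unfold Eqn at h2 h3
    simp only [H]
    linear_combination h2 - h3
  have hpq : ∀ᶠ s in 𝓝 a, p s - q s = 0 := by
    by_cases h : a = 0
    · subst h
      refine base_uniq (h := H) (hpa.sub hqa) (by simp [h1]) cH ?_ (by simpa using hH)
      have h2 := ha rfl
      simp only [H, ← h1, h2]
      have : (0:ℝ) ≤ k := k.cast_nonneg
      norm_num
      linarith
    · refine base_uniq (h := fun s => (s - a) * H s / s) (hpa.sub hqa) (by simp [h1]) ?_ (by simp) ?_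
      · exact ((continuousAt_id.sub continuousAt_const).mul cH).div continuousAt_id h
      · filter_upwards [hH, isOpen_ne.mem_nhds h] with s hs hs0
        have hs0 : s ≠ 0 := hs0
        field_simp
        linear_combination (s - a) * hs
  have : ∀ᶠ s in 𝓝 a, f s - g s = 0 := by
    refine base_uniq (h := fun _ => 0) (hf.sub hg) (by simp [h0]) (by fun_prop) le_rfl ?_
    filter_upwards [hpq, hf.eventually_analyticAt, hg.eventually_analyticAt] with s hs h2 h3
    rw [deriv_fun_sub h2.differentiableAt h3.differentiableAt, ← hp, ← hq, hs]
    simp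
  filter_upwards [this] with s hs
  linarith

noncomputable def Freg (k : ℕ) (p : (ℝ × ℝ × ℝ) × E) : E :=
  (p.1.1 • (1 : E) + p.1.2.2 • T) * p.2
    - (1 - (p.1.2.1 • (1 : E) + p.1.2.2 • (T * avg 0 p.2)) ^ 2)
      * (p.1.1 • (1 : E) + p.1.2.2 • T
        - ((k : ℝ) + 1) • (p.1.2.1 • (1 : E) + p.1.2.2 • (T * avg 0 p.2)))

noncomputable def Fsing (k : ℕ) (p : (ℝ × ℝ × ℝ) × E) : E :=
  p.2 - avg k (p.1.2.2 • T - p.1.2.2 • (T * p.2 ^ 2) + ((k : ℝ) + 1) • p.2 ^ 3)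

lemma Freg_contDiff (k : ℕ) : ContDiff ℝ ω (Freg k) := by
  unfold Freg
  fun_prop

lemma Fsing_contDiff (k : ℕ) : ContDiff ℝ ω (Fsing k) := by
  unfold Fsing
  fun_prop

lemma local_reg (k : ℕ) (s₁ w₁ : ℝ) (hs₁ : 0 < s₁) :
    ∃ r > 0, ∀ s w, |s - s₁| < r → |w - w₁| < r →
      ∃ g : ℝ → ℝ, AnalyticOnNhd ℝ g (Ioo (s - r) (s + r)) ∧ deriv g s = w ∧
        ∀ x ∈ Ioo (s - r) (s + r), Eqn k g x := by
  obtain ⟨r, hr, ψ, -, hψ⟩ := impl (Freg k) (Freg_contDiff k) s₁ w₁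
    (((1 - w₁ ^ 2) * (s₁ - (k + 1) * w₁) / s₁) • (1 : E)) s₁ hs₁.ne'
    (by
      ext τ
      simp [Freg]
      field_simp
      simp)
    (by
      have : (fun v => Freg k ((s₁, w₁, 0), v)) = fun v => s₁ • v -
        ((1 - w₁ ^ 2) * (s₁ - (k + 1) * w₁)) • (1 : E) := by
        ext v τ
        simp [Freg]
      rw [this]
      exact ((hasFDerivAt_id _).const_smul s₁).sub_const _)
    (by intro c; ext τ; simp [dil_apply])
    (by
      intro s w ε v c
      ext τ
      simp [Freg, dil_apply, dil_avg]
      ring)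
  refine ⟨r, hr, ?_⟩
  intro s w hs hw
  have hψ := hψ s w hs hw
  set φ : ℝ → ℝ := fun ε => ψ (s, w, ε) 1 with hφ
  set W : ℝ → E := fun ε => w • (1 : E) + ε • (T * avg 0 (ψ (s, w, ε))) with hW
  set Y : ℝ → ℝ := fun ε => W ε 1 with hY
  set G : ℝ → ℝ := fun ε => ε * avg 0 (W ε) 1 with hG
  have ev : ∀ {u : ℝ → E} {ε : ℝ}, AnalyticAt ℝ u ε → AnalyticAt ℝ (fun x => u x 1) ε := by
    intro u ε hu
    exact ((ContinuousMap.evalCLM ℝ (1 : unitInterval)).analyticAt _).comp hu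
  have hmem : ∀ {ε}, ε ∈ Ioo (-r) r → |ε| < r := fun h => abs_lt.2 h
  have aψ : ∀ ε ∈ Ioo (-r) r, AnalyticAt ℝ (fun x => ψ (s, w, x)) ε := fun ε h => (hψ ε (hmem h)).1
  have aφ : ∀ ε ∈ Ioo (-r) r, AnalyticAt ℝ φ ε := fun ε h => ev (aψ ε h)
  have aW : ∀ ε ∈ Ioo (-r) r, AnalyticAt ℝ W ε := fun ε h => by
    have := ((avg 0).analyticAt _).comp (aψ ε h)
    exact analyticAt_const.add (analyticAt_id.smul (analyticAt_const.mul this))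
  have aY : ∀ ε ∈ Ioo (-r) r, AnalyticAt ℝ Y ε := fun ε h => ev (aW ε h)
  have aG : ∀ ε ∈ Ioo (-r) r, AnalyticAt ℝ G ε := fun ε h =>
    analyticAt_id.mul (ev (((avg 0).analyticAt _).comp (aW ε h)))
  have Wτ : ∀ ε ∈ Ioo (-r) r, ∀ τ : unitInterval, W ε τ = Y (ε * τ) := by
    intro ε h τ
    have h1 : avg 0 (ψ (s, w, ε)) τ = avg 0 (ψ (s, w, ε * τ)) 1 := by
      apply avg_zero_scale
      intro t
      have hετ : |ε * τ| < r := by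
        refine lt_of_le_of_lt ?_ (hmem h)
        rw [abs_mul, abs_of_nonneg τ.2.1]
        exact mul_le_of_le_one_right (abs_nonneg _) τ.2.2
      rw [(hψ ε (hmem h)).2.2, (hψ _ hετ).2.2]
      congr 3
      push_cast
      ring
    simp [hY, hW, h1]
    ring
  have YI : ∀ ε ∈ Ioo (-r) r, Y ε = w + ∫ x in (0:ℝ)..ε, φ x := by
    intro ε h
    have := avg_formula 0 (ψ (s, w, ε)) φ ε (hψ ε (hmem h)).2.2
    simp at this
    simp [hY, hW, this]
  have GI : ∀ ε ∈ Ioo (-r) r, G ε = ∫ x in (0:ℝ)..ε, Y x := by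
    intro ε h
    have := avg_formula 0 (W ε) Y ε (Wτ ε h)
    simpa using this
  have dY : ∀ ε ∈ Ioo (-r) r, HasDerivAt Y (φ ε) ε := by
    intro ε h
    refine ((prim (fun x hx => (aφ x hx).continuousAt.continuousWithinAt) h).const_add
      w).congr_of_eventuallyEq ?_
    filter_upwards [isOpen_Ioo.mem_nhds h] with x hx using YI x hx
  have dG : ∀ ε ∈ Ioo (-r) r, HasDerivAt G (Y ε) ε := by
    intro ε h
    refine (prim (fun x hx => (aY x hx).continuousAt.continuousWithinAt) h).congr_of_eventuallyEq ?_
    filter_upwards [isOpen_Ioo.mem_nhds h] with x hx using GI x hx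
  have hsub : ∀ x ∈ Ioo (s - r) (s + r), x - s ∈ Ioo (-r) r := fun x hx =>
    ⟨by linarith [hx.1], by linarith [hx.2]⟩
  have d1 : ∀ x ∈ Ioo (s - r) (s + r), deriv (fun x => G (x - s)) x = Y (x - s) := fun x hx =>
    ((dG _ (hsub x hx)).comp_sub_const x s).deriv
  refine ⟨fun x => G (x - s), ?_, ?_, ?_⟩
  · intro x hx
    exact (aG _ (hsub x hx)).fun_comp (f := fun x => x - s) (by fun_prop)
  · rw [d1 s ⟨by linarith, by linarith⟩]
    simp [hY, hW]
  · intro x hx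
    have d2 : deriv (deriv (fun x => G (x - s))) x = φ (x - s) := by
      refine HasDerivAt.deriv (((dY _ (hsub x hx)).comp_sub_const x s).congr_of_eventuallyEq ?_)
      filter_upwards [isOpen_Ioo.mem_nhds hx] with y hy using d1 y hy
    unfold Eqn
    rw [d2, d1 x hx]
    have := congrArg (fun u : E => u 1) (hψ _ (hmem (hsub x hx))).2.1
    simp [Freg] at this
    simp [hY, hW, hφ]
    linear_combination this

lemma local_sing (k : ℕ) :
    ∃ r > 0, ∃ g : ℝ → ℝ, AnalyticOnNhd ℝ g (Ioo (-r) r) ∧ g 0 = 0 ∧ deriv g 0 = 0 ∧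
        ∀ x ∈ Ioo (-r) r, Eqn k g x := by
  obtain ⟨r, hr, ψ, hψ0, hψ⟩ := impl (Fsing k) (Fsing_contDiff k) 0 0 0 1 one_ne_zero
    (by simp [Fsing])
    (by
      have h1 : HasFDerivAt (fun v : E => ((k : ℝ) + 1) • v ^ 3) (0 : E →L[ℝ] E) 0 := by
        have := ((hasFDerivAt_id (𝕜 := ℝ) (0 : E)).pow 3).const_smul ((k : ℝ) + 1)
        have e : (((k : ℝ) + 1) • (3 • (id (0 : E)) ^ (3 - 1)) • ContinuousLinearMap.id ℝ E) = 0 := by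
          refine ContinuousLinearMap.ext fun v => ?_
          refine ContinuousMap.ext fun τ => ?_
          change ((k : ℝ) + 1) * (3 • (id (0 : E)) ^ (3 - 1) * v) τ = 0
          simp
        rw [e] at this
        exact this
      have h2 := (hasFDerivAt_id (𝕜 := ℝ) (0 : E)).sub ((avg k).hasFDerivAt.comp (0 : E) h1)
      have e : (fun v => Fsing k ((0, 0, 0), v)) = id - ⇑(avg k) ∘ fun v => ((k:ℝ) + 1) • v ^ 3 := by
        ext v τ
        simp [Fsing]
      rw [e, one_smul]
      simpa using h2)
    (by intro c; ext τ; simp [dil_apply])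
    (by
      intro s w ε v c
      have : (ε * c) • T - (ε * c) • (T * (dil c v) ^ 2) + ((k : ℝ) + 1) • (dil c v) ^ 3
        = dil c (ε • T - ε • (T * v ^ 2) + ((k : ℝ) + 1) • v ^ 3) := by
        ext τ
        simp [dil_apply]
        ring
      simp only [Fsing, this, dil_avg]
      ext τ
      simp [dil_apply])
  refine ⟨r, hr, ?_⟩
  have hψ := hψ 0 0 (by simpa) (by simpa)
  set Y : ℝ → ℝ := fun ε => ψ (0, 0, ε) 1 with hY
  set G : ℝ → ℝ := fun ε => ε * avg 0 (ψ (0, 0, ε)) 1 with hG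
  have ev : ∀ {u : ℝ → E} {ε : ℝ}, AnalyticAt ℝ u ε → AnalyticAt ℝ (fun x => u x 1) ε := by
    intro u ε hu
    exact ((ContinuousMap.evalCLM ℝ (1 : unitInterval)).analyticAt _).comp hu
  have hmem : ∀ {ε}, ε ∈ Ioo (-r) r → |ε| < r := fun h => abs_lt.2 h
  have aψ : ∀ ε ∈ Ioo (-r) r, AnalyticAt ℝ (fun x => ψ (0, 0, x)) ε := fun ε h => (hψ ε (hmem h)).1
  have aY : ∀ ε ∈ Ioo (-r) r, AnalyticAt ℝ Y ε := fun ε h => ev (aψ ε h)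
  have aG : ∀ ε ∈ Ioo (-r) r, AnalyticAt ℝ G ε := fun ε h =>
    analyticAt_id.mul (ev (((avg 0).analyticAt _).comp (aψ ε h)))
  have GI : ∀ ε ∈ Ioo (-r) r, G ε = ∫ x in (0:ℝ)..ε, Y x := by
    intro ε h
    have := avg_formula 0 (ψ (0, 0, ε)) Y ε (hψ ε (hmem h)).2.2
    simpa using this
  set Φ : ℝ → ℝ := fun x => x - x * Y x ^ 2 + (k + 1) * Y x ^ 3 with hΦ
  have YI : ∀ ε ∈ Ioo (-r) r, ε ^ (k + 1) * Y ε = ∫ x in (0:ℝ)..ε, x ^ k * Φ x := by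
    intro ε h
    obtain ⟨-, h1, h2⟩ := hψ ε (hmem h)
    have h3 := avg_formula k (ε • T - ε • (T * ψ (0, 0, ε) ^ 2) + ((k : ℝ) + 1) • ψ (0, 0, ε) ^ 3)
      Φ ε (by
        intro τ
        simp [hΦ, h2 τ, hY]
        ring)
    rw [← h3]
    have h4 : ψ (0, 0, ε) = _ := sub_eq_zero.1 h1
    congr 1
    exact congrArg (fun u : E => u 1) h4
  have dG : ∀ ε ∈ Ioo (-r) r, HasDerivAt G (Y ε) ε := by
    intro ε h
    refine (prim (fun x hx => (aY x hx).continuousAt.continuousWithinAt) h).congr_of_eventuallyEq ?_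
    filter_upwards [isOpen_Ioo.mem_nhds h] with x hx using GI x hx
  have dI : ∀ ε ∈ Ioo (-r) r, HasDerivAt (fun x => x ^ (k + 1) * Y x) (ε ^ k * Φ ε) ε := by
    intro ε h
    refine (prim (φ := fun x => x ^ k * Φ x) (fun x hx => ?_) h).congr_of_eventuallyEq ?_
    · have := (aY x hx).continuousAt
      apply ContinuousAt.continuousWithinAt
      simp only [hΦ]
      fun_prop
    filter_upwards [isOpen_Ioo.mem_nhds h] with x hx using YI x hx
  have Y0 : Y 0 = 0 := by simp [hY, hψ0]
  have h0 : (0:ℝ) ∈ Ioo (-r) r := ⟨by linarith, hr⟩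
  refine ⟨G, aG, by simp [hG], by rw [(dG 0 h0).deriv, Y0], ?_⟩
  intro x hx
  have d2 : deriv (deriv G) x = deriv Y x := by
    apply Filter.EventuallyEq.deriv_eq
    filter_upwards [isOpen_Ioo.mem_nhds hx] with y hy using (dG y hy).deriv
  unfold Eqn
  rw [d2, (dG x hx).deriv]
  by_cases hx0 : x = 0
  · subst hx0; simp [Y0]
  · have h5 := ((hasDerivAt_id x).pow (k + 1)).mul (aY x hx).differentiableAt.hasDerivAt
    have h6 := h5.unique (dI x hx)
    simp [hΦ] at h6
    have h7 : x ^ k * (x * deriv Y x - (1 - Y x ^ 2) * (x - (k + 1) * Y x)) = 0 := by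
      linear_combination h6
    exact sub_eq_zero.1 ((mul_eq_zero.1 h7).resolve_left (pow_ne_zero _ hx0))

lemma Eqn.congr {k : ℕ} {f g : ℝ → ℝ} {s : ℝ} (h : f =ᶠ[𝓝 s] g) (hg : Eqn k g s) : Eqn k f s := by
  unfold Eqn at *
  rw [h.deriv.deriv_eq, h.deriv_eq]
  exact hg

/-- solution on `Ioo a b` -/
def Sol (k : ℕ) (a b : ℝ) (f : ℝ → ℝ) : Prop :=
  AnalyticOnNhd ℝ f (Ioo a b) ∧ f 0 = 0 ∧ deriv f 0 = 0 ∧ ∀ s ∈ Ioo a b, Eqn k f s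

lemma Sol.mono {k : ℕ} {a b a' b' : ℝ} {f : ℝ → ℝ} (h : Sol k a b f) (ha : a ≤ a') (hb : b' ≤ b) :
    Sol k a' b' f :=
  ⟨h.1.mono (Ioo_subset_Ioo ha hb), h.2.1, h.2.2.1, fun s hs => h.2.2.2 s (Ioo_subset_Ioo ha hb hs)⟩

lemma Sol.eqOn {k : ℕ} {a b : ℝ} {f g : ℝ → ℝ} (ha : a < 0) (hb : 0 < b) (hf : Sol k a b f)
    (hg : Sol k a b g) : EqOn f g (Ioo a b) := by
  have h0 : (0:ℝ) ∈ Ioo a b := ⟨ha, hb⟩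
  have hn := isOpen_Ioo.mem_nhds h0
  apply hf.1.eqOn_of_preconnected_of_eventuallyEq hg.1 isPreconnected_Ioo h0
  refine uniq (k := k) (hf.1 0 h0) (hg.1 0 h0) ?_ ?_ (by rw [hf.2.1, hg.2.1])
    (by rw [hf.2.2.1, hg.2.2.1]) (fun _ => hf.2.2.1)
  · filter_upwards [hn] with s hs using hf.2.2.2 s hs
  · filter_upwards [hn] with s hs using hg.2.2.2 s hs

lemma Sol.ne {k : ℕ} {a b : ℝ} {f : ℝ → ℝ} (ha : a < 0) (hb : 0 < b) (hf : Sol k a b f)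
    {s : ℝ} (hs : s ∈ Ioo a b) (hs0 : s ≠ 0) {e : ℝ} (he : e ^ 2 = 1) : deriv f s ≠ e := by
  intro hse
  have hd : ∀ x, HasDerivAt (fun x => f s + e * (x - s)) e x := by
    intro x
    simpa using (((hasDerivAt_id x).sub_const s).const_mul e).const_add (f s)
  have hd' : deriv (fun x => f s + e * (x - s)) = fun _ => e := funext fun x => (hd x).deriv
  have h0 : (0:ℝ) ∈ Ioo a b := ⟨ha, hb⟩
  have h1 : f =ᶠ[𝓝 s] fun x => f s + e * (x - s) := by
    refine uniq (k := k) (hf.1 s hs) (by fun_prop) ?_ ?_ (by simp) (by rw [hd', hse])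
      (fun h => absurd h hs0)
    · filter_upwards [isOpen_Ioo.mem_nhds hs] with s hs using hf.2.2.2 s hs
    · refine Eventually.of_forall fun x => ?_
      unfold Eqn
      rw [hd']
      simp [he]
  have h2 := hf.1.eqOn_of_preconnected_of_eventuallyEq (g := fun x => f s + e * (x - s))
    (fun x _ => by fun_prop) isPreconnected_Ioo hs h1
  have h3 : f =ᶠ[𝓝 0] fun x => f s + e * (x - s) := by
    filter_upwards [isOpen_Ioo.mem_nhds h0] with x hx using h2 hx
  have h4 := h3.deriv_eq
  rw [hd', hf.2.2.1] at h4
  simp only at h4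
  rw [← h4] at he
  norm_num at he

lemma Sol.bound {k : ℕ} {a b : ℝ} {f : ℝ → ℝ} (ha : a < 0) (hb : 0 < b) (hf : Sol k a b f)
    {s : ℝ} (hs : s ∈ Ioo a b) (hs0 : 0 < s) : deriv f s ∈ Icc (-1 : ℝ) 1 := by
  have hsub : Icc 0 s ⊆ Ioo a b := fun x hx => ⟨ha.trans_le hx.1, hx.2.trans_lt hs.2⟩
  have hc : ContinuousOn (deriv f) (Icc 0 s) := fun x hx =>
    (hf.1 x (hsub hx)).deriv.continuousAt.continuousWithinAt
  by_contra h
  rw [mem_Icc, not_and_or, not_le, not_le] at h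
  rcases h with h | h
  · obtain ⟨x, hx, hx1⟩ := intermediate_value_Icc' hs0.le hc
      (show (-1:ℝ) ∈ Icc _ _ from ⟨h.le, by rw [hf.2.2.1]; norm_num⟩)
    refine hf.ne ha hb (hsub hx) ?_ (by norm_num) hx1
    rintro rfl
    rw [hf.2.2.1] at hx1; norm_num at hx1
  · obtain ⟨x, hx, hx1⟩ := intermediate_value_Icc hs0.le hc
      (show (1:ℝ) ∈ Icc _ _ from ⟨by rw [hf.2.2.1]; norm_num, h.le⟩)
    refine hf.ne ha hb (hsub hx) ?_ (by norm_num) hx1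
    rintro rfl
    rw [hf.2.2.1] at hx1; norm_num at hx1

lemma local_unif (k : ℕ) (s₁ : ℝ) (hs₁ : 0 < s₁) :
    ∃ r > 0, ∀ s, |s - s₁| < r → ∀ w ∈ Icc (-1:ℝ) 1,
      ∃ g : ℝ → ℝ, AnalyticOnNhd ℝ g (Ioo (s - r) (s + r)) ∧ deriv g s = w ∧
        ∀ x ∈ Ioo (s - r) (s + r), Eqn k g x := by
  have mono : ∀ r r' s : ℝ, r' ≤ r → Ioo (s - r') (s + r') ⊆ Ioo (s - r) (s + r) := fun r r' s h =>
    Ioo_subset_Ioo (by linarith) (by linarith)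
  refine (isCompact_Icc (a := (-1:ℝ)) (b := 1)).induction_on
    (p := fun K => ∃ r > 0, ∀ s, |s - s₁| < r → ∀ w ∈ K,
      ∃ g : ℝ → ℝ, AnalyticOnNhd ℝ g (Ioo (s - r) (s + r)) ∧ deriv g s = w ∧
        ∀ x ∈ Ioo (s - r) (s + r), Eqn k g x) ?_ ?_ ?_ ?_
  · exact ⟨1, one_pos, by simp⟩
  · rintro A B hAB ⟨r, hr, h⟩
    exact ⟨r, hr, fun s hs w hw => h s hs w (hAB hw)⟩
  · rintro A B ⟨r, hr, h⟩ ⟨r', hr', h'⟩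
    refine ⟨min r r', by positivity, ?_⟩
    rintro s hs w (hw | hw)
    · obtain ⟨g, h1, h2, h3⟩ := h s (hs.trans_le (min_le_left _ _)) w hw
      have := mono r (min r r') s (min_le_left _ _)
      exact ⟨g, h1.mono this, h2, fun x hx => h3 x (this hx)⟩
    · obtain ⟨g, h1, h2, h3⟩ := h' s (hs.trans_le (min_le_right _ _)) w hw
      have := mono r' (min r r') s (min_le_right _ _)
      exact ⟨g, h1.mono this, h2, fun x hx => h3 x (this hx)⟩
  · intro w₁ _
    obtain ⟨r, hr, h⟩ := local_reg k s₁ w₁ hs₁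
    exact ⟨_, mem_nhdsWithin_of_mem_nhds (Metric.ball_mem_nhds w₁ hr), r, hr,
      fun s hs w hw => h s w hs (by simpa [Real.dist_eq] using hw)⟩

/-- gluing -/
lemma glue {k : ℕ} {f g : ℝ → ℝ} {a c b : ℝ} {u : ℝ → ℝ} (hc : c ∈ Ioo a b)
    (hf : ∀ s ∈ Ioc a c, AnalyticAt ℝ f s ∧ Eqn k f s)
    (hg : ∀ s ∈ Ico c b, AnalyticAt ℝ g s ∧ Eqn k g s) (hfg : f =ᶠ[𝓝 c] g)
    (hu : u = fun s => if s < c then f s else g s) :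
    u =ᶠ[𝓝 c] g ∧ AnalyticOnNhd ℝ u (Ioo a b) ∧ ∀ s ∈ Ioo a b, Eqn k u s := by
  have h1 : u =ᶠ[𝓝 c] g := by
    filter_upwards [hfg] with s hs
    rw [hu]; simp only; split_ifs <;> simp [hs]
  have key : ∀ s ∈ Ioo a b, AnalyticAt ℝ u s ∧ Eqn k u s := by
    intro s hs
    rcases lt_trichotomy s c with h | h | h
    · have h2 : u =ᶠ[𝓝 s] f := by
        filter_upwards [isOpen_Iio.mem_nhds h] with x hx
        have hx : x < c := hx
        simp [hu, hx]
      have := hf s ⟨hs.1, h.le⟩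
      exact ⟨this.1.congr h2.symm, Eqn.congr h2 this.2⟩
    · subst h
      have := hg s ⟨le_rfl, hs.2⟩
      exact ⟨this.1.congr h1.symm, Eqn.congr h1 this.2⟩
    · have h2 : u =ᶠ[𝓝 s] g := by
        filter_upwards [isOpen_Ioi.mem_nhds h] with x hx
        have hx : c < x := hx
        simp [hu, hx.not_gt]
      have := hg s ⟨h.le, hs.2⟩
      exact ⟨this.1.congr h2.symm, Eqn.congr h2 this.2⟩
  exact ⟨h1, fun s hs => (key s hs).1, fun s hs => (key s hs).2⟩

lemma exists_half (k : ℕ) : ∃ δ > 0, ∀ b, ∃ f, Sol k (-δ) b f := by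
  obtain ⟨δ, hδ, g, hg1, hg2, hg3, hg4⟩ := local_sing k
  refine ⟨δ, hδ, ?_⟩
  by_contra! hcon
  obtain ⟨B, hB⟩ := hcon
  set S : Set ℝ := {b | ∃ f, Sol k (-δ) b f} with hS
  have hδS : δ ∈ S := ⟨g, hg1, hg2, hg3, hg4⟩
  have hbdd : BddAbove S := by
    refine ⟨B, ?_⟩
    rintro b ⟨f, hf⟩
    by_contra hb
    exact hB f (hf.mono le_rfl (not_le.1 hb).le)
  set M := sSup S with hM
  have hMδ : δ ≤ M := le_csSup hbdd hδS
  have hM0 : 0 < M := hδ.trans_le hMδ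
  obtain ⟨r, hr, hloc⟩ := local_unif k M hM0
  set s₀ := M - min r M / 2 with hs₀
  have hmin : 0 < min r M := by positivity
  have hmr : min r M ≤ r := min_le_left _ _
  have hmM : min r M ≤ M := min_le_right _ _
  have hs₀M : s₀ < M := by linarith
  have hs₀0 : 0 < s₀ := by linarith
  obtain ⟨b, ⟨f, hf⟩, hb⟩ := exists_lt_of_lt_csSup ⟨δ, hδS⟩ hs₀M
  have hs₀m : s₀ ∈ Ioo (-δ) b := ⟨by linarith, hb⟩
  have hb0 : 0 < b := hs₀0.trans hb
  obtain ⟨g, h1, h2, h3⟩ := hloc s₀ (by rw [abs_lt]; constructor <;> linarith) _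
    (hf.bound (by linarith) hb0 hs₀m hs₀0)
  set g' : ℝ → ℝ := fun x => (f s₀ - g s₀) + g x with hg'
  have hdg' : deriv g' = deriv g := by
    ext x; simp [hg']
  have hEg' : ∀ x ∈ Ioo (s₀ - r) (s₀ + r), Eqn k g' x := by
    intro x hx
    have := h3 x hx
    unfold Eqn at *
    rwa [hdg']
  have hAg' : AnalyticOnNhd ℝ g' (Ioo (s₀ - r) (s₀ + r)) := fun x hx =>
    analyticAt_const.add (h1 x hx)
  have hs₀r : s₀ ∈ Ioo (s₀ - r) (s₀ + r) := ⟨by linarith, by linarith⟩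
  have hfg : f =ᶠ[𝓝 s₀] g' := by
    refine uniq (k := k) (hf.1 _ hs₀m) (hAg' _ hs₀r) ?_ ?_ (by simp [hg']) (by rw [hdg', h2])
      (fun h => absurd h hs₀0.ne')
    · filter_upwards [isOpen_Ioo.mem_nhds hs₀m] with s hs using hf.2.2.2 s hs
    · filter_upwards [isOpen_Ioo.mem_nhds hs₀r] with s hs using hEg' s hs
  obtain ⟨-, hu2, hu3⟩ := glue (k := k) (a := -δ) (b := s₀ + r) (c := s₀)
    ⟨hs₀m.1, hs₀r.2⟩
    (fun s hs => ⟨hf.1 s ⟨hs.1, hs.2.trans_lt hb⟩, hf.2.2.2 s ⟨hs.1, hs.2.trans_lt hb⟩⟩)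
    (fun s hs => ⟨hAg' s ⟨by linarith [hs.1], hs.2⟩, hEg' s ⟨by linarith [hs.1], hs.2⟩⟩) hfg rfl
  have h0 : (fun s => if s < s₀ then f s else g' s) =ᶠ[𝓝 0] f := by
    filter_upwards [isOpen_Iio.mem_nhds hs₀0] with x hx
    have hx : x < s₀ := hx
    simp [hx]
  have : s₀ + r ∈ S := ⟨_, hu2, h0.self_of_nhds.trans hf.2.1, by rw [h0.deriv_eq, hf.2.2.1], hu3⟩
  have := le_csSup hbdd this
  linarith

lemma deriv_neg' (f : ℝ → ℝ) : deriv (fun x => f (-x)) = fun x => - deriv f (-x) := by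
  ext x; exact deriv_comp_neg f x

lemma Eqn.neg {k : ℕ} {f : ℝ → ℝ} {s : ℝ} (h : Eqn k f (-s)) : Eqn k (fun x => f (-x)) s := by
  unfold Eqn at *
  rw [deriv_neg', deriv.fun_neg, deriv_comp_neg]
  linear_combination -h

lemma Sol.neg {k : ℕ} {a b : ℝ} {f : ℝ → ℝ} (h : Sol k a b f) : Sol k (-b) (-a) (fun x => f (-x)) := by
  have hm : ∀ x ∈ Ioo (-b) (-a), -x ∈ Ioo a b := fun x hx => ⟨by linarith [hx.2], by linarith [hx.1]⟩
  refine ⟨fun x hx => (h.1 _ (hm x hx)).fun_comp (f := fun x => -x) (by fun_prop), by simp [h.2.1], ?_,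
    fun s hs => Eqn.neg (h.2.2.2 _ (hm s hs))⟩
  rw [deriv_neg']; simp [h.2.2.1]

lemma exists_sym (k : ℕ) (b : ℝ) (hb : 0 < b) : ∃ f, Sol k (-b) b f := by
  obtain ⟨δ, hδ, h⟩ := exists_half k
  obtain ⟨f, hf⟩ := h b
  have hf' := hf.neg
  rw [neg_neg] at hf'
  set d := min δ b with hd
  have hd0 : 0 < d := by positivity
  have e := (hf'.mono (a' := -d) (b' := d) (by simp [hd]) (by simp [hd])).eqOn (by linarith) hd0
    (hf.mono (by simp [hd]) (by simp [hd]))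
  have h0 : (0:ℝ) ∈ Ioo (-d) d := ⟨by linarith, hd0⟩
  obtain ⟨u1, u2, u3⟩ := glue (k := k) (a := -b) (b := b) (c := 0) ⟨by linarith, hb⟩
    (fun s hs => ⟨hf'.1 s ⟨hs.1, hs.2.trans_lt hδ⟩, hf'.2.2.2 s ⟨hs.1, hs.2.trans_lt hδ⟩⟩)
    (fun s hs => ⟨hf.1 s ⟨by linarith [hs.1], hs.2⟩, hf.2.2.2 s ⟨by linarith [hs.1], hs.2⟩⟩)
    (by filter_upwards [isOpen_Ioo.mem_nhds h0] with x hx using e hx) rfl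
  exact ⟨_, u2, u1.self_of_nhds.trans hf.2.1, by rw [u1.deriv_eq, hf.2.2.1], u3⟩

lemma exists_global (k : ℕ) : ∃ f, ∀ b > 0, Sol k (-b) b f := by
  have : ∀ b : ℝ, ∃ f, 0 < b → Sol k (-b) b f := fun b => by
    by_cases hb : 0 < b
    · obtain ⟨f, hf⟩ := exists_sym k b hb
      exact ⟨f, fun _ => hf⟩
    · exact ⟨0, fun h => absurd h hb⟩
  choose F hF using this
  have agree : ∀ b b' : ℝ, 0 < b → b ≤ b' → EqOn (F b) (F b') (Ioo (-b) b) := fun b b' hb hbb =>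
    (hF b hb).eqOn (by linarith) hb ((hF b' (hb.trans_le hbb)).mono (by linarith) hbb)
  refine ⟨fun s => F (|s| + 1) s, fun b hb => ?_⟩
  have e : EqOn (fun s => F (|s| + 1) s) (F b) (Ioo (-b) b) := by
    intro s hs
    have hs1 : s ∈ Ioo (-(|s| + 1)) (|s| + 1) :=
      ⟨by linarith [neg_abs_le s], by linarith [le_abs_self s]⟩
    rcases le_total (|s| + 1) b with h | h
    · exact agree _ _ (by positivity) h hs1
    · exact (agree _ _ hb h hs).symm
  have e' : ∀ s ∈ Ioo (-b) b, (fun s => F (|s| + 1) s) =ᶠ[𝓝 s] F b := fun s hs => by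
    filter_upwards [isOpen_Ioo.mem_nhds hs] with x hx using e hx
  have h0 : (0:ℝ) ∈ Ioo (-b) b := ⟨by linarith, hb⟩
  obtain ⟨h1, h2, h3, h4⟩ := hF b hb
  refine ⟨fun s hs => (h1 s hs).congr (e' s hs).symm, ?_, ?_, fun s hs => Eqn.congr (e' s hs) (h4 s hs)⟩
  · exact (e' 0 h0).self_of_nhds.trans h2
  · rw [(e' 0 h0).deriv_eq, h3]

end Bowl



/-- Existence and uniqueness of the bowl profile `f_B : ℝ → ℝ`:
an even, real-analytic function with `f_B(0) = 0`, `f_B'(0) = 0` whose derivative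
solves the rotationally invariant translating-soliton ODE away from `0`. -/
theorem bowl_profile_exists_unique (n : ℕ) (hn : 2 ≤ n) :
    ∃! f : ℝ → ℝ,
      (∀ s : ℝ, f (-s) = f s) ∧
      AnalyticOn ℝ f Set.univ ∧
      f 0 = 0 ∧
      deriv f 0 = 0 ∧
      (∀ s : ℝ, s ≠ 0 →
        deriv (deriv f) s
          = (1 - (deriv f s) ^ 2) * (1 - (n - 1 : ℝ) * deriv f s / s)) := by
  obtain ⟨k, rfl⟩ : ∃ k, n = k + 2 := ⟨n - 2, by omega⟩
  obtain ⟨f, hf⟩ := Bowl.exists_global k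
  have mem : ∀ s : ℝ, s ∈ Ioo (-(|s| + 1)) (|s| + 1) := fun s =>
    ⟨by linarith [neg_abs_le s], by linarith [le_abs_self s]⟩
  have pos : ∀ s : ℝ, 0 < |s| + 1 := fun s => by positivity
  refine ⟨f, ⟨?_, ?_, (hf 1 one_pos).2.1, (hf 1 one_pos).2.2.1, ?_⟩, ?_⟩
  · intro s
    have h := hf _ (pos s)
    have h' := h.neg
    rw [neg_neg] at h'
    exact h'.eqOn (by linarith [pos s]) (pos s) h (mem s)
  · intro s _
    exact ((hf _ (pos s)).1 s (mem s)).analyticWithinAt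
  · intro s hs
    have h := (hf _ (pos s)).2.2.2 s (mem s)
    unfold Bowl.Eqn at h
    push_cast
    field_simp
    linear_combination h
  · rintro g ⟨-, hg, hg0, hg1, hg2⟩
    rw [analyticOn_univ] at hg
    have hsol : ∀ b > 0, Bowl.Sol k (-b) b g := by
      intro b hb
      refine ⟨fun s _ => hg s (mem_univ s), hg0, hg1, ?_⟩
      intro s _
      unfold Bowl.Eqn
      by_cases hs : s = 0
      · subst hs; simp [hg1]
      · rw [hg2 s hs]
        push_cast
        field_simp
        ring
    ext s
    exact (hsol _ (pos s)).eqOn (by linarith [pos s]) (pos s) (hf _ (pos s)) (mem s)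
end

section
/- Let n ≥ 2 be a natural number and let w : (0,∞) → ℝ be a differentiable function with w'(s) = (1 − w(s)²)·(1 − (n−1)·w(s)/s) and −1 < w(s) < 1 for all s > 0. Then w(s) → 1 as s → +∞. -/
open Set Filter

/-- Any solution of `(★)`, `w' = (1 - w²)(1 - (n-1)w/s)`,
defined on all of `(0, ∞)` with values in `(-1, 1)` tends to `1` at `+∞`. -/
theorem solution_in_strip_tendsto_one_atTop (n : ℕ) (hn : 2 ≤ n) (w : ℝ → ℝ)
    (hode : ∀ s : ℝ, 0 < s →
      HasDerivAt w ((1 - w s ^ 2) * (1 - (n - 1 : ℝ) * w s / s)) s)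
    (hbound : ∀ s : ℝ, 0 < s → -1 < w s ∧ w s < 1) :
    Tendsto w atTop (nhds 1) := by
  have hn' : (2 : ℝ) ≤ n := by exact_mod_cast hn
  set S : ℝ := 2 * ((n : ℝ) - 1) with hS
  have hSpos : 0 < S := by rw [hS]; linarith
  have hder : ∀ s : ℝ, 0 < s → HasDerivAt
      (fun t => Real.log (1 + w t) - Real.log (1 - w t) - t)
      (2 * (1 - (n - 1 : ℝ) * w s / s) - 1) s := by
    intro s hs
    obtain ⟨h1, h2⟩ := hbound s hs
    have ha : 1 + w s ≠ 0 := by linarith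
    have hb : 1 - w s ≠ 0 := by linarith
    have h := ((((hode s hs).const_add 1).log ha).sub
      (((hode s hs).const_sub 1).log hb)).sub (hasDerivAt_id s)
    refine h.congr_deriv ?_
    generalize (1 - (n - 1 : ℝ) * w s / s) = q
    field_simp
    ring
  have hmono : MonotoneOn (fun t => Real.log (1 + w t) - Real.log (1 - w t) - t) (Ici S) := by
    apply monotoneOn_of_deriv_nonneg (convex_Ici S)
    · intro s hs
      exact (hder s (lt_of_lt_of_le hSpos hs)).continuousAt.continuousWithinAt
    · intro s hs
      rw [interior_Ici] at hs
      exact (hder s (lt_trans hSpos hs)).differentiableAt.differentiableWithinAt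
    · intro s hs
      rw [interior_Ici] at hs
      have hs' : S < s := hs
      have hs0 : 0 < s := lt_trans hSpos hs
      rw [(hder s hs0).deriv]
      have : (n - 1 : ℝ) * w s / s ≤ 1 / 2 := by
        rw [div_le_iff₀ hs0]
        nlinarith [(hbound s hs0).2]
      linarith
  set C : ℝ := Real.log (1 + w S) - Real.log (1 - w S) - S with hC
  have hle : ∀ s, S ≤ s → 1 - Real.exp (Real.log 2 - C - s) ≤ w s := by
    intro s hs
    have hs0 : 0 < s := lt_of_lt_of_le hSpos hs
    obtain ⟨h1, h2⟩ := hbound s hs0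
    have h := hmono (mem_Ici.2 le_rfl) (mem_Ici.2 hs) hs
    have h3 : Real.log (1 + w s) ≤ Real.log 2 :=
      Real.log_le_log (by linarith) (by linarith)
    have h4 : Real.log (1 - w s) ≤ Real.log 2 - C - s := by
      simp only [] at h
      linarith
    have := (Real.log_le_iff_le_exp (by linarith)).1 h4
    linarith
  have hlim : Tendsto (fun s => 1 - Real.exp (Real.log 2 - C - s)) atTop (nhds 1) := by
    have : Tendsto (fun s : ℝ => Real.log 2 - C - s) atTop atBot := by
      simpa only [sub_eq_add_neg] using
        tendsto_atBot_add_const_left atTop (Real.log 2 - C) tendsto_neg_atTop_atBot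
    simpa using (Real.tendsto_exp_atBot.comp this).const_sub 1
  refine tendsto_of_tendsto_of_tendsto_of_le_of_le' hlim tendsto_const_nhds ?_ ?_
  · filter_upwards [eventually_ge_atTop S] with s hs using hle s hs
  · filter_upwards [eventually_gt_atTop 0] with s hs using (hbound s hs).2.le
end

section
/- Let n ≥ 2 be a natural number, let w_B : (0,∞) → ℝ be the solution of (★) extending continuously to 0 with limit 0 and values in (−1,1), and let w : (0,∞) → ℝ be a solution of (★) with −1 < w(s) < 1 for all s > 0 and w(s₀) > w_B(s₀) for some s₀ > 0. Then w(s) > w_B(s) for every s > 0, there exists exactly one s₁ > 0 with w'(s₁) = 0, this point satisfies w(s₁) = s₁/(n−1), and w(s) → 1 as s → 0⁺. -/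
open Set Filter

noncomputable def bowlA (x : ℝ) : ℝ := (Real.log (1 + x) - Real.log (1 - x)) / 2

lemma bowlA_deriv {x : ℝ} (h1 : -1 < x) (h2 : x < 1) : HasDerivAt bowlA (1 / (1 - x ^ 2)) x := by
  have a : (1 + x) ≠ 0 := by linarith
  have b : (1 - x) ≠ 0 := by linarith
  have e1 : HasDerivAt (fun x : ℝ => 1 + x) 1 x := (hasDerivAt_id x).const_add 1
  have e2 : HasDerivAt (fun x : ℝ => 1 - x) (-1) x := (hasDerivAt_id x).const_sub 1
  have := ((e1.log a).sub (e2.log b)).div_const 2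
  refine this.congr_deriv ?_
  have c : 1 - x ^ 2 ≠ 0 := by
    have : 1 - x ^ 2 = (1 + x) * (1 - x) := by ring
    rw [this]; exact mul_ne_zero a b
  field_simp
  ring

lemma bowlA_exp {x y : ℝ} (h1 : -1 < x) (h : x ≤ y) (h2 : y < 1) : y - x ≤ bowlA y - bowlA x := by
  have H : ∀ z ∈ Ioo (-1 : ℝ) 1, HasDerivAt (fun z => bowlA z - z) (1 / (1 - z ^ 2) - 1) z :=
    fun z hz => (bowlA_deriv hz.1 hz.2).sub (hasDerivAt_id z)
  have M : MonotoneOn (fun z => bowlA z - z) (Ioo (-1 : ℝ) 1) := by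
    apply monotoneOn_of_hasDerivWithinAt_nonneg (convex_Ioo _ _)
      (fun z hz => (H z hz).continuousAt.continuousWithinAt)
    · intro z hz
      rw [interior_Ioo] at hz
      exact (H z hz).hasDerivWithinAt
    · intro z hz
      rw [interior_Ioo] at hz
      have : 0 < 1 - z ^ 2 := by nlinarith [hz.1, hz.2]
      rw [sub_nonneg, le_div_iff₀ this]
      nlinarith [sq_nonneg z]
  have := M ⟨h1, h.trans_lt h2⟩ ⟨h1.trans_le h, h2⟩ h
  simp only at this
  linarith

lemma bowlA_lt {x y : ℝ} (_h1 : -1 < x) (h1' : x < 1) (h2 : -1 < y) (h : bowlA x < bowlA y) :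
    x < y := by
  by_contra hc
  have := bowlA_exp h2 (not_lt.1 hc) h1'
  linarith [not_lt.1 hc]


/-- **Case II.** A solution of `(★)` with values in `(-1,1)` lying above
the bowl derivative `w_B` at one point lies above it everywhere, has exactly one critical
point `s₁`, at which `w(s₁) = s₁/(n-1)`, and tends to `1` as `s → 0⁺`. -/
theorem solution_above_bowl (n : ℕ) (hn : 2 ≤ n) (wB w : ℝ → ℝ)
    -- the bowl derivative: solution of (★) on (0,∞), values in (-1,1), limit 0 at 0⁺
    (hBode : ∀ s : ℝ, 0 < s →
      HasDerivAt wB ((1 - wB s ^ 2) * (1 - (n - 1 : ℝ) * wB s / s)) s)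
    (hBbound : ∀ s : ℝ, 0 < s → -1 < wB s ∧ wB s < 1)
    (hBlim : Tendsto wB (nhdsWithin 0 (Set.Ioi 0)) (nhds 0))
    -- the solution w
    (hode : ∀ s : ℝ, 0 < s →
      HasDerivAt w ((1 - w s ^ 2) * (1 - (n - 1 : ℝ) * w s / s)) s)
    (hbound : ∀ s : ℝ, 0 < s → -1 < w s ∧ w s < 1)
    (s₀ : ℝ) (hs₀ : 0 < s₀) (habove : wB s₀ < w s₀) :
    (∀ s : ℝ, 0 < s → wB s < w s) ∧
    (∃! s₁ : ℝ, 0 < s₁ ∧ deriv w s₁ = 0) ∧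
    (∀ s₁ : ℝ, 0 < s₁ → deriv w s₁ = 0 → w s₁ = s₁ / (n - 1 : ℝ)) ∧
    Tendsto w (nhdsWithin 0 (Set.Ioi 0)) (nhds 1) := by
  obtain ⟨j, rfl⟩ : ∃ j, n = j + 2 := ⟨n - 2, by omega⟩
  obtain ⟨m, hm⟩ : ∃ m : ℝ, m = (j : ℝ) + 1 := ⟨_, rfl⟩
  have hm' : (((j + 2 : ℕ) : ℝ) - 1) = m := by push_cast; rw [hm]; ring
  have hm0 : 0 < m := by rw [hm]; positivity
  simp only [hm'] at hode hBode ⊢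
  have key : ∀ v : ℝ → ℝ, (∀ s : ℝ, 0 < s → HasDerivAt v ((1 - v s ^ 2) * (1 - m * v s / s)) s) →
      (∀ s : ℝ, 0 < s → -1 < v s ∧ v s < 1) → ∀ s : ℝ, 0 < s →
      HasDerivAt (fun s => bowlA (v s)) (1 - m * v s / s) s := by
    intro v hv hb s hs
    have := (bowlA_deriv (hb s hs).1 (hb s hs).2).comp s (hv s hs)
    refine this.congr_deriv ?_
    have : 0 < 1 - v s ^ 2 := by nlinarith [hb s hs]
    field_simp
  have kw := key w hode hbound
  have kB := key wB hBode hBbound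
  obtain ⟨d, hd⟩ : ∃ d : ℝ → ℝ, d = fun s => bowlA (w s) - bowlA (wB s) := ⟨_, rfl⟩
  have dd : ∀ s, 0 < s → HasDerivAt d (-(m * (w s - wB s) / s)) s := by
    intro s hs
    rw [hd]
    exact ((kw s hs).sub (kB s hs)).congr_deriv (by ring)
  have sg : ∀ s, 0 < s → 0 ≤ d s * (w s - wB s) ∧ 0 ≤ d s * (d s - (w s - wB s)) := by
    intro s hs
    have hds : d s = bowlA (w s) - bowlA (wB s) := by rw [hd]
    rcases le_total (w s) (wB s) with h | h
    · have := bowlA_exp (hbound s hs).1 h (hBbound s hs).2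
      constructor <;> apply mul_nonneg_of_nonpos_of_nonpos <;> linarith
    · have := bowlA_exp (hBbound s hs).1 h (hbound s hs).2
      constructor <;> apply mul_nonneg <;> linarith
  have anti : AntitoneOn (fun s => d s ^ 2) (Ioi 0) := by
    have H := fun s (hs : 0 < s) => (dd s hs).pow 2
    apply antitoneOn_of_hasDerivWithinAt_nonpos (convex_Ioi _)
      (fun z hz => (H z hz).continuousAt.continuousWithinAt)
    · intro z hz
      rw [interior_Ioi] at hz
      exact (H z hz).hasDerivWithinAt
    · intro z hz
      rw [interior_Ioi] at hz
      have hz : 0 < z := hz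
      have e : ((2 : ℕ) : ℝ) * d z ^ (2 - 1) * -(m * (w z - wB z) / z)
        = -(2 * m / z * (d z * (w z - wB z))) := by
        push_cast; field_simp
      rw [e, neg_nonpos]
      exact mul_nonneg (by positivity) (sg z hz).1
  have mono : MonotoneOn (fun s => (d s * s ^ (j + 1)) ^ 2) (Ioi 0) := by
    have H := fun s (hs : 0 < s) => ((dd s hs).mul (hasDerivAt_pow (j + 1) s)).pow 2
    apply monotoneOn_of_hasDerivWithinAt_nonneg (convex_Ioi _)
      (fun z hz => (H z hz).continuousAt.continuousWithinAt)
    · intro z hz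
      rw [interior_Ioi] at hz
      exact (H z hz).hasDerivWithinAt
    · intro z hz
      rw [interior_Ioi] at hz
      have hz : 0 < z := hz
      have := mul_nonneg (by positivity : 0 ≤ 2 * m * z ^ (2 * j + 1)) (sg z hz).2
      refine this.trans_eq ?_
      simp only [Pi.mul_apply, Nat.add_sub_cancel]
      push_cast
      rw [← hm]
      field_simp
      ring
  have d0 : 0 < d s₀ := by
    have := bowlA_exp (hBbound s₀ hs₀).1 habove.le (hbound s₀ hs₀).2
    rw [hd]; dsimp only; linarith
  have dne : ∀ s, 0 < s → d s ≠ 0 := by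
    intro s hs h0
    rcases le_total s s₀ with h | h
    · have := anti hs hs₀ h
      simp only [h0] at this
      nlinarith
    · have := mono hs₀ hs h
      simp only [h0] at this
      have h3 : 0 < (d s₀ * s₀ ^ (j + 1)) ^ 2 := by positivity
      nlinarith
  have dcont : ContinuousOn d (Ioi 0) := fun s hs => (dd s hs).continuousAt.continuousWithinAt
  have dpos : ∀ s, 0 < s → 0 < d s := by
    intro s hs
    by_contra hc
    obtain ⟨c, hc, hc'⟩ := isPreconnected_Ioi.intermediate_value (s := Ioi (0:ℝ)) hs hs₀ dcont
      (show (0:ℝ) ∈ Icc (d s) (d s₀) from ⟨not_lt.1 hc, d0.le⟩)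
    exact dne c hc hc'
  have A1 : ∀ s : ℝ, 0 < s → wB s < w s := by
    intro s hs
    apply bowlA_lt (hBbound s hs).1 (hBbound s hs).2 (hbound s hs).1
    have := dpos s hs
    rw [hd] at this; dsimp only at this; linarith
  have A0 : bowlA 0 = 0 := by simp [bowlA]
  have A0c : ContinuousAt bowlA 0 := (bowlA_deriv (by norm_num) (by norm_num)).continuousAt
  -- w bounded below by positive near zero
  obtain ⟨e, he, he1, heA⟩ : ∃ e : ℝ, 0 < e ∧ e < 1 ∧ bowlA e < d s₀ / 2 := by
    have h1 : ∀ᶠ x in nhds (0:ℝ), bowlA x < d s₀ / 2 :=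
      A0c.eventually_lt_const (by rw [A0]; linarith)
    have h2 : ∀ᶠ x in nhds (0:ℝ), x < 1 := eventually_lt_nhds (by norm_num)
    have h3 : ∀ᶠ x in nhdsWithin (0:ℝ) (Ioi 0), 0 < x := self_mem_nhdsWithin
    obtain ⟨e, h⟩ := (h3.and ((h1.and h2).filter_mono nhdsWithin_le_nhds)).exists
    exact ⟨e, h.1, h.2.2, h.2.1⟩
  have evB : ∀ᶠ s in nhdsWithin (0:ℝ) (Ioi 0), -(d s₀ / 2) < bowlA (wB s) := by
    have : Tendsto (fun s => bowlA (wB s)) (nhdsWithin 0 (Ioi 0)) (nhds 0) := by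
      have := A0c.tendsto.comp hBlim
      rwa [A0] at this
    exact this.eventually_const_lt (by linarith)
  obtain ⟨t, ht, htw⟩ : ∃ t : ℝ, 0 < t ∧ ∀ s ∈ Ioc 0 t, e < w s := by
    have h3 : ∀ᶠ x in nhdsWithin (0:ℝ) (Ioi 0), x < s₀ :=
      (eventually_lt_nhds hs₀).filter_mono nhdsWithin_le_nhds
    obtain ⟨t, ht, h⟩ := mem_nhdsGT_iff_exists_Ioc_subset.1 (evB.and h3)
    refine ⟨t, ht, fun s hs => ?_⟩
    have h' := h hs
    have hs0 := hs.1
    apply bowlA_lt (by linarith) he1 (hbound s hs0).1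
    have a1 : d s₀ ^ 2 ≤ d s ^ 2 := anti hs0 hs₀ h'.2.le
    have a2 : d s₀ ≤ d s := by
      have := dpos s hs0
      nlinarith
    have a3 : d s = bowlA (w s) - bowlA (wB s) := by rw [hd]
    have := h'.1
    linarith
  have anti2 : AntitoneOn (fun s => bowlA (w s) - s + m * e * Real.log s) (Ioc 0 t) := by
    have H := fun s (hs : 0 < s) => ((kw s hs).sub (hasDerivAt_id s)).add
      ((Real.hasDerivAt_log hs.ne').const_mul (m * e))
    apply antitoneOn_of_hasDerivWithinAt_nonpos (convex_Ioc _ _)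
      (fun z hz => (H z hz.1).continuousAt.continuousWithinAt)
    · intro z hz
      rw [interior_Ioc] at hz
      exact (H z hz.1).hasDerivWithinAt
    · intro z hz
      rw [interior_Ioc] at hz
      have hz0 := hz.1
      have := htw z ⟨hz.1, hz.2.le⟩
      have e : 1 - m * w z / z - 1 + m * e * z⁻¹ = - (m / z * (w z - e)) := by
        field_simp; ring
      rw [e, neg_nonpos]
      exact mul_nonneg (by positivity) (by linarith)
  have top : Tendsto (fun s => bowlA (w s)) (nhdsWithin 0 (Ioi 0)) atTop := by
    have l1 : Tendsto (fun s => (bowlA (w t) - t + m * e * Real.log t) + (m * e) * (- Real.log s))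
        (nhdsWithin 0 (Ioi 0)) atTop :=
      tendsto_atTop_add_const_left _ _ (Tendsto.const_mul_atTop (by positivity)
        (tendsto_neg_atBot_atTop.comp Real.tendsto_log_nhdsGT_zero))
    refine tendsto_atTop_mono' _ ?_ l1
    filter_upwards [Ioc_mem_nhdsGT ht] with s hs
    have := anti2 hs ⟨ht, le_rfl⟩ hs.2
    simp only at this
    linarith [hs.1]
  have lim : Tendsto w (nhdsWithin 0 (Ioi 0)) (nhds 1) := by
    rw [tendsto_order]
    constructor
    · intro a ha
      have hb : max a 0 < 1 := max_lt ha one_pos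
      filter_upwards [top.eventually_gt_atTop (bowlA (max a 0)), self_mem_nhdsWithin] with s h1 h2
      exact (le_max_left a 0).trans_lt
        (bowlA_lt (by linarith [le_max_right a 0]) hb (hbound s h2).1 h1)
    · intro a ha
      filter_upwards [self_mem_nhdsWithin] with s h2
      exact (hbound s h2).2.trans ha
  have crit : ∀ s, 0 < s → (deriv w s = 0 ↔ w s = s / m) := by
    intro s hs
    have : 0 < 1 - w s ^ 2 := by nlinarith [hbound s hs]
    rw [(hode s hs).deriv, mul_eq_zero, or_iff_right this.ne']
    constructor
    · intro h
      field_simp at h ⊢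
      linarith
    · intro h
      rw [h]; field_simp; ring
  have gd : ∀ s, 0 < s → HasDerivAt (fun s => s - m * w s)
      (1 - m * ((1 - w s ^ 2) * (1 - m * w s / s))) s :=
    fun s hs => (hasDerivAt_id s).sub ((hode s hs).const_mul m)
  have gc : ContinuousOn (fun s => s - m * w s) (Ioi 0) :=
    fun s hs => (gd s hs).continuousAt.continuousWithinAt
  have uniq : ∀ a b, 0 < a → a < b → w a = a / m → w b = b / m → False := by
    intro a b ha hab h1 h2
    obtain ⟨c, hc, hmin⟩ := isCompact_Icc.exists_isMinOn (nonempty_Icc.2 hab.le)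
      (gc.mono (fun x (hx : x ∈ Icc a b) => ha.trans_le hx.1))
    have ga : a - m * w a = 0 := by rw [h1]; field_simp; ring
    have gb : b - m * w b = 0 := by rw [h2]; field_simp; ring
    have hle : ∀ x ∈ Icc a b, c - m * w c ≤ x - m * w x := fun x hx => hmin hx
    obtain ⟨c, hca, hcb, hle⟩ : ∃ c, a < c ∧ c ≤ b ∧
        ∀ x ∈ Icc a b, c - m * w c ≤ x - m * w x := by
      rcases hc.1.eq_or_lt with h | h
      · refine ⟨b, hab, le_rfl, fun x hx => ?_⟩
        have := hle x hx
        rw [← h] at this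
        linarith
      · exact ⟨c, h, hc.2, hle⟩
    have hc0 : 0 < c := ha.trans hca
    have hg0 : c - m * w c ≤ 0 := by
      have := hle a ⟨le_rfl, hab.le⟩
      linarith
    have hpos : 0 < 1 - m * ((1 - w c ^ 2) * (1 - m * w c / c)) := by
      have p : 0 < 1 - w c ^ 2 := by nlinarith [hbound c hc0]
      have q : 1 - m * w c / c ≤ 0 := by
        rw [sub_nonpos, le_div_iff₀ hc0]; linarith
      have := mul_nonneg hm0.le (mul_nonneg p.le (neg_nonneg.2 q))
      linarith
    have sl := ((hasDerivAt_iff_tendsto_slope.1 (gd c hc0)).mono_left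
      (nhdsWithin_mono c (fun x (hx : x ∈ Iio c) => ne_of_lt hx))).eventually_const_lt hpos
    obtain ⟨x, hx, hx2⟩ := (sl.and (Ioo_mem_nhdsLT hca)).exists
    rw [slope_def_field] at hx
    have := hle x ⟨hx2.1.le, hx2.2.le.trans hcb⟩
    have h5 := div_nonpos_of_nonneg_of_nonpos (sub_nonneg.2 this) (sub_nonpos.2 hx2.2.le)
    linarith
  refine ⟨A1, ?_, fun s hs h => (crit s hs).1 h, lim⟩
  obtain ⟨p, hp, hgp⟩ : ∃ p, 0 < p ∧ p - m * w p ≤ 0 := by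
    have h1 : ∀ᶠ s in nhdsWithin (0:ℝ) (Ioi 0), 1 / 2 < w s :=
      lim.eventually_const_lt (by norm_num)
    have h2 : ∀ᶠ s in nhdsWithin (0:ℝ) (Ioi 0), s < m / 2 :=
      (eventually_lt_nhds (by positivity)).filter_mono nhdsWithin_le_nhds
    obtain ⟨p, hp⟩ := ((h1.and h2).and self_mem_nhdsWithin).exists
    refine ⟨p, hp.2, ?_⟩
    nlinarith [hp.1.1, hp.1.2]
  have hgm : 0 ≤ m - m * w m := by nlinarith [hbound m hm0]
  obtain ⟨c, hc, hc'⟩ := isPreconnected_Ioi.intermediate_value (s := Ioi (0:ℝ)) hp hm0 gc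
      (show (0:ℝ) ∈ Icc _ _ from ⟨hgp, hgm⟩)
  have hc0 : 0 < c := hc
  have hcw : w c = c / m := by
    rw [eq_div_iff hm0.ne']
    simp only at hc'
    linarith
  refine ⟨c, ⟨hc0, (crit c hc0).2 hcw⟩, ?_⟩
  rintro y ⟨hy, hy'⟩
  have hyw := (crit y hy).1 hy'
  rcases lt_trichotomy y c with h | h | h
  · exact (uniq y c hy h hyw hcw).elim
  · exact h
  · exact (uniq c y hc0 h hcw hyw).elim
end

section
/- Let n ≥ 2 be a natural number, let w_B : (0,∞) → ℝ be the solution of (★) extending continuously to 0 with limit 0 and values in (−1,1), and let w : (0,∞) → ℝ be a solution of (★) with −1 < w(s) < 1 for all s > 0 and w(s₀) < w_B(s₀) for some s₀ > 0. Then w(s) < w_B(s) for every s > 0, w'(s) ≠ 0 for every s > 0, w is strictly increasing, and w(s) → −1 as s → 0⁺. -/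
open Set Filter

/-- Positive derivative at a point prevents a left-sided minimum. -/
lemma aux_no_min (h : ℝ → ℝ) (a m h' : ℝ) (ham : a < m) (hd : HasDerivAt h h' m)
    (hpos : 0 < h') : ∃ t, a < t ∧ t < m ∧ h t < h m := by
  have h1 := (hasDerivAt_iff_tendsto_slope.1 hd).eventually (lt_mem_nhds hpos)
  have h2 : ∀ᶠ t in nhdsWithin m (Iio m), 0 < slope h m t :=
    h1.filter_mono (nhdsWithin_mono _ (fun x hx => ne_of_lt hx))
  have h3 : ∀ᶠ t in nhdsWithin m (Iio m), t ∈ Ioo a m := Ioo_mem_nhdsLT ham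
  obtain ⟨t, ht, hat, htm⟩ := (h2.and h3).exists
  refine ⟨t, hat, htm, ?_⟩
  rw [slope_def_field] at ht
  by_contra hc
  push Not at hc
  have : (h t - h m) / (t - m) ≤ 0 := div_nonpos_of_nonneg_of_nonpos (by linarith) (by linarith)
  linarith

lemma aux_bowl (k : ℝ) (hk : 1 ≤ k) (wB : ℝ → ℝ)
    (hBode : ∀ s : ℝ, 0 < s → HasDerivAt wB ((1 - wB s ^ 2) * (1 - k * wB s / s)) s)
    (hBbound : ∀ s : ℝ, 0 < s → -1 < wB s ∧ wB s < 1)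
    (hBlim : Tendsto wB (nhdsWithin 0 (Set.Ioi 0)) (nhds 0)) (s : ℝ) (hs : 0 < s) :
    k * wB s < s := by
  by_contra hc
  push Not at hc
  let h : ℝ → ℝ := fun t => t - k * wB t
  have hd : ∀ t, 0 < t → HasDerivAt h (1 - k * ((1 - wB t ^ 2) * (1 - k * wB t / t))) t :=
    fun t ht => (hasDerivAt_id t).sub ((hBode t ht).const_mul k)
  have hp : ∀ t, 0 < t → h t ≤ 0 → 0 < 1 - k * ((1 - wB t ^ 2) * (1 - k * wB t / t)) := by
    intro t ht hle
    have h1 : 1 - k * wB t / t ≤ 0 := by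
      have : 1 ≤ k * wB t / t := by
        rw [le_div_iff₀ ht]; simp only [h] at hle; linarith
      linarith
    have h2 : 0 ≤ 1 - wB t ^ 2 := by nlinarith [hBbound t ht]
    have := mul_nonpos_of_nonneg_of_nonpos h2 h1
    nlinarith
  have hs0 : h s ≤ 0 := by simp only [h]; linarith
  obtain ⟨t, ht0, hts, hlt⟩ := aux_no_min h 0 s _ hs (hd s hs) (hp s hs hs0)
  have hht : h t < 0 := by linarith
  have hlim : Tendsto h (nhdsWithin 0 (Ioi 0)) (nhds 0) := by
    have : Tendsto (fun t : ℝ => t - k * wB t) (nhdsWithin 0 (Ioi 0)) (nhds (0 - k * 0)) :=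
      (tendsto_id.mono_left nhdsWithin_le_nhds).sub (hBlim.const_mul k)
    simpa [h] using this
  obtain ⟨e, he, he0, het⟩ :=
    ((hlim.eventually (lt_mem_nhds hht)).and (Ioo_mem_nhdsGT ht0)).exists
  obtain ⟨m, hm, hmin⟩ := isCompact_Icc.exists_isMinOn (nonempty_Icc.2 het.le)
    (fun x hx => ((hd x (lt_of_lt_of_le he0 hx.1)).continuousAt).continuousWithinAt)
  have hmt : h m ≤ h t := hmin (right_mem_Icc.2 het.le)
  have hem : e < m := lt_of_le_of_ne hm.1 (by rintro rfl; linarith)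
  have hm0 : 0 < m := he0.trans hem
  obtain ⟨u, hu1, hu2, hu3⟩ := aux_no_min h e m _ hem (hd m hm0) (hp m hm0 (by linarith))
  have : h m ≤ h u := hmin ⟨hu1.le, hu2.le.trans hm.2⟩
  linarith

/-- A function with `d' = g d`, `|g| ≤ C` on `[a,b]` that vanishes somewhere vanishes everywhere. -/
lemma aux_zero (d g : ℝ → ℝ) (a b C : ℝ)
    (hd : ∀ t ∈ Icc a b, HasDerivAt d (g t * d t) t) (hg : ∀ t ∈ Icc a b, |g t| ≤ C)
    (x y : ℝ) (hx : x ∈ Icc a b) (hy : y ∈ Icc a b) (h0 : d x = 0) : d y = 0 := by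
  have hE : ∀ c t, t ∈ Icc a b → HasDerivAt (fun t => d t ^ 2 * Real.exp (c * t))
      ((2 * g t + c) * (d t ^ 2 * Real.exp (c * t))) t := by
    intro c t ht
    have h1 := (hd t ht).pow 2
    have h2 : HasDerivAt (fun t => Real.exp (c * t)) (Real.exp (c * t) * (c * 1)) t :=
      ((hasDerivAt_id t).const_mul c).exp
    refine (h1.mul h2).congr_deriv ?_
    simp
    ring
  have hpos : ∀ c t, 0 ≤ d t ^ 2 * Real.exp (c * t) := fun c t => by positivity
  suffices d y ^ 2 ≤ 0 by nlinarith [sq_nonneg (d y), pow_eq_zero_iff (two_ne_zero) |>.1 (le_antisymm this (sq_nonneg (d y)))]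
  rcases le_total x y with hxy | hxy
  · have hanti : AntitoneOn (fun t => d t ^ 2 * Real.exp ((-2 * C) * t)) (Icc a b) := by
      apply antitoneOn_of_hasDerivWithinAt_nonpos (convex_Icc a b)
        (fun t ht => (hE _ t ht).continuousAt.continuousWithinAt)
        (fun t ht => (hE _ t (interior_subset ht)).hasDerivWithinAt)
      intro t ht
      have := abs_le.1 (hg t (interior_subset ht))
      exact mul_nonpos_of_nonpos_of_nonneg (by linarith) (hpos _ _)
    have := hanti hx hy hxy
    simp only [h0] at this
    have he := Real.exp_pos ((-2 * C) * y)
    by_contra hc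
    push Not at hc
    nlinarith [mul_pos hc he]
  · have hmono : MonotoneOn (fun t => d t ^ 2 * Real.exp ((2 * C) * t)) (Icc a b) := by
      apply monotoneOn_of_hasDerivWithinAt_nonneg (convex_Icc a b)
        (fun t ht => (hE _ t ht).continuousAt.continuousWithinAt)
        (fun t ht => (hE _ t (interior_subset ht)).hasDerivWithinAt)
      intro t ht
      have := abs_le.1 (hg t (interior_subset ht))
      exact mul_nonneg (by linarith) (hpos _ _)
    have := hmono hy hx hxy
    simp only [h0] at this
    have he := Real.exp_pos ((2 * C) * y)
    by_contra hc
    push Not at hc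
    nlinarith [mul_pos hc he]

/-- **Case III.** A solution of `(★)` with values in `(-1,1)` lying below
the bowl derivative `w_B` at one point lies below it everywhere, has no critical points,
is strictly increasing, and tends to `-1` as `s → 0⁺`. -/
theorem solution_below_bowl (n : ℕ) (hn : 2 ≤ n) (wB w : ℝ → ℝ)
    -- the bowl derivative: solution of (★) on (0,∞), values in (-1,1), limit 0 at 0⁺
    (hBode : ∀ s : ℝ, 0 < s →
      HasDerivAt wB ((1 - wB s ^ 2) * (1 - (n - 1 : ℝ) * wB s / s)) s)
    (hBbound : ∀ s : ℝ, 0 < s → -1 < wB s ∧ wB s < 1)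
    (hBlim : Tendsto wB (nhdsWithin 0 (Set.Ioi 0)) (nhds 0))
    -- the solution w
    (hode : ∀ s : ℝ, 0 < s →
      HasDerivAt w ((1 - w s ^ 2) * (1 - (n - 1 : ℝ) * w s / s)) s)
    (hbound : ∀ s : ℝ, 0 < s → -1 < w s ∧ w s < 1)
    (s₀ : ℝ) (hs₀ : 0 < s₀) (hbelow : w s₀ < wB s₀) :
    (∀ s : ℝ, 0 < s → w s < wB s) ∧
    (∀ s : ℝ, 0 < s → deriv w s ≠ 0) ∧
    StrictMonoOn w (Set.Ioi 0) ∧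
    Tendsto w (nhdsWithin 0 (Set.Ioi 0)) (nhds (-1)) := by
  obtain ⟨k, hkdef⟩ : ∃ k : ℝ, k = (n - 1 : ℝ) := ⟨_, rfl⟩
  rw [← hkdef] at hBode hode
  have hk : 1 ≤ k := by
    have : (2 : ℝ) ≤ n := by exact_mod_cast hn
    linarith
  let g : ℝ → ℝ := fun t => -(wB t + w t) - k / t * (1 - (wB t ^ 2 + wB t * w t + w t ^ 2))
  let d : ℝ → ℝ := fun t => wB t - w t
  have hd : ∀ t, 0 < t → HasDerivAt d (g t * d t) t := by
    intro t ht
    refine ((hBode t ht).sub (hode t ht)).congr_deriv ?_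
    simp only [g, d]
    field_simp
    ring
  have hbelow' : ∀ s : ℝ, 0 < s → w s < wB s := by
    intro s hs
    by_contra hc
    push Not at hc
    have hcont : ContinuousOn d (uIcc s s₀) := fun t ht =>
      (hd t (lt_of_lt_of_le (lt_min hs hs₀) ht.1)).continuousAt.continuousWithinAt
    have hz : (0 : ℝ) ∈ uIcc (d s) (d s₀) := by
      apply Icc_subset_uIcc
      simp only [d, mem_Icc]
      constructor <;> linarith
    obtain ⟨z, hzm, hz0⟩ := intermediate_value_uIcc hcont hz
    have ha : 0 < min s s₀ := lt_min hs hs₀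
    have := aux_zero d g (min s s₀) (max s s₀) (2 + k / min s s₀ * 4)
      (fun t ht => hd t (lt_of_lt_of_le ha ht.1)) (by
        intro t ht
        have ht0 : 0 < t := lt_of_lt_of_le ha ht.1
        obtain ⟨b1, b2⟩ := hBbound t ht0
        obtain ⟨c1, c2⟩ := hbound t ht0
        have hkt : k / t ≤ k / min s s₀ := div_le_div_of_nonneg_left (by linarith) ha ht.1
        have hkt0 : 0 < k / t := div_pos (by linarith) ht0
        have e1 : 1 - (wB t ^ 2 + wB t * w t + w t ^ 2) ≤ 4 := by nlinarith [sq_nonneg (wB t), sq_nonneg (w t), sq_nonneg (wB t + w t)]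
        have e2 : -4 ≤ 1 - (wB t ^ 2 + wB t * w t + w t ^ 2) := by nlinarith
        simp only [g]
        rw [abs_le]
        constructor <;> nlinarith) z s₀ hzm ⟨min_le_right _ _, le_max_right _ _⟩ hz0
    simp only [d] at this
    linarith
  have hkw : ∀ s : ℝ, 0 < s → 0 < (1 - w s ^ 2) * (1 - k * w s / s) := by
    intro s hs
    have h1 := aux_bowl k hk wB hBode hBbound hBlim s hs
    have h2 : k * w s < s := by nlinarith [hbelow' s hs]
    have h3 : k * w s / s < 1 := (div_lt_one hs).2 h2
    have h4 : 0 < 1 - w s ^ 2 := by nlinarith [hbound s hs]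
    exact mul_pos h4 (by linarith)
  have hmono : StrictMonoOn w (Ioi 0) := by
    apply strictMonoOn_of_deriv_pos (convex_Ioi 0)
      (fun t ht => (hode t ht).continuousAt.continuousWithinAt)
    intro t ht
    have ht' : (0 : ℝ) < t := interior_subset ht
    rw [(hode t ht').deriv]
    exact hkw t ht'
  refine ⟨hbelow', fun s hs => by rw [(hode s hs).deriv]; exact (hkw s hs).ne', hmono, ?_⟩
  -- w is negative somewhere
  have hneg : ∃ s, 0 < s ∧ w s < 0 := by
    by_contra hc
    push Not at hc
    have hwlim : Tendsto w (nhdsWithin 0 (Ioi 0)) (nhds 0) :=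
      tendsto_of_tendsto_of_tendsto_of_le_of_le' tendsto_const_nhds hBlim
        (eventually_mem_nhdsWithin.mono fun s hs => hc s hs)
        (eventually_mem_nhdsWithin.mono fun s hs => (hbelow' s hs).le)
    have hdlim : Tendsto d (nhdsWithin 0 (Ioi 0)) (nhds 0) := by
      simpa [d] using hBlim.sub hwlim
    have hsm : ∀ᶠ t in nhdsWithin 0 (Ioi 0), wB t < 1 / 2 :=
      hBlim.eventually (gt_mem_nhds (by norm_num))
    obtain ⟨δ, hδ, hδs⟩ := mem_nhdsGT_iff_exists_Ioo_subset.1 hsm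
    have hδ0 : (0 : ℝ) < δ := hδ
    have hanti : AntitoneOn d (Ioo 0 δ) := by
      apply antitoneOn_of_hasDerivWithinAt_nonpos (convex_Ioo 0 δ)
        (fun t ht => (hd t ht.1).continuousAt.continuousWithinAt)
        (fun t ht => (hd t (interior_subset ht).1).hasDerivWithinAt)
      intro t ht
      have ht' := interior_subset ht
      have h1 : wB t < 1 / 2 := hδs ht'
      have h2 := hbelow' t ht'.1
      have h3 := hc t ht'.1
      have hkt0 : 0 < k / t := div_pos (by linarith) ht'.1
      have h4 : 0 ≤ 1 - (wB t ^ 2 + wB t * w t + w t ^ 2) := by nlinarith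
      apply mul_nonpos_of_nonpos_of_nonneg
      · simp only [g]; nlinarith [mul_nonneg hkt0.le h4]
      · simp only [d]; linarith
    have hp : 0 < d (δ / 2) := by
      simp only [d]; linarith [hbelow' (δ / 2) (by linarith)]
    obtain ⟨t, ht, ht0, ht2⟩ := ((hdlim.eventually (gt_mem_nhds hp)).and
      (Ioo_mem_nhdsGT (show (0 : ℝ) < δ / 2 by linarith))).exists
    have := hanti ⟨ht0, by linarith⟩ ⟨by linarith, by linarith⟩ ht2.le
    linarith
  obtain ⟨s₁, hs₁, hw₁⟩ := hneg
  have key : ∀ b, -1 < b → ∃ s, 0 < s ∧ w s < b := by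
    intro b hb
    by_contra hc
    push Not at hc
    obtain ⟨m, hm⟩ : ∃ m, m = (1 + b) * (k * -w s₁) := ⟨_, rfl⟩
    have hm0 : 0 < m := by
      rw [hm]; exact mul_pos (by linarith) (mul_pos (by linarith) (by linarith))
    have hD : ∀ t, 0 < t → HasDerivAt (fun t => w t - m * Real.log t)
        ((1 - w t ^ 2) * (1 - k * w t / t) - m * t⁻¹) t := fun t ht =>
      (hode t ht).sub ((Real.hasDerivAt_log ht.ne').const_mul m)
    have hM : MonotoneOn (fun t => w t - m * Real.log t) (Ioc 0 s₁) := by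
      apply monotoneOn_of_hasDerivWithinAt_nonneg (convex_Ioc 0 s₁)
        (fun t ht => (hD t ht.1).continuousAt.continuousWithinAt)
        (fun t ht => (hD t (interior_subset ht).1).hasDerivWithinAt)
      intro t ht
      obtain ⟨ht0, ht1⟩ := interior_subset ht
      have hle : w t ≤ w s₁ := hmono.monotoneOn ht0 hs₁ ht1
      have hbt := hc t ht0
      have hti : 0 < t⁻¹ := inv_pos.2 ht0
      have h1 : 1 + b ≤ 1 - w t ^ 2 := by nlinarith [hbound t ht0]
      have h2 : (k * -w s₁) * t⁻¹ ≤ 1 - k * w t / t := by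
        rw [div_eq_mul_inv]
        have : k * -w s₁ ≤ k * -w t := mul_le_mul_of_nonneg_left (by linarith) (by linarith)
        nlinarith [mul_le_mul_of_nonneg_right this hti.le]
      have h3 : 0 ≤ (k * -w s₁) * t⁻¹ :=
        mul_nonneg (mul_nonneg (by linarith) (by linarith)) hti.le
      have := mul_le_mul h1 h2 h3 (by linarith)
      rw [hm]
      linarith
    have hl : Tendsto Real.log (nhdsWithin 0 (Ioi 0)) atBot := Real.tendsto_log_nhdsGT_zero
    obtain ⟨t, ht, ht0, ht1⟩ := ((hl.eventually
      (eventually_lt_atBot (Real.log s₁ - 1 / m * (w s₁ + 1)))).and (Ioo_mem_nhdsGT hs₁)).exists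
    have h1 := hM ⟨ht0, ht1.le⟩ ⟨hs₁, le_rfl⟩ ht1.le
    simp only at h1
    have h2 := mul_lt_mul_of_pos_left ht hm0
    have h3 : m * (Real.log s₁ - 1 / m * (w s₁ + 1)) = m * Real.log s₁ - (w s₁ + 1) := by
      field_simp
    linarith [(hbound t ht0).1]
  rw [tendsto_order]
  constructor
  · intro a ha
    exact eventually_mem_nhdsWithin.mono fun s hs => ha.trans (hbound s hs).1
  · intro b hb
    obtain ⟨s, hs, hsb⟩ := key b hb
    filter_upwards [Ioo_mem_nhdsGT hs] with t ht
    exact (hmono ht.1 hs ht.2).trans hsb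
end

section
/- Let n ≥ 2 be a natural number, let s₀ > 0 and w₀ < −1. Then the maximal solution w of (★) with w(s₀) = w₀ is defined exactly on an interval (0, s₁) with s₀ < s₁ < ∞, satisfies w(s) < −1 for all s in its domain, is strictly decreasing, satisfies w(s) → −1 as s → 0⁺, and w(s) → −∞ as s → s₁⁻ (finite-time blow-up). -/
open Set Filter

/-- Global existence for a bounded, globally Lipschitz right-hand side. -/
lemma aux_global (f : ℝ → ℝ → ℝ) (hc : ∀ x, Continuous fun t => f t x)
    (hL : ∀ t, LipschitzWith 1 (f t)) (hb : ∀ t x, |f t x| ≤ 1) (t₀ x₀ : ℝ) :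
    ∃ S : ℝ → ℝ, S t₀ = x₀ ∧ ∀ t, HasDerivAt S (f t (S t)) t := by
  have loc : ∀ N : ℕ, ∃ α : ℝ → ℝ, α t₀ = x₀ ∧
      ∀ t ∈ Ioo (t₀ - (N + 1)) (t₀ + (N + 1)), HasDerivAt α (f t (α t)) t := by
    intro N
    have hN : (0 : ℝ) < N + 1 := by positivity
    have hp : IsPicardLindelof f (tmin := t₀ - (N + 1)) (tmax := t₀ + (N + 1))
        ⟨t₀, by constructor <;> linarith⟩ x₀ ((N : NNReal) + 1) 0 1 1 := by
      refine ⟨fun t _ => (hL t).lipschitzOnWith, fun x _ => (hc x).continuousOn,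
        fun t _ x _ => by simpa using hb t x, ?_⟩
      simp
    obtain ⟨α, h0, h⟩ := hp.exists_eq_forall_mem_Icc_hasDerivWithinAt₀
    exact ⟨α, h0, fun t ht => (h t (Ioo_subset_Icc_self ht)).hasDerivAt (Icc_mem_nhds ht.1 ht.2)⟩
  choose γ h0 h using loc
  have key : ∀ N M : ℕ, N ≤ M → EqOn (γ N) (γ M) (Ioo (t₀ - (N + 1)) (t₀ + (N + 1))) := by
    intro N M hNM
    have hN : (0 : ℝ) < N + 1 := by positivity
    have hNM' : (N : ℝ) ≤ M := by exact_mod_cast hNM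
    refine ODE_solution_unique_of_mem_Ioo (v := f) (s := fun _ => univ) (K := 1) (t₀ := t₀)
      (fun t _ => (hL t).lipschitzOnWith) (by constructor <;> linarith)
      (fun t ht => ⟨h N t ht, trivial⟩)
      (fun t ht => ⟨h M t ⟨by linarith [ht.1], by linarith [ht.2]⟩, trivial⟩) ?_
    rw [h0, h0]
  have hmem : ∀ t, t ∈ Ioo (t₀ - ((⌈|t - t₀|⌉₊ : ℕ) + 1)) (t₀ + ((⌈|t - t₀|⌉₊ : ℕ) + 1)) := by
    intro t
    have h1 := Nat.le_ceil |t - t₀|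
    have h2 := abs_le.1 h1
    constructor <;> linarith [h2.1, h2.2]
  refine ⟨fun t => γ ⌈|t - t₀|⌉₊ t, h0 _, fun t => ?_⟩
  set N := ⌈|t - t₀|⌉₊ with hN
  have hev : (fun t => γ ⌈|t - t₀|⌉₊ t) =ᶠ[nhds t] γ N := by
    filter_upwards [Ioo_mem_nhds (hmem t).1 (hmem t).2] with x hx
    rcases le_total ⌈|x - t₀|⌉₊ N with hle | hle
    · exact key _ _ hle (hmem x)
    · exact (key _ _ hle hx).symm
  exact (h N t (hmem t)).congr_of_eventuallyEq hev

lemma aux_lip (m : ℝ) (hm : 1 ≤ m) (p : ℝ) (hp0 : 0 ≤ p) (hp1 : p ≤ 1) :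
    LipschitzWith 1 (fun x : ℝ => max x 0 * p / (m + max x 0 * p)) := by
  refine LipschitzWith.of_dist_le_mul fun x y => ?_
  rw [Real.dist_eq, Real.dist_eq]
  have h := abs_max_sub_max_le_abs x y 0
  set a := max x 0
  set b := max y 0
  have ha : 0 ≤ a := le_max_right _ _
  have hb : 0 ≤ b := le_max_right _ _
  have hap : 0 ≤ a * p := by positivity
  have hbp : 0 ≤ b * p := by positivity
  have e : a * p / (m + a * p) - b * p / (m + b * p)
      = (a - b) * (m * p / ((m + a * p) * (m + b * p))) := by
    field_simp
    ring
  have hq : 0 ≤ m * p / ((m + a * p) * (m + b * p)) := by positivity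
  have hq1 : m * p / ((m + a * p) * (m + b * p)) ≤ 1 := by
    rw [div_le_one (by positivity)]
    have : m * 1 ≤ (m + a * p) * (m + b * p) :=
      mul_le_mul (by linarith) (by linarith) (by norm_num) (by positivity)
    nlinarith
  rw [e, abs_mul, abs_of_nonneg hq]
  have := abs_nonneg (a - b)
  simp only [NNReal.coe_one, one_mul]
  nlinarith

/-- Uniqueness for the equation, on intervals. -/
lemma aux_unique (m : ℝ) (hm : 1 ≤ m) (a b s₀ : ℝ) (ha : 0 ≤ a) (h0 : s₀ ∈ Ioo a b)
    (v w : ℝ → ℝ)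
    (hv : ∀ s ∈ Ioo a b, HasDerivAt v ((1 - v s ^ 2) * (1 - m * v s / s)) s)
    (hw : ∀ s ∈ Ioo a b, HasDerivAt w ((1 - w s ^ 2) * (1 - m * w s / s)) s)
    (he : v s₀ = w s₀) : EqOn v w (Ioo a b) := by
  intro x hx
  obtain ⟨c, hc1, hc2⟩ := exists_between (lt_min h0.1 hx.1)
  obtain ⟨d, hd1, hd2⟩ := exists_between (max_lt h0.2 hx.2)
  obtain ⟨hc3, hc4⟩ := lt_min_iff.1 hc2
  obtain ⟨hd3, hd4⟩ := max_lt_iff.1 hd1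
  have hc : 0 < c := lt_of_le_of_lt ha hc1
  have hsub : Icc c d ⊆ Ioo a b := fun y hy => ⟨lt_of_lt_of_le hc1 hy.1, lt_of_le_of_lt hy.2 hd2⟩
  have cv : ContinuousOn v (Icc c d) := fun y hy =>
    (hv y (hsub hy)).continuousAt.continuousWithinAt
  have cw : ContinuousOn w (Icc c d) := fun y hy =>
    (hw y (hsub hy)).continuousAt.continuousWithinAt
  obtain ⟨R1, hR1⟩ := isCompact_Icc.exists_bound_of_continuousOn cv
  obtain ⟨R2, hR2⟩ := isCompact_Icc.exists_bound_of_continuousOn cw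
  set R := max (max R1 R2) 0
  have hR : 0 ≤ R := le_max_right _ _
  have hR1' : R1 ≤ R := le_trans (le_max_left _ _) (le_max_left _ _)
  have hR2' : R2 ≤ R := le_trans (le_max_right _ _) (le_max_left _ _)
  set Q := m / c with hQ
  have hQ0 : 0 ≤ Q := by positivity
  have hK : 0 ≤ Q + 2 * R + 3 * Q * R ^ 2 := by positivity
  have hIoo : Ioo c d ⊆ Icc c d := Ioo_subset_Icc_self
  refine ODE_solution_unique_of_mem_Ioo
    (v := fun s y => (1 - y ^ 2) * (1 - m * y / s)) (s := fun _ => Icc (-R) R)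
    (K := ⟨Q + 2 * R + 3 * Q * R ^ 2, hK⟩) (t₀ := s₀) (a := c) (b := d) ?_ ⟨hc3, hd3⟩
    (fun t ht => ⟨hv t (hsub (hIoo ht)), ?_⟩) (fun t ht => ⟨hw t (hsub (hIoo ht)), ?_⟩) he
    ⟨hc4, hd4⟩
  · intro t ht
    refine LipschitzOnWith.of_dist_le_mul fun x hx y hy => ?_
    rw [Real.dist_eq, Real.dist_eq]
    have ht0 : 0 < t := hc.trans ht.1
    have hq0 : 0 ≤ m / t := by positivity
    have hqQ : m / t ≤ Q := by
      rw [hQ]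
      exact div_le_div_of_nonneg_left (by linarith) hc ht.1.le
    set q := m / t
    have e : (1 - x ^ 2) * (1 - m * x / t) - (1 - y ^ 2) * (1 - m * y / t)
        = (-q - (x + y) + q * (x ^ 2 + x * y + y ^ 2)) * (x - y) := by
      have h1 : m * x / t = q * x := by simp only [q]; ring
      have h2 : m * y / t = q * y := by simp only [q]; ring
      rw [h1, h2]; ring
    rw [e, abs_mul]
    refine mul_le_mul_of_nonneg_right ?_ (abs_nonneg _)
    have hx' : |x| ≤ R := abs_le.2 hx
    have hy' : |y| ≤ R := abs_le.2 hy
    have hxx : x ^ 2 ≤ R ^ 2 := sq_le_sq' hx.1 hx.2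
    have hyy : y ^ 2 ≤ R ^ 2 := sq_le_sq' hy.1 hy.2
    have g0 : 0 ≤ x ^ 2 + x * y + y ^ 2 := by nlinarith [sq_nonneg (x + y), sq_nonneg (x - y)]
    have g1 : x ^ 2 + x * y + y ^ 2 ≤ 3 * R ^ 2 := by nlinarith [sq_nonneg (x - y)]
    have g2 : q * (x ^ 2 + x * y + y ^ 2) ≤ Q * (3 * R ^ 2) :=
      mul_le_mul hqQ g1 g0 hQ0
    have g3 : 0 ≤ q * (x ^ 2 + x * y + y ^ 2) := mul_nonneg hq0 g0
    have g4 : 0 ≤ Q * (3 * R ^ 2) := by positivity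
    change _ ≤ Q + 2 * R + 3 * Q * R ^ 2
    rw [abs_le]
    constructor <;> linarith [hx.1, hx.2, hy.1, hy.2]
  · exact abs_le.1 ((hR1 t (hIoo ht)).trans hR1')
  · exact abs_le.1 ((hR2 t (hIoo ht)).trans hR2')

lemma aux_coth (y : ℝ) (hy : y < -1) : ∃ t < 0, Real.cosh t / Real.sinh t = y := by
  have h1 : y⁻¹ ∈ Ioo (-1 : ℝ) 0 := by
    refine ⟨?_, inv_lt_zero.2 (by linarith)⟩
    rw [lt_inv_of_neg (by norm_num) (by linarith)]
    norm_num
    exact hy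
  refine ⟨Real.artanh y⁻¹, Real.artanh_neg h1, ?_⟩
  have := Real.tanh_artanh (x := y⁻¹) ⟨h1.1, by linarith [h1.2]⟩
  rw [Real.tanh_eq_sinh_div_cosh] at this
  rw [← inv_div, this, inv_inv]

lemma aux_coth_lt (t : ℝ) (ht : t < 0) : Real.cosh t / Real.sinh t < -1 := by
  have h := Real.sinh_neg_iff.2 ht
  rw [div_lt_iff_of_neg h]
  have := Real.exp_pos t
  rw [← Real.cosh_add_sinh] at this
  linarith

/-- The inverse parametrization: `s` as a function of `t`, where `w = coth t`. -/
lemma aux_param (m : ℝ) (hm : 1 ≤ m) (t₀ s₀ : ℝ) (ht₀ : t₀ < 0) (hs₀ : 0 < s₀) :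
    ∃ S S' : ℝ → ℝ, S t₀ = s₀ ∧ Continuous S ∧ Continuous S' ∧
      (∀ t, HasDerivAt S (S' t) t) ∧ (∀ t, 0 < S t) ∧
      (∀ t < 0, 0 < S' t ∧ (S' t)⁻¹ = 1 - m * (Real.cosh t / Real.sinh t) / S t) ∧
      (∀ δ > 0, ∃ t < t₀, S t < δ) := by
  set P : ℝ → ℝ := fun t => max (-(Real.sinh t / Real.cosh t)) 0 with hP
  have hPc : Continuous P := by
    refine Continuous.max (Continuous.neg ?_) continuous_const
    exact Real.continuous_sinh.div Real.continuous_cosh fun t => (Real.cosh_pos t).ne'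
  have hP0 : ∀ t, 0 ≤ P t := fun t => le_max_right _ _
  have hP1 : ∀ t, P t ≤ 1 := by
    intro t
    refine max_le ?_ zero_le_one
    rw [← neg_div, div_le_one (Real.cosh_pos t)]
    have := Real.exp_pos t
    rw [← Real.cosh_add_sinh] at this
    linarith
  have hPneg : ∀ t < 0, P t = -(Real.sinh t / Real.cosh t) := by
    intro t ht
    refine max_eq_left ?_
    rw [← neg_div]
    exact div_nonneg (by linarith [Real.sinh_neg_iff.2 ht]) (Real.cosh_pos t).le
  have hPpos : ∀ t < 0, 0 < P t := by
    intro t ht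
    rw [hPneg t ht, ← neg_div]
    exact div_pos (by linarith [Real.sinh_neg_iff.2 ht]) (Real.cosh_pos t)
  have hPmono : ∀ t ≤ t₀, P t₀ ≤ P t := by
    intro t ht
    rw [hPneg t (by linarith), hPneg t₀ ht₀, neg_le_neg_iff,
      div_le_div_iff₀ (Real.cosh_pos t) (Real.cosh_pos t₀)]
    have h1 : Real.sinh (t - t₀) ≤ 0 := Real.sinh_nonpos_iff.2 (by linarith)
    rw [Real.sinh_sub] at h1
    linarith
  set f : ℝ → ℝ → ℝ := fun t x => max x 0 * P t / (m + max x 0 * P t) with hf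
  have hden : ∀ t x, 0 < m + max x 0 * P t := fun t x => by
    have := mul_nonneg (le_max_right x 0) (hP0 t)
    linarith
  have hLip : ∀ t, LipschitzWith 1 (f t) := fun t => aux_lip m hm (P t) (hP0 t) (hP1 t)
  obtain ⟨S, hS0, hS⟩ := aux_global f
    (fun x => (continuous_const.mul hPc).div (continuous_const.add (continuous_const.mul hPc))
      fun t => (hden t x).ne')
    hLip
    (fun t x => by
      have := mul_nonneg (le_max_right x 0) (hP0 t)
      rw [abs_of_nonneg (div_nonneg this (hden t x).le), div_le_one (hden t x)]
      linarith) t₀ s₀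
  have hSc : Continuous S := continuous_iff_continuousAt.2 fun t => (hS t).continuousAt
  have hne : ∀ t, S t ≠ 0 := by
    intro t ht
    have : S = fun _ => 0 := by
      refine ODE_solution_unique_univ (v := f) (s := fun _ => univ) (K := 1) (t₀ := t)
        (fun t => (hLip t).lipschitzOnWith) (fun t => ⟨hS t, trivial⟩)
        (fun t => ⟨?_, trivial⟩) ht
      have : f t 0 = 0 := by simp [hf]
      rw [this]
      exact hasDerivAt_const t 0
    rw [this] at hS0
    linarith
  have hpos : ∀ t, 0 < S t := by
    intro t
    by_contra hcon
    have hle : S t ≤ 0 := not_lt.1 hcon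
    obtain ⟨y, hy⟩ := mem_range_of_exists_le_of_exists_ge hSc ⟨t, hle⟩ ⟨t₀, by rw [hS0]; exact hs₀.le⟩
    exact hne y hy
  have hfS : ∀ t, f t (S t) = S t * P t / (m + S t * P t) := by
    intro t
    simp only [hf, max_eq_left (hpos t).le]
  have hdS : ∀ t, 0 < m + S t * P t := fun t => by
    have := mul_nonneg (hpos t).le (hP0 t)
    linarith
  refine ⟨S, fun t => S t * P t / (m + S t * P t), hS0, hSc, ?_, fun t => (hS t).congr_deriv (hfS t), hpos, ?_, ?_⟩
  · exact (hSc.mul hPc).div (continuous_const.add (hSc.mul hPc)) fun t => (hdS t).ne'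
  · intro t ht
    have h1 := mul_pos (hpos t) (hPpos t ht)
    refine ⟨div_pos h1 (hdS t), ?_⟩
    have h2 : Real.cosh t / Real.sinh t = -(P t)⁻¹ := by
      rw [hPneg t ht, inv_neg, neg_neg, inv_div]
    have h3 := (hpos t).ne'
    have h4 := (hPpos t ht).ne'
    rw [h2, inv_div]
    field_simp
    ring
  · intro δ hδ
    by_contra! hcon
    have hp := hPpos t₀ ht₀
    set c := δ * P t₀ / (m + δ * P t₀) with hc
    have hδp := mul_pos hδ hp
    have hc0 : 0 < c := by positivity
    have hder : ∀ t < t₀, c ≤ S t * P t / (m + S t * P t) := by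
      intro t ht
      have h1 : δ * P t₀ ≤ S t * P t :=
        mul_le_mul (hcon t ht) (hPmono t ht.le) hp.le (hpos t).le
      rw [hc, div_le_div_iff₀ (by linarith) (hdS t)]
      nlinarith
    have hmvt := (convex_Iic t₀).mul_sub_le_image_sub_of_le_deriv (f := S) hSc.continuousOn
      (fun t _ => (hS t).differentiableAt.differentiableWithinAt) (C := c)
      (fun t ht => by
        rw [interior_Iic] at ht
        rw [(hS t).deriv, hfS]
        exact hder t ht)
    have h2 := hmvt (t₀ - s₀ / c) (by simp; positivity) t₀ (by simp)
      (by have : 0 < s₀ / c := by positivity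
          linarith)
    have h3 : c * (t₀ - (t₀ - s₀ / c)) = s₀ := by field_simp; ring
    rw [h3, hS0] at h2
    linarith [hpos (t₀ - s₀ / c)]

/-- **Case IV.** For initial data `w(s₀) = w₀ < -1` with `s₀ > 0`, the
maximal solution of `(★)` is defined exactly on an interval `(0, s₁)` with
`s₀ < s₁ < ∞`, stays below `-1`, is strictly decreasing, tends to `-1` at `0⁺`
and blows up to `-∞` in finite time at `s₁`. -/
theorem maximal_solution_below_minus_one (n : ℕ) (hn : 2 ≤ n)
    (s₀ w₀ : ℝ) (hs₀ : 0 < s₀) (hw₀ : w₀ < -1) :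
    ∃ s₁ : ℝ, s₀ < s₁ ∧
      ∃ w : ℝ → ℝ, w s₀ = w₀ ∧
        (∀ s ∈ Set.Ioo 0 s₁,
          HasDerivAt w ((1 - w s ^ 2) * (1 - (n - 1 : ℝ) * w s / s)) s) ∧
        (∀ s ∈ Set.Ioo 0 s₁, w s < -1) ∧
        StrictAntiOn w (Set.Ioo 0 s₁) ∧
        Tendsto w (nhdsWithin 0 (Set.Ioi 0)) (nhds (-1)) ∧
        Tendsto w (nhdsWithin s₁ (Set.Iio s₁)) atBot ∧
        -- maximality: any solution through `(s₀, w₀)` on a subinterval of `(0,∞)`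
        -- is a restriction of `w`
        (∀ (a b : ℝ) (v : ℝ → ℝ), 0 ≤ a → a < s₀ → s₀ < b →
          (∀ s ∈ Set.Ioo a b,
            HasDerivAt v ((1 - v s ^ 2) * (1 - (n - 1 : ℝ) * v s / s)) s) →
          v s₀ = w₀ →
          Set.Ioo a b ⊆ Set.Ioo 0 s₁ ∧ Set.EqOn v w (Set.Ioo a b)) := by
  set m : ℝ := (n - 1 : ℝ) with hmdef
  have hm : 1 ≤ m := by
    have : (2 : ℝ) ≤ n := by exact_mod_cast hn
    rw [hmdef]; linarith
  obtain ⟨t₀, ht₀, hct₀⟩ := aux_coth w₀ hw₀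
  obtain ⟨S, S', hS0, hSc, hS'c, hS, hpos, hS', hinf⟩ := aux_param m hm t₀ s₀ ht₀ hs₀
  have hmono : StrictMonoOn S (Iic 0) := by
    refine strictMonoOn_of_deriv_pos (convex_Iic 0) hSc.continuousOn fun t ht => ?_
    rw [interior_Iic] at ht
    rw [(hS t).deriv]
    exact (hS' t ht).1
  have hlt : ∀ {t u : ℝ}, t < u → u ≤ 0 → S t < S u := fun h hu =>
    hmono (h.le.trans hu) hu h
  have hsurj : ∀ s ∈ Ioo 0 (S 0), ∃ t < 0, S t = s := by
    intro s hs
    obtain ⟨t1, ht1, ht1'⟩ := hinf s hs.1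
    obtain ⟨t, ht, rfl⟩ := intermediate_value_Ioo (f := S) (ht1.trans ht₀).le hSc.continuousOn
      ⟨ht1', hs.2⟩
    exact ⟨t, ht.2, rfl⟩
  set σ : ℝ → ℝ := Function.invFunOn S (Iio 0) with hσ
  have hσS : ∀ t < 0, σ (S t) = t := by
    intro t ht
    have hinj : InjOn S (Iio 0) := (hmono.mono Iio_subset_Iic_self).injOn
    exact hinj.leftInvOn_invFunOn ht
  set w : ℝ → ℝ := fun s => Real.cosh (σ s) / Real.sinh (σ s) with hw
  have hwS : ∀ t < 0, w (S t) = Real.cosh t / Real.sinh t := by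
    intro t ht
    simp only [hw, hσS t ht]
  have hwd : ∀ s ∈ Ioo 0 (S 0), HasDerivAt w ((1 - w s ^ 2) * (1 - m * w s / s)) s := by
    intro s hs
    obtain ⟨t, ht, rfl⟩ := hsurj s hs
    have hstrict : HasStrictDerivAt S (S' t) t :=
      hasStrictDerivAt_of_hasDerivAt_of_continuousAt (Eventually.of_forall hS) hS'c.continuousAt
    have h1 : HasDerivAt σ (S' t)⁻¹ (S t) := by
      refine (hstrict.to_local_left_inverse (hS' t ht).1.ne' ?_).hasDerivAt
      filter_upwards [Iio_mem_nhds ht] with u hu using hσS u hu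
    have hsh : Real.sinh t ≠ 0 := (Real.sinh_neg_iff.2 ht).ne
    have h2 := (Real.hasDerivAt_cosh t).div (Real.hasDerivAt_sinh t) hsh
    rw [← hσS t ht] at h2
    have h3 := h2.comp (S t) h1
    rw [hσS t ht] at h3
    rw [hwS t ht, ← (hS' t ht).2]
    refine HasDerivAt.congr_deriv h3 ?_
    congr 1
    field_simp
  have hwlt : ∀ s ∈ Ioo 0 (S 0), w s < -1 := by
    intro s hs
    obtain ⟨t, ht, rfl⟩ := hsurj s hs
    rw [hwS t ht]
    exact aux_coth_lt t ht
  have hanti : StrictAntiOn w (Ioo 0 (S 0)) := by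
    refine strictAntiOn_of_deriv_neg (convex_Ioo _ _)
      (fun s hs => (hwd s hs).continuousAt.continuousWithinAt) fun s hs => ?_
    rw [interior_Ioo] at hs
    rw [(hwd s hs).deriv]
    have h1 := hwlt s hs
    have h2 : m * w s / s < 0 := div_neg_of_neg_of_pos (by nlinarith) hs.1
    exact mul_neg_of_neg_of_pos (by nlinarith) (by linarith)
  have hmemS : ∀ t < 0, S t ∈ Ioo 0 (S 0) := fun t ht => ⟨hpos t, hlt ht le_rfl⟩
  have hw0 : w s₀ = w₀ := by rw [← hS0, hwS t₀ ht₀, hct₀]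
  have hs01 : s₀ < S 0 := hS0 ▸ hlt ht₀ le_rfl
  have hbot : Tendsto w (nhdsWithin (S 0) (Set.Iio (S 0))) atBot := by
    rw [tendsto_atBot]
    intro M
    obtain ⟨t, ht, hct⟩ := aux_coth (min M (-2)) (by
      have := min_le_right M (-2)
      linarith)
    filter_upwards [Ioo_mem_nhdsLT (hlt ht le_rfl)] with s hs
    have := hanti (hmemS t ht) ⟨(hpos t).trans hs.1, hs.2⟩ hs.1
    rw [hwS t ht, hct] at this
    exact this.le.trans (min_le_left _ _)
  refine ⟨S 0, hs01, w, hw0, hwd, hwlt, hanti, ?_, hbot, ?_⟩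
  · rw [tendsto_order]
    constructor
    · intro y hy
      obtain ⟨t, ht, hct⟩ := aux_coth y hy
      filter_upwards [Ioo_mem_nhdsGT (hpos t)] with s hs
      have := hanti ⟨hs.1, hs.2.trans (hlt ht le_rfl)⟩ (hmemS t ht) hs.2
      rwa [hwS t ht, hct] at this
    · intro y hy
      filter_upwards [Ioo_mem_nhdsGT (hpos 0)] with s hs
      exact (hwlt s hs).trans hy
  · intro a b v ha has hsb hv hv0
    have heq : EqOn v w (Ioo a (min b (S 0))) := by
      refine aux_unique m hm a _ s₀ ha ⟨has, lt_min hsb hs01⟩ v w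
        (fun s hs => hv s ⟨hs.1, hs.2.trans_le (min_le_left _ _)⟩)
        (fun s hs => hwd s ⟨ha.trans_lt hs.1, hs.2.trans_le (min_le_right _ _)⟩) ?_
      rw [hv0, hw0]
    have hb : b ≤ S 0 := by
      by_contra! hlt'
      rw [min_eq_right hlt'.le] at heq
      have has1 : a < S 0 := has.trans hs01
      have hcv : Tendsto v (nhdsWithin (S 0) (Iio (S 0))) (nhds (v (S 0))) :=
        (hv (S 0) ⟨has1, hlt'⟩).continuousAt.tendsto.mono_left nhdsWithin_le_nhds
      have hvb : Tendsto v (nhdsWithin (S 0) (Iio (S 0))) atBot := by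
        refine hbot.congr' ?_
        filter_upwards [Ioo_mem_nhdsLT has1] with s hs using (heq hs).symm
      exact not_tendsto_nhds_of_tendsto_atBot hvb _ hcv
    rw [min_eq_left hb] at heq
    exact ⟨fun s hs => ⟨ha.trans_lt hs.1, hs.2.trans_le hb⟩, heq⟩
end

section
/- Let n ≥ 2 be a natural number. There exists a solution 𝐰 : (0,∞) → ℝ of (★) defined on all of (0,∞) such that 𝐰(s) > s/(n−1) for every s > 0, 𝐰 is strictly increasing, 𝐰(s) > 1 for every s > 0, 𝐰'(s) → 1/(n−1) as s → +∞, and (n−1)·𝐰(s) − s → 0 as s → +∞ (so 𝐰 is asymptotic at infinity to the line x = s/(n−1)). -/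
open Set Filter

lemma aux_barrier {f f' B B' : ℝ → ℝ} {a b : ℝ}
    (hf : ∀ x ∈ Icc a b, HasDerivWithinAt f (f' x) (Icc a b) x)
    (hB : ∀ x ∈ Icc a b, HasDerivWithinAt B (B' x) (Icc a b) x)
    (hb : f b ≤ B b) (h : ∀ x ∈ Icc a b, f x = B x → B' x < f' x) :
    ∀ x ∈ Icc a b, f x ≤ B x := by
  have key : ∀ {g g' : ℝ → ℝ}, (∀ x ∈ Icc a b, HasDerivWithinAt g (g' x) (Icc a b) x) →
      ∀ x ∈ Icc (-b) (-a), HasDerivWithinAt (fun t => g (-t)) (-(g' (-x))) (Icc (-b) (-a)) x := by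
    intro g g' hg x hx
    have h1 := hg (-x) ⟨by linarith [hx.2], by linarith [hx.1]⟩
    have h2 : HasDerivWithinAt (fun t : ℝ => -t) (-1) (Icc (-b) (-a)) x :=
      (hasDerivAt_neg x).hasDerivWithinAt
    have h3 := h1.comp x h2 (fun t ht => ⟨by linarith [ht.2], by linarith [ht.1]⟩)
    simpa [Function.comp_def] using h3
  have conv : ∀ {g : ℝ → ℝ} {c x : ℝ}, x ∈ Ico (-b) (-a) →
      HasDerivWithinAt g c (Icc (-b) (-a)) x → HasDerivWithinAt g c (Ici x) x := by
    intro g c x hx hg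
    exact (hg.mono (Icc_subset_Icc_left hx.1)).mono_of_mem_nhdsWithin (Icc_mem_nhdsGE hx.2)
  intro x hx
  have := image_le_of_deriv_right_lt_deriv_boundary' (f := fun t => f (-t)) (B := fun t => B (-t))
    (a := -b) (b := -a)
    (fun x hx => (key hf x hx).continuousWithinAt)
    (fun x hx => conv hx (key hf x (Ico_subset_Icc_self hx)))
    (by simpa using hb)
    (fun x hx => (key hB x hx).continuousWithinAt)
    (fun x hx => conv hx (key hB x (Ico_subset_Icc_self hx)))
    (fun x hx he => by
      have := h (-x) ⟨by linarith [hx.2], by linarith [hx.1]⟩ he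
      linarith) (x := -x) ⟨by linarith [hx.2], by linarith [hx.1]⟩
  simpa using this

lemma aux_pos {d d' : ℝ → ℝ} {a b K : ℝ}
    (hd : ∀ x ∈ Icc a b, HasDerivWithinAt d (d' x) (Icc a b) x)
    (hK : ∀ x ∈ Icc a b, |d' x| ≤ K * |d x|) (hb : 0 < d b) :
    ∀ x ∈ Icc a b, 0 < d x := by
  intro x hx
  by_contra hneg
  push Not at hneg
  have hcont : ContinuousOn d (Icc a b) := fun x hx => (hd x hx).continuousWithinAt
  have hsub : Icc x b ⊆ Icc a b := Icc_subset_Icc_left hx.1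
  obtain ⟨y, hy, hy0⟩ := intermediate_value_Icc hx.2 (hcont.mono hsub) ⟨hneg, hb.le⟩
  have hsub' : Icc y b ⊆ Icc a b := Icc_subset_Icc_left (hx.1.trans hy.1)
  have := eq_zero_of_abs_deriv_le_mul_abs_self_of_eq_zero_right (f := d) (f' := d') (K := K)
    (hcont.mono hsub')
    (fun z hz => ((hd z (hsub' (Ico_subset_Icc_self hz))).mono
      (Icc_subset_Icc_left (hsub' (Ico_subset_Icc_self hz)).1)).mono_of_mem_nhdsWithin
        (Icc_mem_nhdsGE hz.2)) hy0
    (fun z hz => hK z (hsub' (Ico_subset_Icc_self hz))) b ⟨hy.2, le_rfl⟩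
  linarith

lemma aux_lip_s6 {m a B : ℝ} (hm : 1 ≤ m) (ha : 0 < a) (hB : 1 ≤ B) :
    ∃ K : ℝ, 0 ≤ K ∧ ∀ s, a ≤ s → ∀ x ∈ Icc (1:ℝ) B, ∀ y ∈ Icc (1:ℝ) B,
      |(1 - x^2) * (1 - m * x / s) - (1 - y^2) * (1 - m * y / s)| ≤ K * |x - y| := by
  refine ⟨m / a * (3 * B^2) + 2 * B + m / a, by positivity, ?_⟩
  intro s hs x hx y hy
  have hs0 : 0 < s := ha.trans_le hs
  have e : (1 - x^2) * (1 - m * x / s) - (1 - y^2) * (1 - m * y / s)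
      = (m / s * (x^2 + x*y + y^2) - (x + y) - m / s) * (x - y) := by
    field_simp; ring
  rw [e, abs_mul]
  refine mul_le_mul_of_nonneg_right ?_ (abs_nonneg _)
  obtain ⟨hx1, hx2⟩ := hx
  obtain ⟨hy1, hy2⟩ := hy
  have hms : m / s ≤ m / a := by gcongr
  have hms0 : 0 < m / s := by positivity
  have hq : x^2 + x*y + y^2 ≤ 3 * B^2 := by nlinarith
  have hq0 : 0 ≤ x^2 + x*y + y^2 := by positivity
  have hp : m / s * (x^2 + x*y + y^2) ≤ m / a * (3 * B^2) := by gcongr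
  have hp0 : 0 ≤ m / s * (x^2 + x*y + y^2) := by positivity
  rw [abs_le]
  constructor <;> nlinarith [sq_nonneg B, mul_nonneg (hms0.le.trans hms) (sq_nonneg B)]

lemma aux_exists {m a T : ℝ} (hm : 1 ≤ m) (ha : 0 < a) (haT : a ≤ T) (hT : m < T) :
    ∃ w : ℝ → ℝ, w T = T / m ∧ ∀ s ∈ Icc a T,
      HasDerivWithinAt w ((1 - w s ^ 2) * (1 - m * w s / s)) (Icc a T) s ∧
      s / m ≤ w s ∧ w s ≤ s / m + m / s ∧ 1 < w s := by
  have hm0 : 0 < m := by linarith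
  have hT0 : 0 < T := by linarith
  set B : ℝ := T / m + m / a with hBdef
  have hTm : 1 < T / m := by rw [lt_div_iff₀ hm0]; linarith
  have hma : 0 < m / a := by positivity
  have hB : 1 ≤ B := by linarith
  obtain ⟨K, hK0, hK⟩ := aux_lip_s6 hm ha hB
  set c : ℝ → ℝ := fun x => max 1 (min B x) with hc
  have hcm : ∀ x, c x ∈ Icc (1:ℝ) B := fun x => ⟨le_max_left _ _, max_le hB (min_le_left _ _)⟩
  have hcl : ∀ x y, |c x - c y| ≤ |x - y| := by
    intro x y
    calc |c x - c y| ≤ |min B x - min B y| := by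
          have := abs_max_sub_max_le_max 1 (min B x) 1 (min B y)
          simpa using this
      _ ≤ |x - y| := by
          have := abs_min_sub_min_le_max B x B y
          simpa using this
  have hceq : ∀ x, 1 ≤ x → x ≤ B → c x = x := by
    intro x h1 h2
    simp [hc, h1, h2]
  set G : ℝ → ℝ → ℝ := fun s x => (1 - c x ^ 2) * (1 - m * c x / s) with hG
  have hGl : ∀ s ∈ Icc a T, ∀ x y, |G s x - G s y| ≤ K * |x - y| := by
    intro s hs x y
    exact (hK s hs.1 _ (hcm x) _ (hcm y)).trans (mul_le_mul_of_nonneg_left (hcl x y) hK0)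
  have hGb : ∀ s ∈ Icc a T, ∀ x, |G s x| ≤ K * B := by
    intro s hs x
    have := hK s hs.1 _ (hcm x) 1 ⟨le_rfl, hB⟩
    simp only [one_pow, sub_self, zero_mul, sub_zero] at this
    refine this.trans (mul_le_mul_of_nonneg_left ?_ hK0)
    have := hcm x
    rw [abs_le]; constructor <;> linarith [this.1, this.2]
  have hKB : 0 ≤ K * B := by positivity
  have hTa : 0 ≤ T - a := by linarith
  have hPL : IsPicardLindelof G (tmin := a) (tmax := T) ⟨T, ⟨haT, le_rfl⟩⟩ (T / m)
      ⟨K * B * (T - a), by positivity⟩ 0 ⟨K * B, hKB⟩ ⟨K, hK0⟩ := by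
    refine ⟨?_, ?_, ?_, ?_⟩
    · intro t ht
      refine LipschitzOnWith.of_dist_le_mul ?_
      intro x _ y _
      rw [Real.dist_eq, Real.dist_eq]
      exact hGl t ht x y
    · intro x _
      refine continuousOn_of_forall_continuousAt ?_
      intro t ht
      have : t ≠ 0 := (ha.trans_le ht.1).ne'
      simp only [hG]
      fun_prop (disch := assumption)
    · intro t ht x _
      exact hGb t ht x
    · have e : max (T - T) (T - a) = T - a := by simp [hTa]
      change K * B * max (T - T) (T - a) ≤ K * B * (T - a) - 0
      rw [e, sub_zero]
  obtain ⟨w, hwT, hw⟩ := hPL.exists_eq_forall_mem_Icc_hasDerivWithinAt₀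
  simp only at hwT
  have hc1 : c 1 = 1 := hceq 1 le_rfl hB
  have h1 : ∀ s ∈ Icc a T, 0 < w s - 1 := by
    refine aux_pos (d := fun s => w s - 1) (d' := fun s => G s (w s)) (K := K)
      (fun s hs => (hw s hs).sub_const 1) ?_ (by simp only [hwT]; linarith)
    intro s hs
    have := hGl s hs (w s) 1
    have e : G s 1 = 0 := by simp [hG, hc1]
    rwa [e, sub_zero] at this
  have hU : ∀ s ∈ Icc a T, w s ≤ s / m + m / s := by
    refine aux_barrier (f := w) (B := fun s => s / m + m / s) (B' := fun s => 1 / m - m / s^2)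
      hw ?_ ?_ ?_
    · intro s hs
      have hs0 : s ≠ 0 := (ha.trans_le hs.1).ne'
      have := ((hasDerivAt_id s).div_const m).add ((hasDerivAt_inv hs0).const_mul m)
      refine HasDerivAt.hasDerivWithinAt ?_
      have e : 1 / m - m / s ^ 2 = 1 / m + m * -(s ^ 2)⁻¹ := by ring
      rw [e]
      exact this
    · rw [hwT]
      have : 0 < m / T := by positivity
      linarith
    · intro s hs he
      have hs0 : 0 < s := (ha.trans_le hs.1)
      have hle : w s ≤ B := by
        rw [he, hBdef]
        have := hs.1
        have := hs.2
        gcongr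
      have hcw : c (w s) = w s := hceq _ (by linarith [h1 s hs]) hle
      simp only [hG]
      rw [hcw, he]
      have hm1 : 1 / m ≤ 1 := by rw [div_le_one hm0]; exact hm
      have e : (1 - (s / m + m / s)^2) * (1 - m * (s / m + m / s) / s)
        = 1 + m^2/s^2 + m^4/s^4 := by
        field_simp; ring
      rw [e]
      have : 0 < m / s^2 := by positivity
      have : 0 < m^2 / s^2 := by positivity
      have : 0 < m^4 / s^4 := by positivity
      linarith
  have hUB : ∀ s ∈ Icc a T, w s ≤ B := by
    intro s hs
    have hs0 : 0 < s := (ha.trans_le hs.1)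
    refine (hU s hs).trans ?_
    have := hs.1
    have := hs.2
    rw [hBdef]
    gcongr
  have hce : ∀ s ∈ Icc a T, c (w s) = w s := fun s hs =>
    hceq _ (by linarith [h1 s hs]) (hUB s hs)
  have hL : ∀ s ∈ Icc a T, s / m ≤ w s := by
    refine aux_barrier (f := fun s => s / m) (B := w) (f' := fun s => 1 / m) 
      (fun s hs => ((hasDerivAt_id s).div_const m).hasDerivWithinAt) hw hwT.ge ?_
    intro s hs he
    have hs0 : 0 < s := (ha.trans_le hs.1)
    simp only [hG]
    rw [hce s hs, ← he]
    have : 1 - m * (s / m) / s = 0 := by field_simp; ring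
    rw [this, mul_zero]; positivity
  refine ⟨w, hwT, fun s hs => ⟨?_, hL s hs, hU s hs, by linarith [h1 s hs]⟩⟩
  have := hw s hs
  simp only [hG, hce s hs] at this
  exact this

lemma aux_limit {m p q B : ℝ} (hm : 1 ≤ m) (hp : 0 < p) (hpq : p < q) (hB : 1 ≤ B)
    {W : ℕ → ℝ → ℝ} {w : ℝ → ℝ}
    (hW : ∀ k, ∀ s ∈ Icc p q, HasDerivAt (W k) ((1 - W k s ^ 2) * (1 - m * W k s / s)) s)
    (hb : ∀ k, ∀ s ∈ Icc p q, W k s ∈ Icc 1 B)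
    (hlim : ∀ s ∈ Icc p q, Tendsto (fun k => W k s) atTop (nhds (w s))) :
    ∀ s ∈ Ioo p q, HasDerivAt w ((1 - w s ^ 2) * (1 - m * w s / s)) s := by
  obtain ⟨K, hK0, hK⟩ := aux_lip_s6 hm hp hB
  have hFb : ∀ s ∈ Icc p q, ∀ x ∈ Icc 1 B, |(1 - x^2) * (1 - m * x / s)| ≤ K * B := by
    intro s hs x hx
    have := hK s hs.1 _ hx 1 ⟨le_rfl, hB⟩
    simp only [one_pow, sub_self, zero_mul, sub_zero] at this
    refine this.trans (mul_le_mul_of_nonneg_left ?_ hK0)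
    rw [abs_le]; constructor <;> linarith [hx.1, hx.2]
  have hlip : ∀ x ∈ Icc p q, ∀ y ∈ Icc p q, |w y - w x| ≤ K * B * |y - x| := by
    intro x hx y hy
    have h1 : Tendsto (fun k => |W k y - W k x|) atTop (nhds (|w y - w x|)) :=
      ((hlim y hy).sub (hlim x hx)).abs
    refine le_of_tendsto h1 (Eventually.of_forall fun k => ?_)
    exact Convex.norm_image_sub_le_of_norm_hasDerivWithin_le
      (fun s hs => (hW k s hs).hasDerivWithinAt) (fun s hs => hFb s hs _ (hb k s hs))
      (convex_Icc p q) hx hy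
  have hKB : 0 ≤ K * B := by positivity
  have hwc : ContinuousOn w (Icc p q) := by
    have : LipschitzOnWith ⟨K * B, hKB⟩ w (Icc p q) := by
      refine LipschitzOnWith.of_dist_le_mul fun x hx y hy => ?_
      rw [Real.dist_eq, Real.dist_eq]
      exact hlip y hy x hx
    exact this.continuousOn
  have hFc : ∀ v : ℝ → ℝ, ContinuousOn v (Icc p q) →
      ContinuousOn (fun s => (1 - v s ^ 2) * (1 - m * v s / s)) (Icc p q) := by
    intro v hv
    have : ∀ s ∈ Icc p q, s ≠ 0 := fun s hs => (hp.trans_le hs.1).ne'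
    fun_prop (disch := assumption)
  have hWc : ∀ k, ContinuousOn (W k) (Icc p q) := fun k s hs =>
    (hW k s hs).continuousAt.continuousWithinAt
  have hint : ∀ s ∈ Icc p q, w s = w p + ∫ x in p..s, (1 - w x ^ 2) * (1 - m * w x / x) := by
    intro s hs
    have hsub : Icc p s ⊆ Icc p q := Icc_subset_Icc_right hs.2
    have hsub' : uIoc p s ⊆ Icc p q := by
      rw [uIoc_of_le hs.1]; exact Ioc_subset_Icc_self.trans hsub
    have h1 : Tendsto (fun k => ∫ x in p..s, (1 - W k x ^ 2) * (1 - m * W k x / x)) atTop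
        (nhds (∫ x in p..s, (1 - w x ^ 2) * (1 - m * w x / x))) := by
      refine intervalIntegral.tendsto_integral_filter_of_dominated_convergence
        (fun _ => K * B) ?_ ?_ ?_ ?_
      · exact Eventually.of_forall fun k =>
          ((hFc _ (hWc k)).mono hsub').aestronglyMeasurable measurableSet_uIoc
      · exact Eventually.of_forall fun k => Eventually.of_forall fun x hx =>
          hFb x (hsub' hx) _ (hb k x (hsub' hx))
      · simp
      · refine Eventually.of_forall fun x hx => ?_
        have := hlim x (hsub' hx)
        exact ((this.pow 2).const_sub 1).mul (((this.const_mul m).div_const x).const_sub 1)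
    have h2 : ∀ k, ∫ x in p..s, (1 - W k x ^ 2) * (1 - m * W k x / x) = W k s - W k p := by
      intro k
      refine intervalIntegral.integral_eq_sub_of_hasDerivAt ?_ ?_
      · intro x hx
        rw [uIcc_of_le hs.1] at hx
        exact hW k x (hsub hx)
      · refine ContinuousOn.intervalIntegrable ?_
        rw [uIcc_of_le hs.1]
        exact (hFc _ (hWc k)).mono hsub
    simp only [h2] at h1
    have := tendsto_nhds_unique h1 ((hlim s hs).sub (hlim p ⟨le_rfl, hpq.le⟩))
    linarith
  intro s hs
  have hs' := Ioo_subset_Icc_self hs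
  have hnh : Icc p q ∈ nhds s := Icc_mem_nhds hs.1 hs.2
  have hd : HasDerivAt (fun u => w p + ∫ x in p..u, (1 - w x ^ 2) * (1 - m * w x / x))
      ((1 - w s ^ 2) * (1 - m * w s / s)) s := by
    refine HasDerivAt.const_add _ (intervalIntegral.integral_hasDerivAt_right ?_ ?_ ?_)
    · refine ContinuousOn.intervalIntegrable ?_
      rw [uIcc_of_le hs'.1]
      exact (hFc _ hwc).mono (Icc_subset_Icc_right hs'.2)
    · exact ⟨Icc p q, hnh, (hFc _ hwc).aestronglyMeasurable measurableSet_Icc⟩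
    · exact (hFc _ hwc).continuousAt hnh
  refine hd.congr_of_eventuallyEq ?_
  filter_upwards [hnh] with x hx using hint x hx

lemma aux_sol {m : ℝ} (hm : 1 ≤ m) :
    ∃ w : ℝ → ℝ, ∀ s, 0 < s →
      HasDerivAt w ((1 - w s ^ 2) * (1 - m * w s / s)) s ∧
      s / m ≤ w s ∧ w s ≤ s / m + m / s ∧ 1 ≤ w s := by
  have hm0 : 0 < m := by linarith
  have hex := fun k : ℕ => aux_exists (m := m) (a := 1 / ((k:ℝ) + 1)) (T := m + 1 + k) hm
    (by positivity)
    (by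
      have : (0:ℝ) ≤ k := by positivity
      rw [div_le_iff₀ (by positivity)]; nlinarith)
    (by
      have : (0:ℝ) ≤ k := by positivity
      linarith)
  choose W hWT hW using hex
  have hsub : ∀ k : ℕ, Icc (1 / ((k:ℝ) + 1)) (m + 1 + k) ⊆
      Icc (1 / (((k+1:ℕ):ℝ) + 1)) (m + 1 + (k+1:ℕ)) := by
    intro k
    push_cast
    refine Icc_subset_Icc ?_ (by linarith)
    gcongr
    linarith
  have hmono : ∀ k : ℕ, ∀ s ∈ Icc (1 / ((k:ℝ) + 1)) (m + 1 + k), W k s ≤ W (k+1) s := by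
    intro k s hs
    have hk : (0:ℝ) ≤ k := by positivity
    have ha : 0 < 1 / ((k:ℝ) + 1) := by positivity
    set a := 1 / ((k:ℝ) + 1) with hadef
    set T := m + 1 + (k:ℝ) with hTdef
    have haT : a ≤ T := hs.1.trans hs.2
    set B := (T / m + m / a) with hBdef
    have hT0 : 0 < T := by positivity
    have hbd : ∀ x ∈ Icc a T, x / m + m / x ≤ B := by
      intro x hx
      have := hx.1
      have := hx.2
      have : 0 < x := ha.trans_le hx.1
      rw [hBdef]; gcongr
    have hB : 1 ≤ B := by
      have := (hW k s hs).2.2.1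
      have := (hW k s hs).2.2.2
      have := hbd s hs
      linarith
    obtain ⟨K, hK0, hK⟩ := aux_lip_s6 hm ha hB
    have hTT : T ∈ Icc a T := ⟨haT, le_rfl⟩
    have h0 : 0 ≤ W (k+1) T - W k T := by
      have := (hW (k+1) T (hsub k hTT)).2.1
      rw [hWT k]
      linarith
    have hd : ∀ x ∈ Icc a T, HasDerivWithinAt (fun x => W (k+1) x - W k x)
        ((1 - W (k+1) x ^ 2) * (1 - m * W (k+1) x / x) - (1 - W k x ^ 2) * (1 - m * W k x / x))
        (Icc a T) x := fun x hx =>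
      ((hW (k+1) x (hsub k hx)).1.mono (hsub k)).sub (hW k x hx).1
    have hKd : ∀ x ∈ Icc a T, |(1 - W (k+1) x ^ 2) * (1 - m * W (k+1) x / x)
        - (1 - W k x ^ 2) * (1 - m * W k x / x)| ≤ K * |W (k+1) x - W k x| := by
      intro x hx
      have h1 := (hW k x hx).2
      have h2 := (hW (k+1) x (hsub k hx)).2
      exact hK x hx.1 _ ⟨h2.2.2.le, h2.2.1.trans (hbd x hx)⟩ _ ⟨h1.2.2.le, h1.2.1.trans (hbd x hx)⟩
    have hpos : 0 < W (k+1) T - W k T := by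
      rcases h0.lt_or_eq with h | h
      · exact h
      · exfalso
        -- the larger solution would touch the line at an interior point
        have hT' : T < m + 1 + ((k+1:ℕ):ℝ) := by push_cast; linarith
        have hT'' : 1 / (((k+1:ℕ):ℝ) + 1) < T := by
          refine lt_of_lt_of_le ?_ haT
          rw [hadef]; push_cast; gcongr; linarith
        have hda := (hW (k+1) T (hsub k hTT)).1.hasDerivAt (Icc_mem_nhds hT'' hT')
        have hval : W (k+1) T = T / m := by rw [hWT k] at h; linarith
        have hz : 1 - m * (T / m) / T = 0 := by field_simp; ring
        rw [hval, hz, mul_zero] at hda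
        have hdd := hda.sub ((hasDerivAt_id T).div_const m)
        have hmin : IsLocalMin (W (k+1) - fun x => id x / m) T := by
          filter_upwards [Icc_mem_nhds hT'' hT'] with x hx
          have := (hW (k+1) x hx).2.1
          simp only [Pi.sub_apply, id, hval]
          linarith
        have := hmin.hasDerivAt_eq_zero hdd
        have : 0 < 1 / m := by positivity
        linarith
    have := aux_pos hd hKd hpos s hs
    linarith
  have hev : ∀ p q : ℝ, 0 < p → ∃ k0 : ℕ, ∀ k ≥ k0, Icc p q ⊆ Ioo (1 / ((k:ℝ) + 1)) (m + 1 + k) := by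
    intro p q hp
    obtain ⟨k1, hk1⟩ := exists_nat_gt (1 / p)
    obtain ⟨k2, hk2⟩ := exists_nat_gt q
    refine ⟨max k1 k2, fun k hk => ?_⟩
    have h1 : (k1:ℝ) ≤ k := by exact_mod_cast (le_max_left _ _).trans hk
    have h2 : (k2:ℝ) ≤ k := by exact_mod_cast (le_max_right _ _).trans hk
    refine Icc_subset_Ioo ?_ (by linarith)
    rw [div_lt_iff₀ (by positivity)]
    rw [div_lt_iff₀ hp] at hk1
    nlinarith
  have hlim : ∀ s : ℝ, ∃ l : ℝ, 0 < s → Tendsto (fun k => W k s) atTop (nhds l) := by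
    intro s
    by_cases hs : 0 < s
    · obtain ⟨k0, hk0⟩ := hev s s hs
      have hmem : ∀ k ≥ k0, s ∈ Icc (1 / ((k:ℝ) + 1)) (m + 1 + k) := fun k hk =>
        Ioo_subset_Icc_self (hk0 k hk ⟨le_rfl, le_rfl⟩)
      have hmo : Monotone fun k => W (k + k0) s := by
        refine monotone_nat_of_le_succ fun k => ?_
        have := hmono (k + k0) s (hmem _ (by omega))
        rw [show k + 1 + k0 = k + k0 + 1 by ring]
        exact this
      have hbd : BddAbove (range fun k => W (k + k0) s) := by
        refine ⟨s / m + m / s, ?_⟩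
        rintro _ ⟨k, rfl⟩
        exact (hW _ s (hmem _ (by omega))).2.2.1
      exact ⟨_, fun _ => (tendsto_add_atTop_iff_nat k0).1 (tendsto_atTop_ciSup hmo hbd)⟩
    · exact ⟨0, fun h => absurd h hs⟩
  choose w hw using hlim
  refine ⟨w, fun s hs => ?_⟩
  have hp : 0 < s / 2 := by positivity
  obtain ⟨k0, hk0⟩ := hev (s/2) (2*s) hp
  have hsm : s ∈ Icc (s/2) (2*s) := ⟨by linarith, by linarith⟩
  refine ⟨?_, ?_, ?_, ?_⟩
  · have hbd : ∀ x ∈ Icc (s/2) (2*s), x / m + m / x ≤ 2*s/m + m/(s/2) := by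
      intro x hx
      have := hx.1
      have := hx.2
      have : 0 < x := hp.trans_le hx.1
      gcongr
    have hB : 1 ≤ 2*s/m + m/(s/2) := by
      have := (hW k0 s (Ioo_subset_Icc_self (hk0 k0 le_rfl hsm))).2
      linarith [this.2.1, this.2.2, hbd s hsm]
    refine aux_limit (p := s/2) (q := 2*s) (W := fun k => W (k + k0)) hm hp (by linarith) hB ?_ ?_ ?_ s
      ⟨by linarith, by linarith⟩
    · intro k x hx
      have := hk0 (k + k0) (by omega) hx
      exact (hW _ x (Ioo_subset_Icc_self this)).1.hasDerivAt (Icc_mem_nhds this.1 this.2)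
    · intro k x hx
      have := (hW _ x (Ioo_subset_Icc_self (hk0 (k + k0) (by omega) hx))).2
      exact ⟨this.2.2.le, this.2.1.trans (hbd x hx)⟩
    · intro x hx
      exact (tendsto_add_atTop_iff_nat k0).2 (hw x (hp.trans_le hx.1))
  · refine ge_of_tendsto (hw s hs) ?_
    filter_upwards [eventually_ge_atTop k0] with k hk
    exact (hW _ s (Ioo_subset_Icc_self (hk0 k hk hsm))).2.1
  · refine le_of_tendsto (hw s hs) ?_
    filter_upwards [eventually_ge_atTop k0] with k hk
    exact (hW _ s (Ioo_subset_Icc_self (hk0 k hk hsm))).2.2.1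
  · refine ge_of_tendsto (hw s hs) ?_
    filter_upwards [eventually_ge_atTop k0] with k hk
    exact (hW _ s (Ioo_subset_Icc_self (hk0 k hk hsm))).2.2.2.le

lemma aux_asymp {m : ℝ} (hm : 1 ≤ m) {w : ℝ → ℝ}
    (hw : ∀ s, 0 < s → HasDerivAt w ((1 - w s ^ 2) * (1 - m * w s / s)) s)
    (hL : ∀ s, 0 < s → s / m ≤ w s) (hU : ∀ s, 0 < s → w s ≤ s / m + m / s) :
    Tendsto (fun s => (1 - w s ^ 2) * (1 - m * w s / s)) atTop (nhds (1 / m)) := by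
  have hm0 : 0 < m := by linarith
  have hinv2 : Tendsto (fun s : ℝ => (s^2)⁻¹) atTop (nhds 0) :=
    tendsto_inv_atTop_zero.comp (tendsto_pow_atTop two_ne_zero)
  -- w / s → 1 / m
  have hr : Tendsto (fun s => w s / s) atTop (nhds (1 / m)) := by
    have hu : Tendsto (fun s : ℝ => 1 / m + m * (s^2)⁻¹) atTop (nhds (1 / m)) := by
      simpa using (hinv2.const_mul m).const_add (1 / m)
    refine tendsto_of_tendsto_of_tendsto_of_le_of_le' tendsto_const_nhds hu ?_ ?_
    · filter_upwards [eventually_gt_atTop 0] with s hs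
      rw [le_div_iff₀ hs]
      have := hL s hs
      calc 1 / m * s = s / m := by ring
        _ ≤ _ := this
    · filter_upwards [eventually_gt_atTop 0] with s hs
      rw [div_le_iff₀ hs]
      refine (hU s hs).trans (le_of_eq ?_)
      field_simp
  set g : ℝ → ℝ := fun s => s * w s - s^2 / m with hg
  set k : ℝ → ℝ := fun s => m^2 * (w s / s)^2 + (m - m^2) * (s^2)⁻¹ with hk
  have hk1 : Tendsto k atTop (nhds 1) := by
    have := ((hr.pow 2).const_mul (m^2)).add (hinv2.const_mul (m - m^2))
    have e : m^2 * (1 / m)^2 + (m - m^2) * 0 = 1 := by field_simp; ring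
    rwa [e] at this
  have hg0 : ∀ s, 0 < s → 0 ≤ g s := by
    intro s hs
    have := mul_le_mul_of_nonneg_left (hL s hs) hs.le
    have e : s * (s / m) = s^2 / m := by ring
    simp only [hg]; linarith
  have hgm : ∀ s, 0 < s → g s ≤ m := by
    intro s hs
    have := mul_le_mul_of_nonneg_left (hU s hs) hs.le
    have e : s * (s / m + m / s) = s^2 / m + m := by field_simp
    simp only [hg]; linarith
  have hgd : ∀ s, 0 < s → HasDerivAt g (s / m * (k s * g s - 1)) s := by
    intro s hs
    have h1 := ((hasDerivAt_id s).mul (hw s hs)).sub ((hasDerivAt_pow 2 s).div_const m)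
    have e : s / m * (k s * g s - 1) = 1 * w s + id s * ((1 - w s ^ 2) * (1 - m * w s / s))
        - ((2:ℕ):ℝ) * s ^ (2 - 1) / m := by
      simp only [hk, hg, id]
      field_simp
      push_cast
      ring
    rw [e]
    exact h1
  have hexp : ∀ s : ℝ, HasDerivAt (fun s : ℝ => Real.exp (-(s^2 / (2*m))))
      (Real.exp (-(s^2 / (2*m))) * (-(s / m))) s := by
    intro s
    have h1 := (((hasDerivAt_pow 2 s).div_const (2*m)).neg).exp
    have e : -(s / m) = -(((2:ℕ):ℝ) * s ^ (2 - 1) / (2 * m)) := by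
      push_cast
      field_simp
      try ring
    rw [e]
    exact h1
  have hexp0 : Tendsto (fun s : ℝ => Real.exp (-(s^2 / (2*m)))) atTop (nhds 0) := by
    refine Real.tendsto_exp_neg_atTop_nhds_zero.comp ?_
    exact (tendsto_pow_atTop two_ne_zero).atTop_div_const (by positivity)
  have hphi : ∀ c s : ℝ, 0 < s → HasDerivAt (fun s => (g s - c) * Real.exp (-(s^2 / (2*m))))
      (s / m * Real.exp (-(s^2 / (2*m))) * ((k s - 1) * g s + (c - 1))) s := by
    intro c s hs
    have := ((hgd s hs).sub_const c).mul (hexp s)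
    have e : s / m * Real.exp (-(s^2 / (2*m))) * ((k s - 1) * g s + (c - 1))
        = s / m * (k s * g s - 1) * Real.exp (-(s^2 / (2*m)))
          + (g s - c) * (Real.exp (-(s^2 / (2*m))) * (-(s / m))) := by ring
    rw [e]
    exact this
  have hphi0 : ∀ c : ℝ, Tendsto (fun s => (g s - c) * Real.exp (-(s^2 / (2*m)))) atTop (nhds 0) := by
    intro c
    refine bdd_le_mul_tendsto_zero' (m + |c|) ?_ hexp0
    filter_upwards [eventually_gt_atTop 0] with s hs
    have h1 := hg0 s hs
    have h2 := hgm s hs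
    rw [abs_le]
    constructor <;> linarith [neg_abs_le c, le_abs_self c]
  have hkg : Tendsto (fun s => (k s - 1) * g s) atTop (nhds 0) := by
    have hk0 : Tendsto (fun s => k s - 1) atTop (nhds 0) := by
      simpa using hk1.sub_const 1
    have : Tendsto (fun s => g s * (k s - 1)) atTop (nhds 0) := by
      refine bdd_le_mul_tendsto_zero' m ?_ hk0
      filter_upwards [eventually_gt_atTop 0] with s hs
      rw [abs_of_nonneg (hg0 s hs)]
      exact hgm s hs
    simpa [mul_comm] using this
  have hglim : Tendsto g atTop (nhds 1) := by
    rw [Metric.tendsto_atTop]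
    intro ε hε
    have hε2 : 0 < ε / 2 := by positivity
    obtain ⟨S, hS⟩ := (Metric.tendsto_atTop.1 hkg) (ε/2) hε2
    have hS1 : 0 < max S 1 := by positivity
    have hin : ∀ s, max S 1 ≤ s → 0 < s := fun s hs => hS1.trans_le hs
    have hb : ∀ s, max S 1 ≤ s → |(k s - 1) * g s| < ε / 2 := by
      intro s hs
      have := hS s ((le_max_left _ _).trans hs)
      rwa [Real.dist_eq, sub_zero] at this
    refine ⟨max S 1, fun s hs => ?_⟩
    have hs0 := hin s hs
    have hup : (g s - (1 + ε/2)) * Real.exp (-(s^2 / (2*m))) ≤ 0 := by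
      have hmono : MonotoneOn (fun s => (g s - (1 + ε/2)) * Real.exp (-(s^2 / (2*m))))
          (Ici (max S 1)) := by
        refine monotoneOn_of_deriv_nonneg (convex_Ici _)
          (fun x hx => (hphi _ x (hin x hx)).continuousAt.continuousWithinAt)
          (fun x hx => (hphi _ x (hin x (interior_subset hx))).differentiableAt.differentiableWithinAt)
          (fun x hx => ?_)
        have hx' := interior_subset hx
        have hx0 := hin x hx'
        rw [(hphi _ x hx0).deriv]
        have := (abs_lt.1 (hb x hx')).1
        exact mul_nonneg (by positivity) (by linarith)
      refine ge_of_tendsto (hphi0 (1 + ε/2)) ?_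
      filter_upwards [eventually_ge_atTop s] with t ht
      exact hmono hs (le_trans hs ht) ht
    have hlo : 0 ≤ (g s - (1 - ε/2)) * Real.exp (-(s^2 / (2*m))) := by
      have hmono : AntitoneOn (fun s => (g s - (1 - ε/2)) * Real.exp (-(s^2 / (2*m))))
          (Ici (max S 1)) := by
        refine antitoneOn_of_deriv_nonpos (convex_Ici _)
          (fun x hx => (hphi _ x (hin x hx)).continuousAt.continuousWithinAt)
          (fun x hx => (hphi _ x (hin x (interior_subset hx))).differentiableAt.differentiableWithinAt)
          (fun x hx => ?_)
        have hx' := interior_subset hx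
        have hx0 := hin x hx'
        rw [(hphi _ x hx0).deriv]
        have := (abs_lt.1 (hb x hx')).2
        exact mul_nonpos_of_nonneg_of_nonpos (by positivity) (by linarith)
      refine le_of_tendsto (hphi0 (1 - ε/2)) ?_
      filter_upwards [eventually_ge_atTop s] with t ht
      exact hmono hs (le_trans hs ht) ht
    have hE := Real.exp_pos (-(s^2 / (2*m)))
    have h1 : g s - (1 + ε/2) ≤ 0 := nonpos_of_mul_nonpos_left hup hE
    have h2 : 0 ≤ g s - (1 - ε/2) := nonneg_of_mul_nonneg_left hlo hE
    rw [Real.dist_eq, abs_lt]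
    constructor <;> linarith
  have hfin := (((hr.pow 2).sub hinv2).mul hglim).const_mul m
  have e : m * (((1 / m)^2 - 0) * 1) = 1 / m := by field_simp; try ring
  rw [e] at hfin
  refine hfin.congr' ?_
  filter_upwards [eventually_gt_atTop 0] with s hs
  simp only [hg]
  field_simp
  ring

/-- **Case V.** There is a solution `𝐰` of `(★)` on all of `(0,∞)`
lying above the line `x = s/(n-1)`, strictly increasing, with values `> 1`, whose
derivative tends to `1/(n-1)` at infinity and which is asymptotic to that line. -/
theorem exists_asymptotic_solution (n : ℕ) (hn : 2 ≤ n) :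
    ∃ w : ℝ → ℝ,
      (∀ s : ℝ, 0 < s →
        HasDerivAt w ((1 - w s ^ 2) * (1 - (n - 1 : ℝ) * w s / s)) s) ∧
      (∀ s : ℝ, 0 < s → s / (n - 1 : ℝ) < w s) ∧
      StrictMonoOn w (Set.Ioi 0) ∧
      (∀ s : ℝ, 0 < s → 1 < w s) ∧
      Tendsto (deriv w) atTop (nhds (1 / (n - 1 : ℝ))) ∧
      Tendsto (fun s : ℝ => (n - 1 : ℝ) * w s - s) atTop (nhds 0) := by
  have hm : (1:ℝ) ≤ (n:ℝ) - 1 := by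
    have : (2:ℝ) ≤ n := by exact_mod_cast hn
    linarith
  generalize (n:ℝ) - 1 = m at hm ⊢
  have hm0 : 0 < m := by linarith
  obtain ⟨w, hw⟩ := aux_sol hm
  have hline : ∀ s : ℝ, 0 < s → s / m < w s := by
    intro s hs
    rcases (hw s hs).2.1.lt_or_eq with h | h
    · exact h
    · exfalso
      have hda := (hw s hs).1
      have hz : 1 - m * (s / m) / s = 0 := by field_simp; ring
      rw [← h, hz, mul_zero] at hda
      have hdd := hda.sub ((hasDerivAt_id s).div_const m)
      have hmin : IsLocalMin (w - fun x => id x / m) s := by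
        filter_upwards [eventually_gt_nhds hs] with x hx
        have := (hw x hx).2.1
        simp only [Pi.sub_apply, id, ← h]
        linarith
      have := hmin.hasDerivAt_eq_zero hdd
      have : 0 < 1 / m := by positivity
      linarith
  have hone : ∀ s : ℝ, 0 < s → 1 < w s := by
    intro s hs
    set T := max s m with hT
    have hsT : s ≤ T := le_max_left _ _
    have hT0 : 0 < T := hs.trans_le hsT
    set B := T / m + m / s with hBdef
    have hbd : ∀ x ∈ Icc s T, w x ∈ Icc 1 B := by
      intro x hx
      have h1 := hx.1
      have h2 := hx.2
      have hx0 : 0 < x := hs.trans_le hx.1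
      refine ⟨(hw x hx0).2.2.2, (hw x hx0).2.2.1.trans ?_⟩
      rw [hBdef]; gcongr
    have hB : 1 ≤ B := (hbd s ⟨le_rfl, hsT⟩).1.trans (hbd s ⟨le_rfl, hsT⟩).2
    obtain ⟨K, hK0, hK⟩ := aux_lip_s6 hm hs hB
    have := aux_pos (d := fun x => w x - 1) (a := s) (b := T) (K := K)
      (d' := fun x => (1 - w x ^ 2) * (1 - m * w x / x))
      (fun x hx => ((hw x (hs.trans_le hx.1)).1.sub_const 1).hasDerivWithinAt)
      (fun x hx => by
        have := hK x hx.1 _ (hbd x hx) 1 ⟨le_rfl, hB⟩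
        simpa only [one_pow, sub_self, zero_mul, sub_zero] using this)
      (by
        have h1 := hline T hT0
        have h2 : 1 ≤ T / m := by
          rw [le_div_iff₀ hm0, one_mul]; exact le_max_right _ _
        show 0 < w T - 1
        linarith) s ⟨le_rfl, hsT⟩
    linarith
  refine ⟨w, fun s hs => (hw s hs).1, hline, ?_, hone, ?_, ?_⟩
  · refine strictMonoOn_of_deriv_pos (convex_Ioi 0)
      (fun x hx => (hw x hx).1.continuousAt.continuousWithinAt) (fun x hx => ?_)
    have hx0 : 0 < x := interior_subset hx
    rw [(hw x hx0).1.deriv]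
    have h1 := hone x hx0
    have h2 := hline x hx0
    refine mul_pos_of_neg_of_neg (by nlinarith) ?_
    rw [sub_neg, lt_div_iff₀ hx0, one_mul]
    rw [div_lt_iff₀ hm0] at h2
    linarith
  · refine (aux_asymp hm (fun s hs => (hw s hs).1) (fun s hs => (hw s hs).2.1)
      (fun s hs => (hw s hs).2.2.1)).congr' ?_
    filter_upwards [eventually_gt_atTop 0] with s hs
    exact (hw s hs).1.deriv.symm
  · have hu : Tendsto (fun s : ℝ => m^2 * s⁻¹) atTop (nhds 0) := by
      simpa using tendsto_inv_atTop_zero.const_mul (m^2)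
    refine tendsto_of_tendsto_of_tendsto_of_le_of_le' tendsto_const_nhds hu ?_ ?_
    · filter_upwards [eventually_gt_atTop 0] with s hs
      have h2 := hline s hs
      rw [div_lt_iff₀ hm0] at h2
      linarith
    · filter_upwards [eventually_gt_atTop 0] with s hs
      have h2 := mul_le_mul_of_nonneg_left (hw s hs).2.2.1 hm0.le
      have e : m * (s / m + m / s) = s + m^2 * s⁻¹ := by field_simp
      linarith
end

section
/- Let n ≥ 2 be a natural number. Up to equality of functions, there is exactly one solution w : (0,∞) → ℝ of (★) defined on all of (0,∞) such that w(s) > 1 for every s > 0 and w'(s) ≠ 0 for every s > 0. -/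
open Set Filter

noncomputable def cth (y : ℝ) : ℝ := Real.cosh y / Real.sinh y

lemma cth_deriv {y : ℝ} (hy : 0 < y) : HasDerivAt cth (1 - cth y ^ 2) y := by
  have hs : Real.sinh y ≠ 0 := (Real.sinh_pos_iff.2 hy).ne'
  have := (Real.hasDerivAt_cosh y).div (Real.hasDerivAt_sinh y) hs
  refine HasDerivAt.congr_deriv this ?_
  unfold cth
  field_simp

lemma cth_gt {y : ℝ} (hy : 0 < y) : 1 < cth y := by
  have hs := Real.sinh_pos_iff.2 hy
  unfold cth
  rw [lt_div_iff₀ hs, one_mul]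
  exact Real.sinh_lt_cosh y

lemma cth_ge {y : ℝ} (hy : 0 < y) : 1 / (2 * y) ≤ cth y := by
  have hs := Real.sinh_pos_iff.2 hy
  unfold cth
  rw [div_le_div_iff₀ (by positivity) hs]
  have h1 := Real.add_one_le_exp (-(2 * y))
  have h2 : Real.exp (-(2*y)) = Real.exp (-y) * Real.exp (-y) := by
    rw [← Real.exp_add]; ring_nf
  have h3 : Real.exp y * Real.exp (-y) = 1 := by rw [← Real.exp_add]; simp
  rw [Real.sinh_eq, Real.cosh_eq]
  have he := Real.exp_pos y
  have he' := Real.exp_pos (-y)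
  have h4 : Real.exp y * (1 - 2 * y) ≤ Real.exp (-y) := by
    have : Real.exp y * (1 - 2 * y) ≤ Real.exp y * (Real.exp (-y) * Real.exp (-y)) := by
      apply mul_le_mul_of_nonneg_left _ he.le
      linarith
    rw [← mul_assoc, h3, one_mul] at this
    exact this
  have h5 := mul_pos hy he'
  have h6 := mul_pos hy he
  nlinarith

lemma cth_le {y : ℝ} (hy : 0 < y) : cth y ≤ 1 + 1 / y := by
  have hs := Real.sinh_pos_iff.2 hy
  unfold cth
  rw [div_le_iff₀ hs]
  have h1 : Real.cosh y - Real.sinh y = Real.exp (-y) := Real.cosh_sub_sinh y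
  have h2 : Real.exp (-y) ≤ 1 := Real.exp_le_one_iff.2 (by linarith)
  have h3 : y ≤ Real.sinh y := Real.self_le_sinh_iff.2 hy.le
  have h4 : 1 ≤ 1 / y * Real.sinh y := by
    rw [div_mul_eq_mul_div, le_div_iff₀ hy]; linarith
  linarith

lemma cth_anti {x y : ℝ} (hx : 0 < x) (hxy : x ≤ y) : cth y ≤ cth x := by
  have hs := Real.sinh_pos_iff.2 hx
  have hs' := Real.sinh_pos_iff.2 (hx.trans_le hxy)
  unfold cth
  rw [div_le_div_iff₀ hs' hs]
  have := Real.sinh_nonneg_iff.2 (sub_nonneg.2 hxy)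
  rw [Real.sinh_sub] at this
  linarith

lemma cth_lip {d x y : ℝ} (hd : 0 < d) (hx : d ≤ x) (hy : d ≤ y) :
    |cth x - cth y| ≤ cth d ^ 2 * |x - y| := by
  have := Convex.norm_image_sub_le_of_norm_hasDerivWithin_le (f := cth)
    (f' := fun z => 1 - cth z ^ 2) (s := Ici d) (C := cth d ^ 2) (x := y) (y := x)
    (fun z hz => (cth_deriv (hd.trans_le hz)).hasDerivWithinAt) ?_ (convex_Ici d) hy hx
  · simpa using this
  · intro z hz
    have h1 := cth_gt (hd.trans_le hz)
    have h2 := cth_anti hd hz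
    rw [Real.norm_eq_abs, abs_le]
    constructor <;> nlinarith

lemma le_of_der {a b : ℝ} {f f' : ℝ → ℝ} (hab : a ≤ b) (hc : ContinuousOn f (Icc a b))
    (hd : ∀ s ∈ Ioo a b, HasDerivAt f (f' s) s) (h : ∀ s ∈ Ioo a b, 0 ≤ f' s) : f a ≤ f b := by
  refine monotoneOn_of_deriv_nonneg (convex_Icc a b) hc ?_ ?_ (left_mem_Icc.2 hab)
    (right_mem_Icc.2 hab) hab
  · rw [interior_Icc]
    exact fun s hs => (hd s hs).differentiableAt.differentiableWithinAt
  · rw [interior_Icc]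
    exact fun s hs => by rw [(hd s hs).deriv]; exact h s hs

lemma barrier {a b : ℝ} {g : ℝ → ℝ} (hab : a ≤ b) (hg : ContinuousOn g (Icc a b)) (hb : 0 ≤ g b)
    (h : ∀ c ∈ Icc a b, a < c → (∀ s ∈ Ico a c, g s < 0) → g c < 0) : 0 ≤ g a := by
  by_contra! hga
  have hcl : IsClosed (Icc a b ∩ g ⁻¹' Ici 0) := hg.preimage_isClosed_of_isClosed isClosed_Icc isClosed_Ici
  have hbd : BddBelow (Icc a b ∩ g ⁻¹' Ici 0) := ⟨a, fun x hx => hx.1.1⟩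
  have hmem := hcl.csInf_mem ⟨b, right_mem_Icc.2 hab, hb⟩ hbd
  set c := sInf (Icc a b ∩ g ⁻¹' Ici 0)
  have hac : a < c := by
    rcases hmem.1.1.lt_or_eq with h1 | h1
    · exact h1
    · have := hmem.2
      rw [← h1] at this
      exact absurd this (not_le.2 hga)
  have := h c hmem.1 hac (fun s hs => by
    by_contra! hs'
    have := csInf_le hbd (show s ∈ Icc a b ∩ g ⁻¹' Ici 0 from ⟨⟨hs.1, hs.2.le.trans hmem.1.2⟩, hs'⟩)
    exact absurd hs.2 (not_lt.2 this))
  exact absurd hmem.2 (not_le.2 this)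

lemma picard {m e T d : ℝ} (hm : 0 < m) (he : 0 < e) (heT : e < T) (hd : 0 < d) :
    ∃ y : ℝ → ℝ, y T = d ∧ ∀ s ∈ Icc e T,
      HasDerivWithinAt y (1 - m / s * cth (max (y s) d)) (Icc e T) s := by
  have hC := cth_gt hd
  let L : NNReal := ⟨1 + m / e * cth d, by positivity⟩
  let K : NNReal := ⟨m / e * cth d ^ 2, by positivity⟩
  let A : NNReal := ⟨(1 + m / e * cth d) * (T - e), mul_nonneg (by positivity) (by linarith)⟩
  have hms : ∀ s ∈ Icc e T, 0 < m / s ∧ m / s ≤ m / e := fun s hs =>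
    ⟨div_pos hm (he.trans_le hs.1), div_le_div_of_nonneg_left hm.le he hs.1⟩
  have hP : IsPicardLindelof (fun s x => 1 - m / s * cth (max x d)) (tmin := e) (tmax := T)
      ⟨T, right_mem_Icc.2 heT.le⟩ d A 0 L K := by
    constructor
    · intro t ht
      apply LipschitzOnWith.of_dist_le_mul
      intro x _ y _
      obtain ⟨h1, h2⟩ := hms t ht
      have h3 := cth_lip hd (le_max_right x d) (le_max_right y d)
      have h4 : |max x d - max y d| ≤ |x - y| := abs_max_sub_max_le_abs x y d
      rw [Real.dist_eq, Real.dist_eq]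
      have : (1 - m / t * cth (max x d)) - (1 - m / t * cth (max y d))
        = - (m / t * (cth (max x d) - cth (max y d))) := by ring
      rw [this, abs_neg, abs_mul, abs_of_pos h1]
      show _ ≤ m / e * cth d ^ 2 * |x - y|
      rw [mul_assoc]
      refine mul_le_mul h2 (h3.trans ?_) (abs_nonneg _) (by positivity)
      exact mul_le_mul_of_nonneg_left h4 (by positivity)
    · intro x _
      refine continuousOn_const.sub (ContinuousOn.mul (continuousOn_const.div continuousOn_id ?_) continuousOn_const)
      exact fun s hs => (he.trans_le hs.1).ne'
    · intro t ht x _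
      obtain ⟨h1, h2⟩ := hms t ht
      have h3 := cth_anti hd (le_max_right x d)
      have h4 := cth_gt (hd.trans_le (le_max_right x d))
      have h5 : m / t * cth (max x d) ≤ m / e * cth d := mul_le_mul h2 h3 (by linarith) (by positivity)
      have h6 : 0 < m / t * cth (max x d) := mul_pos h1 (by linarith)
      show _ ≤ 1 + m / e * cth d
      rw [Real.norm_eq_abs, abs_le]
      constructor <;> linarith
    · show (1 + m / e * cth d) * max (T - T) (T - e) ≤ (1 + m / e * cth d) * (T - e) - 0
      rw [max_eq_right (by linarith)]; simp
  exact hP.exists_eq_forall_mem_Icc_hasDerivWithinAt₀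

structure Sol (m e T : ℝ) (y : ℝ → ℝ) : Prop where
  cont : ContinuousOn y (Icc e T)
  pos : ∀ s ∈ Icc e T, 0 < y s
  der : ∀ s ∈ Ioo e T, HasDerivAt y (1 - m / s * cth (y s)) s
  above : ∀ s ∈ Icc e T, s / m ≤ cth (y s)

lemma Sol.mono {m e T e' T' : ℝ} {y : ℝ → ℝ} (h : Sol m e T y) (h1 : e ≤ e') (h2 : T' ≤ T) :
    Sol m e' T' y :=
  ⟨h.cont.mono (Icc_subset_Icc h1 h2), fun s hs => h.pos s (Icc_subset_Icc h1 h2 hs),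
   fun s hs => h.der s (Ioo_subset_Ioo h1 h2 hs), fun s hs => h.above s (Icc_subset_Icc h1 h2 hs)⟩

lemma exists_sol {m e T : ℝ} (hm : 0 < m) (he : 0 < e) (heT : e < T) : ∃ y, Sol m e T y := by
  have hT : 0 < T := he.trans heT
  obtain ⟨d, hd, hdC⟩ : ∃ d : ℝ, 0 < d ∧ T / m ≤ cth d := by
    refine ⟨m / (2 * T), by positivity, ?_⟩
    have := cth_ge (show 0 < m / (2 * T) by positivity)
    convert this using 1
    field_simp
  obtain ⟨y, hyT, hy⟩ := picard hm he heT hd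
  have hc : ContinuousOn y (Icc e T) := fun s hs => (hy s hs).continuousWithinAt
  have hder : ∀ s ∈ Ioo e T, HasDerivAt y (1 - m / s * cth (max (y s) d)) s := fun s hs =>
    (hy s (Ioo_subset_Icc_self hs)).hasDerivAt (Icc_mem_nhds hs.1 hs.2)
  have hyd : ∀ s ∈ Icc e T, d ≤ y s := by
    intro s hs
    have : 0 ≤ (fun x => y x - d) s := by
      refine barrier (g := fun x => y x - d) (b := T) hs.2 ((hc.mono (Icc_subset_Icc_left hs.1)).sub continuousOn_const) (by simp [hyT]) ?_
      intro c hc' hsc hneg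
      have h0 := hneg s ⟨le_rfl, hsc⟩
      have := le_of_der (f := fun x => - y x) (f' := fun x => - (1 - m / x * cth (max (y x) d))) hsc.le
        (hc.mono (Icc_subset_Icc hs.1 hc'.2)).neg
        (fun x hx => (hder x (Ioo_subset_Ioo hs.1 hc'.2 hx)).neg) ?_
      · linarith
      · intro x hx
        have h1 := hneg x ⟨hx.1.le, hx.2⟩
        rw [max_eq_right (by linarith)]
        have hx0 : 0 < x := he.trans_le (hs.1.trans hx.1.le)
        have hxT : x ≤ T := hx.2.le.trans hc'.2
        have h2 : m / x * (T / m) ≤ m / x * cth d := mul_le_mul_of_nonneg_left hdC (by positivity)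
        have h3 : 1 ≤ m / x * (T / m) := by
          have : m / x * (T / m) = T / x := by field_simp
          rw [this, le_div_iff₀ hx0]; linarith
        linarith
    simp only at this; linarith
  have hpos : ∀ s ∈ Icc e T, 0 < y s := fun s hs => hd.trans_le (hyd s hs)
  have hder' : ∀ s ∈ Ioo e T, HasDerivAt y (1 - m / s * cth (y s)) s := fun s hs => by
    have := hder s hs
    rwa [max_eq_left (hyd s (Ioo_subset_Icc_self hs))] at this
  refine ⟨y, hc, hpos, hder', ?_⟩
  intro s hs
  have hcc : ContinuousOn (fun x => cth (y x)) (Icc e T) := fun x hx =>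
    (cth_deriv (hpos x hx)).continuousAt.comp_continuousWithinAt (hc x hx)
  have : 0 ≤ (fun x => cth (y x) - x / m) s := by
    refine barrier (g := fun x => cth (y x) - x / m) (b := T) hs.2 ((hcc.mono (Icc_subset_Icc_left hs.1)).sub (continuousOn_id.div_const m)) (by simp [hyT, hdC]) ?_
    intro c hc' hsc hneg
    have h0 := hneg s ⟨le_rfl, hsc⟩
    have := le_of_der (f := y) (f' := fun x => (1 - m / x * cth (y x))) hsc.le
        (hc.mono (Icc_subset_Icc hs.1 hc'.2))
        (fun x hx => (hder' x (Ioo_subset_Ioo hs.1 hc'.2 hx))) ?_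
    · have h1 := cth_anti (hpos s hs) this
      have h2 : s / m ≤ c / m := div_le_div_of_nonneg_right hsc.le hm.le
      linarith
    · intro x hx
      have h1 := hneg x ⟨hx.1.le, hx.2⟩
      have hx0 : 0 < x := he.trans_le (hs.1.trans hx.1.le)
      have h2 : m / x * cth (y x) ≤ m / x * (x / m) := mul_le_mul_of_nonneg_left (by linarith) (by positivity)
      have h3 : m / x * (x / m) = 1 := by field_simp
      linarith
  simp only at this; linarith

lemma Sol.upper {m e T : ℝ} {y : ℝ → ℝ} (h : Sol m e T y) (hm : 0 < m) {s : ℝ} (hs : s ∈ Icc e T)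
    (hsm : m < s) : y s ≤ m / (s - m) := by
  have h1 := h.above s hs
  have hp := h.pos s hs
  have h2 := cth_le hp
  have h3 : s / m - 1 ≤ 1 / y s := by linarith
  have h4 : s / m - 1 = (s - m) / m := by field_simp
  rw [h4, div_le_div_iff₀ hm hp] at h3
  rw [le_div_iff₀ (by linarith)]
  linarith

lemma Sol.lower {m s : ℝ} {y : ℝ → ℝ} (hm : 0 < m) (hs : 0 < s) (h : Sol m s (s + 1) y) :
    min 1 (m / (4 * (s + 1))) ≤ y s := by
  by_contra! hlt
  have hl1 := hlt.trans_le (min_le_left _ _)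
  have hl2 := hlt.trans_le (min_le_right _ _)
  have hy0 := h.pos s ⟨le_rfl, by linarith⟩
  have hanti : ∀ x ∈ Icc s (s+1), y x ≤ y s := by
    intro x hx
    have := le_of_der (f := fun x => - y x) (f' := fun x => - (1 - m / x * cth (y x))) hx.1
      (h.cont.mono (Icc_subset_Icc_right hx.2)).neg
      (fun z hz => (h.der z (Ioo_subset_Ioo_right hx.2 hz)).neg) ?_
    · linarith
    · intro z hz
      have hz0 : 0 < z := hs.trans hz.1
      have h1 := h.above z ⟨hz.1.le, hz.2.le.trans hx.2⟩
      have h2 : m / z * (z / m) ≤ m / z * cth (y z) := mul_le_mul_of_nonneg_left h1 (by positivity)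
      have h3 : m / z * (z / m) = 1 := by field_simp
      linarith
  have := le_of_der (f := fun x => - y x - x) (f' := fun x => - (1 - m / x * cth (y x)) - 1) (show s ≤ s + 1 by linarith)
      (h.cont.neg.sub continuousOn_id)
      (fun z hz => ((h.der z hz).neg).sub (hasDerivAt_id z)) ?_
  · have h1 := h.pos (s+1) ⟨by linarith, le_rfl⟩
    linarith
  · intro z hz
    have hz0 : 0 < z := hs.trans hz.1
    have hzI := Ioo_subset_Icc_self hz
    have h1 := hanti z hzI
    have h2 := cth_ge (h.pos z hzI)
    have hp := h.pos z hzI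
    have h3 : m / (s + 1) ≤ m / z := div_le_div_of_nonneg_left hm.le hz0 hz.2.le
    have h4 : 2 * (s + 1) / m ≤ cth (y z) := by
      refine le_trans ?_ h2
      rw [div_le_div_iff₀ hm (by positivity)]
      have h5 : y z < m / (4 * (s + 1)) := by linarith
      rw [lt_div_iff₀ (by positivity)] at h5
      nlinarith
    have h5 : m / (s + 1) * (2 * (s + 1) / m) ≤ m / z * cth (y z) :=
      mul_le_mul h3 h4 (by positivity) (by positivity)
    have h6 : m / (s + 1) * (2 * (s + 1) / m) = 2 := by field_simp
    linarith

lemma Sol.close {m e T : ℝ} {y z : ℝ → ℝ} (hm : 0 < m) (he : 0 < e) (hT : m < T)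
    (hy : Sol m e T y) (hz : Sol m e T z) {s : ℝ} (hs : s ∈ Icc e T) :
    |y s - z s| ≤ m / (T - m) := by
  have := le_of_der (f := fun x => (y x - z x) ^ 2)
    (f' := fun x => 2 * (y x - z x) * ((1 - m / x * cth (y x)) - (1 - m / x * cth (z x)))) hs.2
    (((hy.mono hs.1 le_rfl).cont.sub (hz.mono hs.1 le_rfl).cont).pow 2) ?_ ?_
  · have hTT : T ∈ Icc e T := ⟨hs.1.trans hs.2, le_rfl⟩
    have h1 := hy.upper hm hTT hT
    have h2 := hz.upper hm hTT hT
    have h3 := hy.pos T hTT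
    have h4 := hz.pos T hTT
    have h5 := sq_le_sq.1 this
    refine h5.trans ?_
    rw [abs_le]; constructor <;> linarith
  · intro x hx
    have := ((hy.der x ⟨hs.1.trans_lt hx.1, hx.2⟩).sub (hz.der x ⟨hs.1.trans_lt hx.1, hx.2⟩)).pow 2
    refine HasDerivAt.congr_deriv this ?_
    simp
  · intro x hx
    have hxI : x ∈ Icc e T := ⟨hs.1.trans hx.1.le, hx.2.le⟩
    have hx0 : 0 < m / x := div_pos hm (he.trans_le hxI.1)
    have e1 : 2 * (y x - z x) * ((1 - m / x * cth (y x)) - (1 - m / x * cth (z x))) =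
      2 * (m / x) * ((y x - z x) * (cth (z x) - cth (y x))) := by ring
    rw [e1]
    refine mul_nonneg (by positivity) ?_
    rcases le_total (y x) (z x) with h | h
    · exact mul_nonneg_of_nonpos_of_nonpos (by linarith) (by linarith [cth_anti (hy.pos x hxI) h])
    · exact mul_nonneg (by linarith) (by linarith [cth_anti (hz.pos x hxI) h])

lemma exists_limit {m : ℝ} (hm : 0 < m) : ∃ y : ℝ → ℝ, ∀ s, 0 < s →
    0 < y s ∧ HasDerivAt y (1 - m / s * cth (y s)) s ∧ s / m ≤ cth (y s) := by
  have hex : ∀ k : ℕ, ∃ y, Sol m (1 / ((k : ℝ) + 1)) (m + k + 1) y := by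
    intro k
    have hk : (0 : ℝ) ≤ k := k.cast_nonneg
    refine exists_sol hm (by positivity) ?_
    have : 1 / ((k : ℝ) + 1) ≤ 1 := by rw [div_le_one (by positivity)]; linarith
    linarith
  choose Y hY using hex
  have hsub : ∀ k l : ℕ, k ≤ l → Sol m (1 / ((k : ℝ) + 1)) (m + k + 1) (Y l) := by
    intro k l hkl
    have hkl' : (k : ℝ) ≤ l := by exact_mod_cast hkl
    exact (hY l).mono (one_div_le_one_div_of_le (by positivity) (by linarith)) (by linarith)
  have hclose : ∀ k l : ℕ, k ≤ l → ∀ x ∈ Icc (1 / ((k : ℝ) + 1)) (m + k + 1),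
      |Y k x - Y l x| ≤ m / ((k : ℝ) + 1) := by
    intro k l hkl x hx
    have hk : (0 : ℝ) ≤ k := k.cast_nonneg
    have := Sol.close hm (by positivity) (by linarith) (hY k) (hsub k l hkl) hx
    rwa [show m + (k : ℝ) + 1 - m = k + 1 by ring] at this
  have hev : ∀ a b : ℝ, 0 < a → ∀ᶠ k : ℕ in atTop, 1 / ((k : ℝ) + 1) ≤ a ∧ b ≤ m + k + 1 := by
    intro a b ha
    have h1 : ∀ᶠ k : ℕ in atTop, 1 / ((k : ℝ) + 1) < a :=
      (tendsto_one_div_add_atTop_nhds_zero_nat (𝕜 := ℝ)).eventually_lt_const ha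
    have h2 : ∀ᶠ k : ℕ in atTop, b ≤ (k : ℝ) := tendsto_natCast_atTop_atTop.eventually_ge_atTop b
    filter_upwards [h1, h2] with k h1 h2
    exact ⟨h1.le, by linarith⟩
  have hsmall : Tendsto (fun k : ℕ => m / ((k : ℝ) + 1)) atTop (nhds 0) := by
    have := (tendsto_one_div_add_atTop_nhds_zero_nat (𝕜 := ℝ)).const_mul m
    simpa [div_eq_mul_inv] using this
  have hlim : ∀ x : ℝ, ∃ l, 0 < x → Tendsto (fun k => Y k x) atTop (nhds l) := by
    intro x
    by_cases hx : 0 < x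
    · have : CauchySeq (fun k => Y k x) := by
        rw [Metric.cauchySeq_iff']
        intro ε hε
        obtain ⟨N, h1, h2⟩ := ((hev x x hx).and (hsmall.eventually_lt_const hε)).exists
        refine ⟨N, fun k hk => ?_⟩
        rw [dist_comm, Real.dist_eq]
        exact (hclose N k hk x h1).trans_lt h2
      obtain ⟨l, hl⟩ := cauchySeq_tendsto_of_complete this
      exact ⟨l, fun _ => hl⟩
    · exact ⟨0, fun h => absurd h hx⟩
  choose y hy using hlim
  have hlow : ∀ b : ℝ, ∀ x, 0 < x → x ≤ b → ∀ k : ℕ, 1 / ((k : ℝ) + 1) ≤ x → b + 1 ≤ m + k + 1 →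
      min 1 (m / (4 * (b + 1))) ≤ Y k x := by
    intro b x hx hxb k h1 h2
    refine le_trans ?_ (Sol.lower hm hx ((hY k).mono h1 (by linarith)))
    refine min_le_min_left _ (div_le_div_of_nonneg_left hm.le (by positivity) (by linarith))
  have hlowy : ∀ b : ℝ, ∀ x, 0 < x → x ≤ b → min 1 (m / (4 * (b + 1))) ≤ y x := by
    intro b x hx hxb
    refine ge_of_tendsto (hy x hx) ?_
    filter_upwards [hev x (b + 1) hx] with k hk
    exact hlow b x hx hxb k hk.1 hk.2
  have hcl : ∀ k : ℕ, ∀ x ∈ Icc (1 / ((k : ℝ) + 1)) (m + k + 1),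
      |Y k x - y x| ≤ m / ((k : ℝ) + 1) := by
    intro k x hx
    have hx0 : 0 < x := lt_of_lt_of_le (by positivity) hx.1
    refine le_of_tendsto ((tendsto_const_nhds.sub (hy x hx0)).abs) ?_
    filter_upwards [eventually_ge_atTop k] with l hl
    exact hclose k l hl x hx
  refine ⟨y, fun s hs => ?_⟩
  have hpos : 0 < y s := lt_of_lt_of_le (by positivity) (hlowy s s hs le_rfl)
  refine ⟨hpos, ?_, ?_⟩
  · set a := s / 2 with ha
    set b := s + 1 with hb
    have ha0 : 0 < a := by positivity
    set η := min 1 (m / (4 * (b + 1))) with hη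
    have hη0 : 0 < η := by positivity
    refine hasDerivAt_of_tendstoUniformlyOn (l := atTop) (s := Ioo a b) isOpen_Ioo
      (f := Y) (f' := fun k x => 1 - m / x * cth (Y k x)) (g := y)
      (g' := fun x => 1 - m / x * cth (y x)) ?_ ?_ ?_ ?_
    · rw [Metric.tendstoUniformlyOn_iff]
      intro ε hε
      have h3 : Tendsto (fun k : ℕ => m / a * (cth η ^ 2 * (m / ((k : ℝ) + 1)))) atTop (nhds 0) := by
        simpa using (hsmall.const_mul (cth η ^ 2)).const_mul (m / a)
      filter_upwards [hev a (b + 1) ha0, h3.eventually_lt_const hε] with k hk hk2 x hx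
      have hx0 : 0 < x := ha0.trans hx.1
      refine lt_of_le_of_lt ?_ hk2
      have h4 := cth_lip hη0 (hlow b x hx0 hx.2.le k (hk.1.trans hx.1.le) hk.2)
        (hlowy b x hx0 hx.2.le)
      have h5 := hcl k x ⟨hk.1.trans hx.1.le, by linarith [hx.2, hk.2]⟩
      have h6 : m / x ≤ m / a := div_le_div_of_nonneg_left hm.le ha0 hx.1.le
      rw [Real.dist_eq, show (1 - m / x * cth (y x)) - (1 - m / x * cth (Y k x)) =
        m / x * (cth (Y k x) - cth (y x)) by ring, abs_mul, abs_of_pos (div_pos hm hx0)]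
      refine mul_le_mul h6 (h4.trans ?_) (abs_nonneg _) (by positivity)
      exact mul_le_mul_of_nonneg_left h5 (by positivity)
    · filter_upwards [hev a b ha0] with k hk x hx
      exact (hY k).der x ⟨hk.1.trans_lt hx.1, hx.2.trans_le hk.2⟩
    · exact fun x hx => hy x (ha0.trans hx.1)
    · exact ⟨by rw [ha]; linarith, by rw [hb]; linarith⟩
  · refine ge_of_tendsto ((cth_deriv hpos).continuousAt.tendsto.comp (hy s hs)) ?_
    filter_upwards [hev s s hs] with k hk
    exact (hY k).above s hk

lemma uniq {m : ℝ} (hm : 0 < m) {v w : ℝ → ℝ}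
    (hv : ∀ s : ℝ, 0 < s → HasDerivAt v ((1 - v s ^ 2) * (1 - m * v s / s)) s)
    (hw : ∀ s : ℝ, 0 < s → HasDerivAt w ((1 - w s ^ 2) * (1 - m * w s / s)) s)
    (hv1 : ∀ s : ℝ, 0 < s → 1 < v s) (hw1 : ∀ s : ℝ, 0 < s → 1 < w s)
    (hva : ∀ s, 0 < s → s / m ≤ v s) (hwa : ∀ s, 0 < s → s / m ≤ w s) :
    ∀ s, 0 < s → v s = w s := by
  let F : ℝ → ℝ := fun x => Real.log (x + 1) - Real.log (x - 1)
  have hF : ∀ x, 1 < x → HasDerivAt F (2 / (1 - x ^ 2)) x := by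
    intro x hx
    have h1 := ((hasDerivAt_id x).add_const 1).log (show id x + 1 ≠ 0 by simp; linarith)
    have h2 := ((hasDerivAt_id x).sub_const 1).log (show id x - 1 ≠ 0 by simp; linarith)
    refine HasDerivAt.congr_deriv (h1.sub h2) ?_
    have h3 : x + 1 ≠ 0 := by linarith
    have h4 : x - 1 ≠ 0 := by linarith
    have h5 : 1 - x ^ 2 ≠ 0 := by nlinarith
    simp only [id]
    field_simp
    ring
  have hFe : ∀ x, 1 < x → F x = Real.log (1 + 2 / (x - 1)) := by
    intro x hx
    have h4 : x - 1 ≠ 0 := by linarith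
    show Real.log (x + 1) - Real.log (x - 1) = _
    rw [← Real.log_div (by linarith) h4]
    congr 1
    field_simp
    ring
  have hFanti : ∀ x y, 1 < x → x < y → F y < F x := by
    intro x y hx hxy
    rw [hFe x hx, hFe y (hx.trans hxy)]
    have h0 : 0 < 2 / (y - 1) := div_pos two_pos (by linarith)
    refine Real.log_lt_log (by linarith) ?_
    have := div_lt_div_of_pos_left (two_pos (α := ℝ)) (show 0 < x - 1 by linarith)
      (show x - 1 < y - 1 by linarith)
    linarith
  have hFb : ∀ x, 1 < x → 0 ≤ F x ∧ F x ≤ 2 / (x - 1) := by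
    intro x hx
    have h0 : 0 < 2 / (x - 1) := div_pos two_pos (by linarith)
    rw [hFe x hx]
    refine ⟨Real.log_nonneg (by linarith), ?_⟩
    have := Real.log_le_sub_one_of_pos (show 0 < 1 + 2 / (x - 1) by linarith)
    linarith
  have hcomp : ∀ u : ℝ → ℝ, (∀ s : ℝ, 0 < s → HasDerivAt u ((1 - u s ^ 2) * (1 - m * u s / s)) s) →
      (∀ s : ℝ, 0 < s → 1 < u s) → ∀ s, 0 < s →
      HasDerivAt (fun x => F (u x)) (2 * (1 - m * u s / s)) s := by
    intro u hu hu1 s hs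
    refine HasDerivAt.congr_deriv ((hF _ (hu1 s hs)).comp s (hu s hs)) ?_
    have h5 : 1 - u s ^ 2 ≠ 0 := by nlinarith [hu1 s hs]
    field_simp
  have hFlim : ∀ u : ℝ → ℝ, (∀ s : ℝ, 0 < s → 1 < u s) → (∀ s, 0 < s → s / m ≤ u s) →
      Tendsto (fun x => F (u x)) atTop (nhds 0) := by
    intro u hu1 hua
    have h1 : Tendsto u atTop atTop := by
      refine tendsto_atTop_mono' _ ?_ (tendsto_id.atTop_div_const hm)
      filter_upwards [eventually_gt_atTop 0] with x hx using hua x hx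
    have h2 : Tendsto (fun x => 2 / (u x - 1)) atTop (nhds 0) :=
      (tendsto_atTop_add_const_right _ (-1) h1).const_div_atTop 2
    refine tendsto_of_tendsto_of_tendsto_of_le_of_le' tendsto_const_nhds h2 ?_ ?_
    · filter_upwards [eventually_gt_atTop 0] with x hx using (hFb _ (hu1 x hx)).1
    · filter_upwards [eventually_gt_atTop 0] with x hx using (hFb _ (hu1 x hx)).2
  have hD : ∀ s, 0 < s → HasDerivAt (fun x => (F (v x) - F (w x)) ^ 2)
      (2 * (F (v s) - F (w s)) * (2 * (1 - m * v s / s) - 2 * (1 - m * w s / s))) s := by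
    intro s hs
    refine HasDerivAt.congr_deriv (((hcomp v hv hv1 s hs).sub (hcomp w hw hw1 s hs)).pow 2) ?_
    simp
  intro s hs
  have hmono : ∀ t, s ≤ t → (F (v s) - F (w s)) ^ 2 ≤ (F (v t) - F (w t)) ^ 2 := by
    intro t hst
    refine le_of_der (f := fun x => (F (v x) - F (w x)) ^ 2) hst
      (fun x hx => (hD x (hs.trans_le hx.1)).continuousAt.continuousWithinAt)
      (fun x hx => hD x (hs.trans hx.1)) ?_
    intro x hx
    have hx0 : 0 < x := hs.trans hx.1
    rw [show 2 * (F (v x) - F (w x)) * (2 * (1 - m * v x / x) - 2 * (1 - m * w x / x)) =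
      4 * (m / x) * ((F (v x) - F (w x)) * (w x - v x)) by ring]
    refine mul_nonneg (by positivity) ?_
    rcases lt_trichotomy (v x) (w x) with h | h | h
    · exact mul_nonneg (by linarith [hFanti _ _ (hv1 x hx0) h]) (by linarith)
    · simp [h]
    · exact mul_nonneg_of_nonpos_of_nonpos (by linarith [hFanti _ _ (hw1 x hx0) h]) (by linarith)
  have hlim : Tendsto (fun t => (F (v t) - F (w t)) ^ 2) atTop (nhds 0) := by
    simpa using ((hFlim v hv1 hva).sub (hFlim w hw1 hwa)).pow 2
  have h0 : (F (v s) - F (w s)) ^ 2 ≤ 0 := by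
    refine ge_of_tendsto hlim ?_
    filter_upwards [eventually_ge_atTop s] with t ht using hmono t ht
  have h1 : F (v s) - F (w s) = 0 := by
    have := sq_nonneg (F (v s) - F (w s))
    exact pow_eq_zero_iff two_ne_zero |>.1 (le_antisymm h0 this)
  rcases lt_trichotomy (v s) (w s) with h | h | h
  · linarith [hFanti _ _ (hv1 s hs) h]
  · exact h
  · linarith [hFanti _ _ (hw1 s hs) h]

/-- Up to equality on `(0,∞)`, there is exactly one solution of `(★)`
defined on all of `(0,∞)` with values `> 1` and no critical points. -/
theorem unique_global_solution_above_one_without_critical_points (n : ℕ) (hn : 2 ≤ n) :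
    ∃ w : ℝ → ℝ,
      ((∀ s : ℝ, 0 < s →
          HasDerivAt w ((1 - w s ^ 2) * (1 - (n - 1 : ℝ) * w s / s)) s) ∧
        (∀ s : ℝ, 0 < s → 1 < w s) ∧
        (∀ s : ℝ, 0 < s → deriv w s ≠ 0)) ∧
      (∀ v : ℝ → ℝ,
        ((∀ s : ℝ, 0 < s →
            HasDerivAt v ((1 - v s ^ 2) * (1 - (n - 1 : ℝ) * v s / s)) s) ∧
          (∀ s : ℝ, 0 < s → 1 < v s) ∧
          (∀ s : ℝ, 0 < s → deriv v s ≠ 0)) →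
        ∀ s : ℝ, 0 < s → v s = w s) := by
  have hm : (0 : ℝ) < (n - 1 : ℝ) := by
    have : (2 : ℝ) ≤ n := by exact_mod_cast hn
    linarith
  generalize (n - 1 : ℝ) = m at hm ⊢
  obtain ⟨y, hy⟩ := exists_limit hm
  have hw : ∀ s : ℝ, 0 < s → HasDerivAt (fun x => cth (y x))
      ((1 - cth (y s) ^ 2) * (1 - m * cth (y s) / s)) s := by
    intro s hs
    obtain ⟨h1, h2, h3⟩ := hy s hs
    refine HasDerivAt.congr_deriv ((cth_deriv h1).comp s h2) ?_
    ring
  have hw1 : ∀ s : ℝ, 0 < s → 1 < cth (y s) := fun s hs => cth_gt (hy s hs).1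
  refine ⟨fun x => cth (y x), ⟨hw, hw1, ?_⟩, ?_⟩
  · intro s hs h0
    rw [(hw s hs).deriv] at h0
    have hd := hw s hs
    rw [h0] at hd
    have h1 : 1 - cth (y s) ^ 2 ≠ 0 := by nlinarith [hw1 s hs]
    have h2 : 1 - m * cth (y s) / s = 0 := (mul_eq_zero.1 h0).resolve_left h1
    have h3 : cth (y s) = s / m := by
      field_simp at h2 ⊢
      linarith
    have hmin : IsLocalMin (fun x => cth (y x) - x / m) s := by
      filter_upwards [Ioi_mem_nhds hs] with x hx
      have := (hy x hx).2.2
      rw [h3]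
      linarith
    have h4 := hmin.hasDerivAt_eq_zero (hd.sub ((hasDerivAt_id s).div_const m))
    have h5 : 0 < 1 / m := by positivity
    linarith
  · rintro v ⟨hv, hv1, hv0⟩
    refine uniq hm hv hw hv1 hw1 ?_ (fun s hs => (hy s hs).2.2)
    have hne : ∀ s, 0 < s → v s - s / m ≠ 0 := by
      intro s hs h
      apply hv0 s hs
      rw [(hv s hs).deriv]
      have : v s = s / m := by linarith
      have h2 : 1 - m * v s / s = 0 := by rw [this]; field_simp; simp
      rw [h2, mul_zero]
    intro s hs
    by_contra! hlt
    have hcont : ContinuousOn (fun x => v x - x / m) (Ioi 0) := fun x hx =>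
      ((hv x hx).continuousAt.sub (continuousAt_id.div_const m)).continuousWithinAt
    have hpos : 0 ≤ v m - m / m := by
      rw [div_self hm.ne']; linarith [hv1 m hm]
    obtain ⟨c, hc, hc0⟩ := isPreconnected_Ioi.intermediate_value (show s ∈ Ioi (0:ℝ) from hs)
      (show m ∈ Ioi (0:ℝ) from hm) hcont (show (0:ℝ) ∈ Icc (v s - s / m) (v m - m / m) from ⟨by linarith, hpos⟩)
    exact hne c hc hc0
end

section
/- Let n ≥ 2 be a natural number, let 0 < b ≤ ∞, and let w : (0, b) → ℝ be a solution of (★) with w(s) > 1 for every s ∈ (0, b). Then w(s) → 1 and w'(s) → 0 as s → 0⁺. -/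
open Set Filter

/-- Any solution of `(★)` on `(0, b)` (with `0 < b ≤ ∞`) whose values
stay above `1` satisfies `w(s) → 1` and `w'(s) → 0` as `s → 0⁺`. -/
theorem solution_above_one_limits_at_zero (n : ℕ) (hn : 2 ≤ n)
    (b : EReal) (hb : 0 < b) (w : ℝ → ℝ)
    (hode : ∀ s : ℝ, 0 < s → (s : EReal) < b →
      HasDerivAt w ((1 - w s ^ 2) * (1 - (n - 1 : ℝ) * w s / s)) s)
    (hbound : ∀ s : ℝ, 0 < s → (s : EReal) < b → 1 < w s) :
    Tendsto w (nhdsWithin 0 (Set.Ioi 0)) (nhds 1) ∧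
    Tendsto (deriv w) (nhdsWithin 0 (Set.Ioi 0)) (nhds 0) := by
  have hm : (1 : ℝ) ≤ (n : ℝ) - 1 := by
    have : (2 : ℝ) ≤ n := by exact_mod_cast hn
    linarith
  generalize (n : ℝ) - 1 = m at hode hm
  obtain ⟨r, hr0, hrb⟩ := EReal.lt_iff_exists_real_btwn.1 hb
  have hr0 : 0 < r := by exact_mod_cast hr0
  obtain ⟨c, hc0, hc1, hcr⟩ : ∃ c : ℝ, 0 < c ∧ c ≤ 1 ∧ c ≤ r :=
    ⟨min r 1, lt_min hr0 one_pos, min_le_right _ _, min_le_left _ _⟩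
  have hlt : ∀ s : ℝ, s ≤ c → (s : EReal) < b := fun s hs =>
    lt_of_le_of_lt (by exact_mod_cast hs.trans hcr) hrb
  have hd : ∀ s ∈ Ioc 0 c, HasDerivAt w ((1 - w s ^ 2) * (1 - m * w s / s)) s :=
    fun s hs => hode s hs.1 (hlt s hs.2)
  have h1 : ∀ s ∈ Ioc 0 c, 1 < w s := fun s hs => hbound s hs.1 (hlt s hs.2)
  have hq : ∀ s ∈ Ioc 0 c, 1 ≤ m * w s / s := by
    intro s hs
    rw [le_div_iff₀ hs.1]
    nlinarith [h1 s hs, hs.2]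
  have hmono : MonotoneOn w (Ioc 0 c) := by
    apply monotoneOn_of_deriv_nonneg (convex_Ioc 0 c)
    · exact fun s hs => (hd s hs).continuousAt.continuousWithinAt
    · exact fun s hs => (hd s (interior_subset hs)).differentiableAt.differentiableWithinAt
    · intro s hs
      have hs := interior_subset hs
      rw [(hd s hs).deriv]
      apply mul_nonneg_of_nonpos_of_nonpos
      · nlinarith [h1 s hs]
      · linarith [hq s hs]
  have hcm : c ∈ Ioc 0 c := ⟨hc0, le_rfl⟩
  set C := w c + 1 with hC
  have hwC : ∀ s ∈ Ioc 0 c, w s + 1 ≤ C := fun s hs => by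
    linarith [hmono hs hcm hs.2]
  have hg : ∀ s ∈ Ioc 0 c, HasDerivAt (fun s => (w s - 1) * Real.exp (C * s) / s ^ 2)
      (Real.exp (C * s) / s ^ 2 * ((w s - 1) *
        ((w s + 1) * (m * w s / s - 1) + C - 2 / s))) s := by
    intro s hs
    have hs0 : s ≠ 0 := hs.1.ne'
    have e1 := ((hd s hs).sub_const 1).mul (((hasDerivAt_id s).const_mul C).exp)
    have e2 := e1.div ((hasDerivAt_id s).pow 2) (by simpa using hs0)
    refine e2.congr_deriv ?_
    simp
    field_simp
    ring
  have hgm : MonotoneOn (fun s => (w s - 1) * Real.exp (C * s) / s ^ 2) (Ioc 0 c) := by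
    apply monotoneOn_of_deriv_nonneg (convex_Ioc 0 c)
    · exact fun s hs => (hg s hs).continuousAt.continuousWithinAt
    · exact fun s hs => (hg s (interior_subset hs)).differentiableAt.differentiableWithinAt
    · intro s hs
      have hs := interior_subset hs
      rw [(hg s hs).deriv]
      have hw := h1 s hs
      have : 2 / s ≤ (w s + 1) * (m * w s / s) := by
        rw [← mul_div_assoc]
        apply div_le_div_of_nonneg_right _ hs.1.le
        have : 1 ≤ m * w s := by nlinarith
        nlinarith
      refine mul_nonneg (by positivity) (mul_nonneg (by linarith) ?_)
      nlinarith [hwC s hs]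
  set K := (w c - 1) * Real.exp (C * c) / c ^ 2 with hK
  have hCpos : 0 < C := by linarith [h1 c hcm]
  have hu : ∀ s ∈ Ioc 0 c, w s - 1 ≤ K * s ^ 2 := by
    intro s hs
    have h := hgm hs hcm hs.2
    have hs2 : 0 < s ^ 2 := pow_pos hs.1 2
    simp only [← hK] at h
    rw [div_le_iff₀ hs2] at h
    have he : 1 ≤ Real.exp (C * s) := Real.one_le_exp (mul_pos hCpos hs.1).le
    nlinarith [h1 s hs]
  have hev : ∀ᶠ s in nhdsWithin (0 : ℝ) (Ioi 0), s ∈ Ioc 0 c :=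
    Ioc_mem_nhdsGT hc0
  constructor
  · have hlim : Tendsto (fun s : ℝ => 1 + K * s ^ 2) (nhdsWithin 0 (Ioi 0)) (nhds 1) := by
      have : Continuous (fun s : ℝ => 1 + K * s ^ 2) := by fun_prop
      simpa using (this.tendsto 0).mono_left nhdsWithin_le_nhds
    refine tendsto_of_tendsto_of_tendsto_of_le_of_le' tendsto_const_nhds hlim ?_ ?_
    · filter_upwards [hev] with s hs using (h1 s hs).le
    · filter_upwards [hev] with s hs using by linarith [hu s hs]
  · have hlim : Tendsto (fun s : ℝ => K * C * m * C * s) (nhdsWithin 0 (Ioi 0)) (nhds 0) := by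
      have : Continuous (fun s : ℝ => K * C * m * C * s) := by fun_prop
      simpa using (this.tendsto 0).mono_left nhdsWithin_le_nhds
    refine tendsto_of_tendsto_of_tendsto_of_le_of_le' tendsto_const_nhds hlim ?_ ?_
    · filter_upwards [hev] with s hs
      rw [(hd s hs).deriv]
      apply mul_nonneg_of_nonpos_of_nonpos
      · nlinarith [h1 s hs]
      · linarith [hq s hs]
    · filter_upwards [hev] with s hs
      rw [(hd s hs).deriv]
      have hw := h1 s hs
      have hs0 := hs.1
      have a1 : w s ^ 2 - 1 ≤ K * s ^ 2 * C := by
        have : (w s - 1) * (w s + 1) ≤ K * s ^ 2 * C :=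
          mul_le_mul (hu s hs) (hwC s hs) (by linarith) (by linarith [hu s hs])
        linarith
      have a2 : m * w s / s - 1 ≤ m * C / s := by
        have : m * w s / s ≤ m * C / s := by
          apply div_le_div_of_nonneg_right _ hs0.le
          nlinarith [hwC s hs]
        linarith
      have a3 : (w s ^ 2 - 1) * (m * w s / s - 1) ≤ K * s ^ 2 * C * (m * C / s) :=
        mul_le_mul a1 a2 (by linarith [hq s hs]) (by nlinarith)
      have a4 : K * s ^ 2 * C * (m * C / s) = K * C * m * C * s := by
        field_simp
      linarith
end
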